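/- arXiv:0903.4517 — 4 statements merged into one kernel-verified Lean document; each statement's English description precedes it below -/
import Mathlib

section
/- Let m be a square-free positive integer and O_{-m} the ring of integers of ℚ(√−m). Every finite subgroup of PSL_2(O_{-m}) is isomorphic to one of the following groups: the trivial group, the cyclic group ℤ/2, the cyclic group ℤ/3, the Klein four-group ℤ/2 × ℤ/2, the symmetric group S_3 on three letters, or the alternating group A_4 on four letters. -/
/-!
Group homology via the inhomogeneous bar complex (trivial coefficients).
-/

namespace BarHomology

/-- The `n`-th term of the inhomogeneous bar complex of `G` with trivial coefficients in `A`. -/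
abbrev chains (G : Type) (A : Type) [AddCommGroup A] (n : ℕ) : Type := (Fin n → G) →₀ A

/-- The differential of the inhomogeneous bar complex with trivial coefficients:
`d (g₁, …, g_{n+1}) = (g₂, …, g_{n+1}) + ∑_{j=1}^{n} (-1)^j (g₁, …, g_j g_{j+1}, …, g_{n+1})
  + (-1)^{n+1} (g₁, …, g_n)`. -/
noncomputable def d (k : Type) [CommRing k] (G : Type) [Group G] (A : Type) [AddCommGroup A]
    [Module k A] (n : ℕ) : chains G A (n + 1) →ₗ[k] chains G A n :=
  Finsupp.lsum k fun g =>
    (Finsupp.lsingle (fun i => g i.succ) : A →ₗ[k] chains G A n)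
      + ∑ j : Fin (n + 1),
          ((-1 : k) ^ ((j : ℕ) + 1)) • (Finsupp.lsingle (Fin.contractNth j (· * ·) g))

/-- The cycles: everything in degree `0`, the kernel of the differential in positive degrees. -/
noncomputable def cycles (k : Type) [CommRing k] (G : Type) [Group G] (A : Type) [AddCommGroup A]
    [Module k A] : (n : ℕ) → Submodule k (chains G A n)
  | 0 => ⊤
  | (n + 1) => LinearMap.ker (d k G A n)

/-- The boundaries, viewed as a submodule of the cycles. -/
noncomputable def boundariesIn (k : Type) [CommRing k] (G : Type) [Group G] (A : Type)
    [AddCommGroup A] [Module k A] (n : ℕ) : Submodule k (cycles k G A n) :=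
  (LinearMap.range (d k G A n)).comap (cycles k G A n).subtype

/-- Group homology of `G` in degree `n` with trivial coefficients in the `k`-module `A`,
defined as cycles modulo boundaries in the inhomogeneous bar complex. -/
abbrev GroupHomology (k : Type) [CommRing k] (G : Type) [Group G] (A : Type) [AddCommGroup A]
    [Module k A] (n : ℕ) : Type :=
  ↥(cycles k G A n) ⧸ boundariesIn k G A n

section Maps

variable {k : Type} [CommRing k] {G G' : Type} [Group G] [Group G'] {A : Type} [AddCommGroup A]
  [Module k A]

/-- The chain map induced by a group homomorphism. -/
noncomputable def chainsMap (k : Type) [CommRing k] (A : Type) [AddCommGroup A] [Module k A]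
    (φ : G →* G') (n : ℕ) : chains G A n →ₗ[k] chains G' A n :=
  Finsupp.lmapDomain A k (fun f => φ ∘ f)

lemma comp_contractNth (φ : G →* G') {n : ℕ} (j : Fin (n + 1)) (g : Fin (n + 1) → G) :
    φ ∘ Fin.contractNth j (· * ·) g = Fin.contractNth j (· * ·) (φ ∘ g) := by
  funext i
  rcases lt_trichotomy (i : ℕ) (j : ℕ) with h | h | h
  · simp [Function.comp_apply, Fin.contractNth_apply_of_lt _ _ _ _ h]
  · simp [Function.comp_apply, Fin.contractNth_apply_of_eq _ _ _ _ h, map_mul]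
  · simp [Function.comp_apply, Fin.contractNth_apply_of_gt _ _ _ _ h]

lemma chainsMap_comm (φ : G →* G') (n : ℕ) :
    (d k G' A n).comp (chainsMap k A φ (n + 1))
      = (chainsMap k A φ n).comp (d k G A n) := by
  apply Finsupp.lhom_ext
  intro g a
  simp only [LinearMap.comp_apply, chainsMap, Finsupp.lmapDomain_apply, Finsupp.mapDomain_single,
    d, Finsupp.lsum_single, LinearMap.add_apply, LinearMap.sum_apply, LinearMap.smul_apply,
    Finsupp.lsingle_apply, map_add, map_sum, map_smul]
  congr 1
  refine Finset.sum_congr rfl fun j _ => ?_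
  rw [comp_contractNth]

lemma chainsMap_mem_cycles (φ : G →* G') {n : ℕ} {x : chains G A n}
    (hx : x ∈ cycles k G A n) : chainsMap k A φ n x ∈ cycles k G' A n := by
  cases n with
  | zero => trivial
  | succ n =>
    simp only [cycles, LinearMap.mem_ker] at hx ⊢
    have := LinearMap.congr_fun (chainsMap_comm (k := k) (A := A) φ n) x
    simp only [LinearMap.comp_apply] at this
    rw [this, hx, map_zero]

/-- The map induced by a group homomorphism on cycles. -/
noncomputable def cyclesMap (k : Type) [CommRing k] (A : Type) [AddCommGroup A] [Module k A]
    (φ : G →* G') (n : ℕ) : ↥(cycles k G A n) →ₗ[k] ↥(cycles k G' A n) :=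
  (chainsMap k A φ n).restrict fun _ hx => chainsMap_mem_cycles φ hx

/-- The map induced by a group homomorphism on group homology with trivial coefficients. -/
noncomputable def inducedMap (k : Type) [CommRing k] (A : Type) [AddCommGroup A] [Module k A]
    (φ : G →* G') (n : ℕ) :
    GroupHomology k G A n →ₗ[k] GroupHomology k G' A n :=
  Submodule.mapQ (boundariesIn k G A n) (boundariesIn k G' A n) (cyclesMap k A φ n) (by
    rintro ⟨x, hx⟩ hb
    simp only [boundariesIn, Submodule.mem_comap, Submodule.subtype_apply,
      LinearMap.mem_range] at hb ⊢
    obtain ⟨w, hw⟩ := hb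
    refine ⟨chainsMap k A φ (n + 1) w, ?_⟩
    have := LinearMap.congr_fun (chainsMap_comm (k := k) (A := A) φ n) w
    simp only [LinearMap.comp_apply] at this
    rw [this, hw]
    rfl)

end Maps

end BarHomology

open BarHomology

/-- The projective special linear group `PSL₂(R)`, i.e. `SL₂(R)` modulo its center. -/
abbrev PSL2 (R : Type) [CommRing R] : Type :=
  Matrix.ProjectiveSpecialLinearGroup (Fin 2) R

section GroupTheory

variable {G : Type*} [Group G]

/-- The action of a group by conjugation on its involutions. -/
def conjInvolutions (G : Type*) [Group G] : G →* Equiv.Perm {x : G // orderOf x = 2} where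
  toFun g := (MulAut.conj g).toEquiv.subtypeEquiv fun x => by
    rw [MulEquiv.toEquiv_eq_coe, EquivLike.coe_coe, MulEquiv.orderOf_eq]
  map_one' := by ext; simp
  map_mul' g h := by ext; simp [mul_assoc]

lemma mem_ker_conjInvolutions {g : G} :
    g ∈ (conjInvolutions G).ker ↔ ∀ x : G, orderOf x = 2 → Commute g x := by
  rw [MonoidHom.mem_ker, Equiv.ext_iff, Subtype.forall]
  refine forall₂_congr fun x hx => ?_
  rw [Subtype.ext_iff]
  exact mul_inv_eq_iff_eq_mul

/-- In a group whose elements have order at most three, no element of order three commutes with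
an involution. -/
lemma not_commute_of_orderOf_le_three (hG : ∀ g : G, orderOf g ≤ 3) {g x : G}
    (hg : orderOf g = 3) (hx : orderOf x = 2) : ¬ Commute g x := by
  intro h
  have h6 := h.orderOf_mul_eq_mul_orderOf_of_coprime (by rw [hg, hx]; norm_num)
  have := hG (g * x)
  rw [h6, hg, hx] at this
  omega

lemma orderOf_eq_one_or_two_or_three [Finite G] (hG : ∀ g : G, orderOf g ≤ 3) (g : G) :
    orderOf g = 1 ∨ orderOf g = 2 ∨ orderOf g = 3 := by
  have := hG g
  have := orderOf_pos g
  omega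

lemma nonempty_mulEquiv_alternatingGroup_of_card_eq_twelve [Finite G] (hG : ∀ g : G, orderOf g ≤ 3)
    (h12 : Nat.card G = 12) (V : Subgroup G) [V.Normal] {x : G} (hxV : x ∈ V) (hx : orderOf x = 2)
    (hV : ∀ v ∈ V, v ^ 2 = 1) : Nonempty (G ≃* alternatingGroup (Fin 4)) := by
  have : Fact (Nat.Prime 3) := ⟨by norm_num⟩
  obtain ⟨g, hg⟩ := exists_prime_orderOf_dvd_card' (G := G) 3 (by rw [h12]; norm_num)
  set P := Subgroup.zpowers g with hP
  have hPcard : Nat.card P = 3 := by rw [hP, Nat.card_zpowers, hg]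
  have hidx : Nat.card (G ⧸ P) = 4 := by
    have := P.card_mul_index
    rw [hPcard, h12] at this
    rw [← Subgroup.index_eq_card]
    omega
  have hpow : ∀ k ∈ P, k ^ 3 = 1 := fun k hk => by
    have : (⟨k, hk⟩ : P) ^ 3 = 1 := hPcard ▸ pow_card_eq_one'
    simpa [Subtype.ext_iff] using this
  have hdisj : Disjoint P.normalCore V := by
    rw [Subgroup.disjoint_def]
    intro k hk hkV
    have h3 := hpow k (P.normalCore_le hk)
    rwa [pow_succ, hV k hkV, one_mul] at h3
  have hinj : Function.Injective (MulAction.toPermHom G (G ⧸ P)) := by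
    rw [← MonoidHom.ker_eq_bot_iff, ← Subgroup.normalCore_eq_ker, Subgroup.eq_bot_iff_forall]
    intro k hk
    by_contra hk1
    exact not_commute_of_orderOf_le_three hG
      (orderOf_eq_prime (hpow k (P.normalCore_le hk)) hk1) hx
      (Subgroup.commute_of_normal_of_disjoint _ _ inferInstance inferInstance hdisj k x hk hxV)
  let e : G ⧸ P ≃ Fin 4 := Finite.equivFinOfCardEq hidx
  let φ : G →* Equiv.Perm (Fin 4) := e.permCongrHom.toMonoidHom.comp (MulAction.toPermHom G (G ⧸ P))
  have hφ : Function.Injective φ := e.permCongrHom.injective.comp hinj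
  have hr : φ.range = alternatingGroup (Fin 4) := by
    apply Equiv.Perm.eq_alternatingGroup_of_index_eq_two
    have h1 := φ.range.card_mul_index
    rw [← Nat.card_congr (MonoidHom.ofInjective hφ).toEquiv, h12, Nat.card_perm, Nat.card_fin] at h1
    have : Nat.factorial 4 = 24 := rfl
    omega
  exact ⟨(MonoidHom.ofInjective hφ).trans (MulEquiv.subgroupCongr hr)⟩

/-- A finite group with exactly three involutions, all of whose elements have order at most three,
is the Klein four-group, `S₃` or `A₄`. -/
lemma nonempty_mulEquiv_of_card_involutions_eq_three [Finite G] (hG : ∀ g : G, orderOf g ≤ 3)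
    (h3 : Nat.card {x : G // orderOf x = 2} = 3) :
    Nonempty (G ≃* Multiplicative (ZMod 2 × ZMod 2)) ∨
    Nonempty (G ≃* Equiv.Perm (Fin 3)) ∨ Nonempty (G ≃* alternatingGroup (Fin 4)) := by
  have hcard : 4 ≤ Nat.card G := by
    have := Finite.card_subtype_lt (p := fun x : G => orderOf x = 2) (x := 1) (by simp)
    omega
  have hfact : Nat.factorial 3 = 6 := rfl
  have hperm : Nat.card (Equiv.Perm {x : G // orderOf x = 2}) = 6 := by
    rw [Nat.card_perm, h3, hfact]
  set V := (conjInvolutions G).ker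
  by_cases hker : V = ⊥
  · have hinj := (MonoidHom.ker_eq_bot_iff _).1 hker
    have hdvd := Subgroup.card_dvd_of_injective _ hinj
    rw [hperm] at hdvd
    have h6 : Nat.card G = 6 := by
      have := Nat.le_of_dvd (by norm_num) hdvd
      interval_cases Nat.card G <;> omega
    have hbij := (Nat.bijective_iff_injective_and_card (conjInvolutions G)).2
      ⟨hinj, h6.trans hperm.symm⟩
    exact Or.inr (Or.inl ⟨(MulEquiv.ofBijective _ hbij).trans
      (Finite.equivFinOfCardEq h3).permCongrHom⟩)
  · obtain ⟨⟨x₀, hx₀⟩⟩ : Nonempty {x : G // orderOf x = 2} :=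
      (Nat.card_pos_iff.1 (by omega)).1
    have hsq : ∀ v ∈ V, v ^ 2 = 1 := by
      intro v hv
      have hc := mem_ker_conjInvolutions.1 hv x₀ hx₀
      rcases orderOf_eq_one_or_two_or_three hG v with h | h | h
      · rw [orderOf_eq_one_iff.1 h, one_pow]
      · rw [← h, pow_orderOf_eq_one]
      · exact absurd hc (not_commute_of_orderOf_le_three hG h hx₀)
    obtain ⟨z, hzV, hz1⟩ := V.ne_bot_iff_exists_ne_one.1 hker |>.elim fun z hz =>
      (⟨z, z.2, by simpa using hz⟩ : ∃ z ∈ V, z ≠ 1)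
    have hz : orderOf z = 2 := orderOf_eq_prime (hsq z hzV) hz1
    have hzc := mem_ker_conjInvolutions.1 hzV
    classical
    have : Fintype {x : G // orderOf x = 2} := Fintype.ofFinite _
    have hinvol : ∀ x y : G, orderOf x = 2 → orderOf y = 2 → Commute x y := by
      intro x y hx hy
      by_cases hxz : x = z
      · exact hxz ▸ hzc y hy
      by_cases hyz : y = z
      · exact hyz ▸ (hzc x hx).symm
      have hzx : orderOf (z * x) = 2 := by
        apply orderOf_eq_prime
        · rw [(hzc x hx).mul_pow, hsq z hzV, one_mul, ← hx, pow_orderOf_eq_one]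
        · intro h
          apply hxz
          rw [eq_comm, mul_eq_one_iff_eq_inv.1 h, inv_eq_iff_mul_eq_one, ← sq, ← hx,
            pow_orderOf_eq_one]
      have hx1 : x ≠ 1 := by rintro rfl; simp at hx
      have huniv : ({⟨z, hz⟩, ⟨x, hx⟩, ⟨z * x, hzx⟩} : Finset {x : G // orderOf x = 2}) =
          Finset.univ := by
        apply Finset.eq_univ_of_card
        rw [← Nat.card_eq_fintype_card, h3]
        apply Finset.card_eq_three.2 ⟨_, _, _, _, _, _, rfl⟩ <;> simp [Ne.symm hxz, hx1, hz1]
      have hmem : (⟨y, hy⟩ : {x : G // orderOf x = 2}) ∈ Finset.univ := Finset.mem_univ _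
      rw [← huniv] at hmem
      simp only [Finset.mem_insert, Finset.mem_singleton, Subtype.mk.injEq] at hmem
      rcases hmem with h | h | h
      · exact absurd h hyz
      · exact h ▸ Commute.refl x
      · rw [h]
        exact (hzc x hx).symm.mul_right (Commute.refl x)
    have hmemV : ∀ x : G, orderOf x = 2 → x ∈ V := fun x hx =>
      mem_ker_conjInvolutions.2 fun y hy => hinvol x y hx hy
    have hVcard : Nat.card V = 4 := by
      have e : Option {x : G // orderOf x = 2} ≃ V := by
        refine (Equiv.optionSubtypeNe (1 : V)).symm.trans ?_ |>.symm
        refine Equiv.optionCongr ?_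
        exact
          { toFun := fun v => ⟨v.1, orderOf_eq_prime (hsq _ v.1.2) (by simpa using v.2)⟩
            invFun := fun x => ⟨⟨x, hmemV x x.2⟩, fun h => by
              have hx := x.2
              rw [Subtype.ext_iff.1 h] at hx
              simp at hx⟩
            left_inv := fun v => rfl
            right_inv := fun x => rfl }
      rw [← Nat.card_congr e, Finite.card_option, h3]
    have hmul : Nat.card V * Nat.card (conjInvolutions G).range = Nat.card G := by
      rw [← Subgroup.index_ker, Subgroup.card_mul_index]
    have hdvd := (conjInvolutions G).range.card_subgroup_dvd_card
    rw [hperm] at hdvd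
    have hodd : ¬ 2 ∣ Nat.card (conjInvolutions G).range := by
      intro h2
      obtain ⟨⟨p, hp⟩, hg⟩ := exists_prime_orderOf_dvd_card' 2 h2
      rw [Subgroup.orderOf_mk] at hg
      obtain ⟨g, rfl⟩ := hp
      have hdg : orderOf (conjInvolutions G g) ∣ orderOf g := orderOf_map_dvd _ g
      rw [hg] at hdg
      have h2g : orderOf g = 2 := by
        rcases orderOf_eq_one_or_two_or_three hG g with h | h | h <;> omega
      rw [show conjInvolutions G g = 1 from hmemV g h2g] at hg
      simp at hg
    have hle := Nat.le_of_dvd (by norm_num) hdvd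
    have hcases : Nat.card G = 4 ∨ Nat.card G = 12 := by
      rw [hVcard] at hmul
      interval_cases Nat.card (conjInvolutions G).range <;> omega
    rcases hcases with h4 | h12
    · have : IsKleinFour G := by
        refine ⟨h4, ?_⟩
        have hVtop : V = ⊤ := Subgroup.eq_top_of_card_eq _ (hVcard.trans h4.symm)
        refine (Nat.dvd_prime Nat.prime_two).1 (Monoid.exponent_dvd_of_forall_pow_eq_one fun g =>
          hsq g (hVtop ▸ Subgroup.mem_top g)) |>.resolve_left fun h => ?_
        have := Monoid.order_dvd_exponent z
        rw [h, hz] at this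
        omega
      exact Or.inl IsKleinFour.nonempty_mulEquiv
    · exact Or.inr (Or.inr
        (nonempty_mulEquiv_alternatingGroup_of_card_eq_twelve hG h12 V hzV hz hsq))

end GroupTheory

open scoped MatrixGroups

section Trace

lemma exists_eigenvalue_norm_one_of_isOfFinOrder {A : SL(2, ℂ)} (hA : IsOfFinOrder A) :
    ∃ ζ : ℂ, ‖ζ‖ = 1 ∧ ζ ^ 2 - (A : Matrix (Fin 2) (Fin 2) ℂ).trace * ζ + 1 = 0 := by
  obtain ⟨n, hn, hAn⟩ := isOfFinOrder_iff_pow_eq_one.1 hA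
  have hdet := A.det_coe
  obtain ⟨ζ, hζ⟩ := IsAlgClosed.exists_root (A : Matrix (Fin 2) (Fin 2) ℂ).charpoly
    (by rw [Matrix.charpoly_degree_eq_dim]; norm_num)
  have hroot : (A : Matrix (Fin 2) (Fin 2) ℂ).charpoly.eval ζ = 0 := hζ
  refine ⟨ζ, ?_, ?_⟩
  · rw [Matrix.eval_charpoly] at hroot
    obtain ⟨v, hv, hAv⟩ := Matrix.exists_mulVec_eq_zero_iff.2 hroot
    have hev : (A : Matrix (Fin 2) (Fin 2) ℂ).mulVec v = ζ • v := by
      rw [Matrix.sub_mulVec, sub_eq_zero] at hAv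
      rw [← hAv]
      ext i; simp [Matrix.scalar_apply, Matrix.mulVec_diagonal]
    have hpow : ∀ k : ℕ, ((A : Matrix (Fin 2) (Fin 2) ℂ) ^ k).mulVec v = ζ ^ k • v := by
      intro k
      induction k with
      | zero => simp
      | succ k ih => rw [pow_succ, ← Matrix.mulVec_mulVec, hev, Matrix.mulVec_smul, ih, smul_smul,
          pow_succ, mul_comm]
    have h := hpow n
    rw [← Matrix.SpecialLinearGroup.coe_pow, hAn, Matrix.SpecialLinearGroup.coe_one,
      Matrix.one_mulVec] at h
    have hone : ζ ^ n = 1 := by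
      have : (ζ ^ n - 1) • v = 0 := by rw [sub_smul, one_smul, ← h, sub_self]
      exact sub_eq_zero.1 ((smul_eq_zero.1 this).resolve_right hv)
    exact Complex.norm_eq_one_of_pow_eq_one hone hn.ne'
  · rw [Matrix.charpoly_fin_two, hdet] at hroot
    simpa using hroot

lemma exists_real_trace_eq_of_isOfFinOrder {A : SL(2, ℂ)} (hA : IsOfFinOrder A) :
    ∃ r : ℝ, |r| ≤ 2 ∧ (A : Matrix (Fin 2) (Fin 2) ℂ).trace = r := by
  obtain ⟨ζ, hnorm, hζ⟩ := exists_eigenvalue_norm_one_of_isOfFinOrder hA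
  have hζ0 : ζ ≠ 0 := by rintro rfl; simp at hnorm
  refine ⟨2 * ζ.re, ?_, ?_⟩
  · have := Complex.abs_re_le_norm ζ
    rw [abs_mul, abs_two]
    linarith
  · have hconj : ζ * (starRingEnd ℂ) ζ = 1 := by
      rw [Complex.mul_conj, Complex.normSq_eq_norm_sq, hnorm]; simp
    have htr : (A : Matrix (Fin 2) (Fin 2) ℂ).trace = ζ + (starRingEnd ℂ) ζ := by
      apply mul_right_cancel₀ hζ0
      linear_combination -hζ - hconj
    rw [htr, Complex.add_conj]

/-- An element of an imaginary quadratic field which is real is rational. -/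
lemma mem_range_algebraMap_of_conj_eq {K : Type*} [Field K] [NumberField K]
    (hdeg : Module.finrank ℚ K = 2) {m : ℕ} (hm : 0 < m) {α : K} (hα : α ^ 2 = -(m : K))
    (φ : K →ₐ[ℚ] ℂ) {x : K} (hx : (starRingEnd ℂ) (φ x) = φ x) :
    x ∈ Set.range (algebraMap ℚ K) := by
  have := Subalgebra.isSimpleOrder_of_finrank_prime ℚ K (by rw [hdeg]; exact Nat.prime_two)
  let conjAlg : ℂ →ₐ[ℚ] ℂ := (starRingEnd ℂ).toRatAlgHom
  let S : Subalgebra ℚ K := AlgHom.equalizer (conjAlg.comp φ) φ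
  have hxS : x ∈ S := hx
  rcases eq_bot_or_eq_top S with h | h
  · rw [h] at hxS
    exact Algebra.mem_bot.1 hxS
  · exfalso
    have hαS : α ∈ S := h ▸ Algebra.mem_top
    have hreal : (starRingEnd ℂ) (φ α) = φ α := hαS
    obtain ⟨r, hr⟩ := Complex.conj_eq_iff_real.1 hreal
    have hsq : ((r ^ 2 : ℝ) : ℂ) = ((-(m : ℝ) : ℝ) : ℂ) := by
      push_cast
      rw [← hr, ← map_pow, hα]
      simp
    have hsq' : r ^ 2 = -(m : ℝ) := by exact_mod_cast hsq
    have : (0 : ℝ) < m := by exact_mod_cast hm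
    nlinarith [sq_nonneg r]

open NumberField in
lemma exists_int_trace_eq_of_isOfFinOrder {K : Type*} [Field K] [NumberField K]
    (hdeg : Module.finrank ℚ K = 2) {m : ℕ} (hm : 0 < m) {α : K} (hα : α ^ 2 = -(m : K))
    {g : SL(2, 𝓞 K)} (hg : IsOfFinOrder g) :
    ∃ n : ℤ, |n| ≤ 2 ∧ (g : Matrix (Fin 2) (Fin 2) (𝓞 K)).trace = n := by
  let φ : K →ₐ[ℚ] ℂ := (Classical.arbitrary (K →+* ℂ)).toRatAlgHom
  let ψ : 𝓞 K →+* ℂ := (φ : K →+* ℂ).comp (algebraMap (𝓞 K) K)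
  obtain ⟨r, hr2, hr⟩ := exists_real_trace_eq_of_isOfFinOrder
    ((Matrix.SpecialLinearGroup.map (n := Fin 2) ψ).isOfFinOrder hg)
  set t := (g : Matrix (Fin 2) (Fin 2) (𝓞 K)).trace with ht
  have hφt : φ t = r := by
    rw [← hr, ht]
    simp [Matrix.trace_fin_two, ψ]
  obtain ⟨q, hq⟩ := mem_range_algebraMap_of_conj_eq hdeg hm hα φ (x := (t : K)) (by
    rw [hφt, Complex.conj_ofReal])
  have hint : IsIntegral ℤ q := by
    rw [← isIntegral_algebraMap_iff (algebraMap ℚ K).injective, hq]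
    exact t.isIntegral_coe
  obtain ⟨n, hn⟩ := IsIntegrallyClosed.isIntegral_iff.1 hint
  have htn : (t : K) = (n : K) := by rw [← hq, ← hn]; simp
  refine ⟨n, ?_, ?_⟩
  · have hnr : ((n : ℝ) : ℂ) = r := by rw [← hφt, htn]; simp
    have hnr' : (n : ℝ) = r := by exact_mod_cast hnr
    rw [← hnr'] at hr2
    exact_mod_cast hr2
  · apply RingOfIntegers.coe_injective
    change (t : K) = _
    rw [htn]; simp

end Trace

section PSL

variable {R : Type*} [CommRing R]

lemma sq_eq_trace_smul_sub_one (g : SL(2, R)) :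
    (g : Matrix (Fin 2) (Fin 2) R) ^ 2 =
      (g : Matrix (Fin 2) (Fin 2) R).trace • (g : Matrix (Fin 2) (Fin 2) R) - 1 := by
  have h := Matrix.aeval_self_charpoly (g : Matrix (Fin 2) (Fin 2) R)
  nontriviality R
  rw [Matrix.charpoly_fin_two, g.det_coe] at h
  simp only [map_add, map_sub, map_pow, map_mul, Polynomial.aeval_X, Polynomial.aeval_C, map_one,
    Algebra.algebraMap_eq_smul_one, smul_mul_assoc, one_mul] at h
  rw [← sub_eq_zero, ← h]
  abel

lemma mem_center_iff_eq_one_or_neg_one [IsDomain R] {g : SL(2, R)} :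
    g ∈ Subgroup.center SL(2, R) ↔ g = 1 ∨ g = -1 := by
  rw [Matrix.SpecialLinearGroup.mem_center_iff]
  constructor
  · rintro ⟨r, hr, h⟩
    rw [Fintype.card_fin, sq_eq_one_iff] at hr
    rcases hr with rfl | rfl
    · left; ext i j; rw [← h]; simp
    · right; ext i j; rw [Matrix.SpecialLinearGroup.coe_neg, ← h]; rw [map_neg, map_one]; simp
  · rintro (rfl | rfl)
    · exact ⟨1, by simp, by simp⟩
    · exact ⟨-1, by simp, by rw [map_neg, map_one]; simp⟩

lemma eq_one_of_isOfFinOrder_of_trace_eq_two [IsDomain R] [CharZero R] {g : SL(2, R)}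
    (hg : IsOfFinOrder g) (ht : (g : Matrix (Fin 2) (Fin 2) R).trace = 2) : g = 1 := by
  obtain ⟨n, hn, hgn⟩ := isOfFinOrder_iff_pow_eq_one.1 hg
  have hsq := sq_eq_trace_smul_sub_one g
  rw [ht] at hsq
  set A := (g : Matrix (Fin 2) (Fin 2) R) with hA
  have hpow : ∀ k : ℕ, A ^ k = 1 + (k : R) • (A - 1) := by
    intro k
    induction k with
    | zero => simp
    | succ k ih =>
      rw [pow_succ, ih, add_mul, one_mul, smul_mul_assoc, sub_mul, one_mul, ← sq, hsq]
      push_cast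
      module
  have h := hpow n
  rw [hA, ← Matrix.SpecialLinearGroup.coe_pow, hgn, Matrix.SpecialLinearGroup.coe_one, ← hA,
    left_eq_add, smul_eq_zero, Nat.cast_eq_zero] at h
  apply Subtype.ext
  exact sub_eq_zero.1 (h.resolve_left hn.ne')

/-- The square of the trace of a matrix in `SL₂` of finite order with integral trace, in terms of
the order of its image in `PSL₂`. -/
lemma orderOf_mk_of_trace_eq_int [IsDomain R] [CharZero R] {g : SL(2, R)}
    (hg : IsOfFinOrder g) {n : ℤ} (hn : |n| ≤ 2)
    (ht : (g : Matrix (Fin 2) (Fin 2) R).trace = n) :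
    (orderOf (QuotientGroup.mk g : SL(2, R) ⧸ Subgroup.center SL(2, R)) = 1 ∧ n ^ 2 = 4) ∨
    (orderOf (QuotientGroup.mk g : SL(2, R) ⧸ Subgroup.center SL(2, R)) = 2 ∧ n ^ 2 = 0) ∨
    (orderOf (QuotientGroup.mk g : SL(2, R) ⧸ Subgroup.center SL(2, R)) = 3 ∧ n ^ 2 = 1) := by
  have hsq := sq_eq_trace_smul_sub_one g
  rw [ht] at hsq
  have hone : ∀ x : SL(2, R), (QuotientGroup.mk x : SL(2, R) ⧸ Subgroup.center SL(2, R)) = 1 ↔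
      x = 1 ∨ x = -1 := fun x => by
    rw [QuotientGroup.eq_one_iff, mem_center_iff_eq_one_or_neg_one]
  have hne : n ^ 2 ≠ 4 → (QuotientGroup.mk g : SL(2, R) ⧸ Subgroup.center SL(2, R)) ≠ 1 := by
    intro hn4 h
    apply hn4
    have : (n : R) ^ 2 = 4 := by
      rw [← ht]
      rcases (hone g).1 h with rfl | rfl <;> simp <;> norm_num
    exact_mod_cast this
  have : Fact (Nat.Prime 2) := ⟨Nat.prime_two⟩
  have : Fact (Nat.Prime 3) := ⟨Nat.prime_three⟩
  have hcube : ∀ A : Matrix (Fin 2) (Fin 2) R, A ^ 2 = (n : R) • A - 1 →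
      A ^ 3 = ((n : R) ^ 2 - 1) • A - (n : R) • 1 := by
    intro A hA
    rw [pow_succ, hA, sub_mul, smul_mul_assoc, one_mul, ← sq, hA]
    module
  have hcb := hcube _ hsq
  obtain ⟨hl, hu⟩ := abs_le.1 hn
  interval_cases n
  · left
    refine ⟨orderOf_eq_one_iff.2 ((hone g).2 (Or.inr ?_)), by norm_num⟩
    rw [← neg_eq_iff_eq_neg]
    apply eq_one_of_isOfFinOrder_of_trace_eq_two
    · obtain ⟨k, hk, hgk⟩ := isOfFinOrder_iff_pow_eq_one.1 hg
      refine isOfFinOrder_iff_pow_eq_one.2 ⟨2 * k, by omega, ?_⟩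
      rw [pow_mul, neg_sq, ← pow_mul, mul_comm, pow_mul, hgk, one_pow]
    · rw [Matrix.SpecialLinearGroup.coe_neg, Matrix.trace_neg, ht]; norm_num
  · right; right
    refine ⟨orderOf_eq_prime ?_ (hne (by norm_num)), by norm_num⟩
    rw [← QuotientGroup.mk_pow, hone]
    left
    apply Subtype.ext
    simpa using hcb
  · right; left
    refine ⟨orderOf_eq_prime ?_ (hne (by norm_num)), by norm_num⟩
    rw [← QuotientGroup.mk_pow, hone]
    right
    apply Subtype.ext
    simpa using hsq
  · right; right
    refine ⟨orderOf_eq_prime ?_ (hne (by norm_num)), by norm_num⟩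
    rw [← QuotientGroup.mk_pow, hone]
    right
    apply Subtype.ext
    simpa using hcb
  · left
    refine ⟨orderOf_eq_one_iff.2 ((hone g).2 (Or.inl ?_)), by norm_num⟩
    exact eq_one_of_isOfFinOrder_of_trace_eq_two hg (by rw [ht]; norm_num)

lemma isOfFinOrder_of_mk [IsDomain R] {g : SL(2, R)}
    (hg : IsOfFinOrder (QuotientGroup.mk g : SL(2, R) ⧸ Subgroup.center SL(2, R))) :
    IsOfFinOrder g := by
  obtain ⟨n, hn, hgn⟩ := isOfFinOrder_iff_pow_eq_one.1 hg
  rw [← QuotientGroup.mk_pow, QuotientGroup.eq_one_iff, mem_center_iff_eq_one_or_neg_one] at hgn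
  refine isOfFinOrder_iff_pow_eq_one.2 ⟨n * 2, by omega, ?_⟩
  rw [pow_mul]
  rcases hgn with h | h <;> rw [h] <;> simp

end PSL

section Adjoint

variable {R : Type*} [CommRing R] (F : Type*) [Field F] [Algebra R F]

/-- The representation of `SL₂(R)` on the `2 × 2` matrices over an `R`-field, by conjugation. -/
def adjointRep : Representation F SL(2, R) (Matrix (Fin 2) (Fin 2) F) where
  toFun g :=
    LinearMap.mulLeft F (Matrix.SpecialLinearGroup.map (algebraMap R F) g).1 ∘ₗ
      LinearMap.mulRight F (Matrix.SpecialLinearGroup.map (algebraMap R F) g⁻¹).1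
  map_one' := by ext; simp
  map_mul' g h := by
    apply LinearMap.ext
    intro X
    simp only [map_mul, mul_inv_rev, Module.End.mul_apply, LinearMap.comp_apply,
      LinearMap.mulLeft_apply, LinearMap.mulRight_apply, Matrix.SpecialLinearGroup.coe_mul,
      mul_assoc]

lemma adjointRep_apply (g : SL(2, R)) (X : Matrix (Fin 2) (Fin 2) F) :
    adjointRep F g X = (Matrix.SpecialLinearGroup.map (algebraMap R F) g).1 *
      (X * (Matrix.SpecialLinearGroup.map (algebraMap R F) g⁻¹).1) := rfl

lemma trace_adjointRep (g : SL(2, R)) :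
    LinearMap.trace F _ (adjointRep F g) =
      algebraMap R F (g : Matrix (Fin 2) (Fin 2) R).trace ^ 2 := by
  rw [LinearMap.trace_eq_matrix_trace F (Matrix.stdBasis F (Fin 2) (Fin 2)), Matrix.trace]
  simp [Fintype.sum_prod_type, LinearMap.toMatrix_apply, adjointRep_apply, Matrix.stdBasis,
    Matrix.mul_apply, Matrix.trace_fin_two, Matrix.SpecialLinearGroup.coe_inv,
    Matrix.adjugate_fin_two]
  ring

lemma center_le_ker_adjointRep :
    Subgroup.center SL(2, R) ≤ MonoidHom.ker (adjointRep (R := R) F) := by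
  intro c hc
  obtain ⟨r, -, hr⟩ := Matrix.SpecialLinearGroup.mem_center_iff.1 hc
  rw [MonoidHom.mem_ker]
  apply LinearMap.ext
  intro X
  have hcX : (Matrix.SpecialLinearGroup.map (algebraMap R F) c).1 * X =
      X * (Matrix.SpecialLinearGroup.map (algebraMap R F) c).1 := by
    have : (Matrix.SpecialLinearGroup.map (algebraMap R F) c).1 =
        Matrix.scalar (Fin 2) (algebraMap R F r) := by
      rw [Matrix.SpecialLinearGroup.map_apply_coe, ← hr]
      ext i j
      by_cases h : i = j <;> simp [h]
    rw [this]
    exact (Matrix.scalar_commute _ (fun _ => Commute.all _ _) X).eq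
  rw [adjointRep_apply, ← mul_assoc, hcX, mul_assoc, ← Matrix.SpecialLinearGroup.coe_mul,
    ← map_mul, mul_inv_cancel, map_one, Matrix.SpecialLinearGroup.coe_one, mul_one]
  rfl

/-- The representation of `PSL₂(R)` on the `2 × 2` matrices over an `R`-field, by conjugation. -/
def projectiveAdjointRep :
    Representation F (SL(2, R) ⧸ Subgroup.center SL(2, R)) (Matrix (Fin 2) (Fin 2) F) :=
  QuotientGroup.lift _ (adjointRep F) (center_le_ker_adjointRep F)

lemma trace_projectiveAdjointRep_mk (g : SL(2, R)) :
    LinearMap.trace F _ (projectiveAdjointRep F (QuotientGroup.mk g)) =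
      algebraMap R F (g : Matrix (Fin 2) (Fin 2) R).trace ^ 2 :=
  trace_adjointRep F g

lemma one_mem_invariants_projectiveAdjointRep
    (H : Subgroup (SL(2, R) ⧸ Subgroup.center SL(2, R))) :
    (1 : Matrix (Fin 2) (Fin 2) F) ∈
      Representation.invariants ((projectiveAdjointRep F).comp H.subtype) := by
  rintro ⟨h, hh⟩
  obtain ⟨g, rfl⟩ := QuotientGroup.mk_surjective h
  change adjointRep F g 1 = 1
  rw [adjointRep_apply, one_mul, ← Matrix.SpecialLinearGroup.coe_mul, ← map_mul, mul_inv_cancel,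
    map_one, Matrix.SpecialLinearGroup.coe_one]

end Adjoint

/-- The sum of the character of a representation of a finite group in characteristic zero is the
order of the group times the dimension of the invariants. -/
lemma sum_trace_eq_card_mul_finrank_invariants {F G V : Type*} [Field F] [CharZero F] [Group G]
    [Fintype G] [AddCommGroup V] [Module F V] [FiniteDimensional F V] (ρ : Representation F G V) :
    ∑ g, LinearMap.trace F V (ρ g) = Fintype.card G * Module.finrank F ρ.invariants := by
  have hcard : (Fintype.card G : F) ≠ 0 := by exact_mod_cast Fintype.card_ne_zero
  let : Invertible (Fintype.card G : F) := invertibleOfNonzero hcard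
  have h := ρ.isProj_averageMap.trace
  have h' : ρ.averageMap = (Fintype.card G : F)⁻¹ • ∑ g, ρ g := by
    simp [Representation.averageMap, GroupAlgebra.average]
  rw [← h, h', map_smul, map_sum, smul_eq_mul, mul_inv_cancel_left₀ hcard]

section Bianchi

variable {K : Type*} [Field K] [NumberField K]

open NumberField

open Classical in
/-- The order and the adjoint character of an element of finite order in a Bianchi group. -/
lemma orderOf_le_three_and_trace_projectiveAdjointRep (hdeg : Module.finrank ℚ K = 2) {m : ℕ}
    (hm : 0 < m) {α : K} (hα : α ^ 2 = -(m : K))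
    {h : Matrix.ProjectiveSpecialLinearGroup (Fin 2) (𝓞 K)} (hh : IsOfFinOrder h) :
    orderOf h ≤ 3 ∧ LinearMap.trace K _ (projectiveAdjointRep K h) =
      1 + (if h = 1 then 3 else 0) - (if orderOf h = 2 then 1 else 0) := by
  obtain ⟨g, rfl⟩ := QuotientGroup.mk_surjective h
  have hg := isOfFinOrder_of_mk hh
  obtain ⟨n, hn, ht⟩ := exists_int_trace_eq_of_isOfFinOrder hdeg hm hα hg
  have hsq : ∀ k : ℤ, n ^ 2 = k →
      LinearMap.trace K _ (projectiveAdjointRep K (QuotientGroup.mk g)) = (k : K) := by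
    rintro k rfl
    rw [trace_projectiveAdjointRep_mk, ht]
    simp
  have hone := (orderOf_eq_one_iff
    (x := (QuotientGroup.mk g : Matrix.ProjectiveSpecialLinearGroup (Fin 2) (𝓞 K)))).symm
  rcases orderOf_mk_of_trace_eq_int hg hn ht with ⟨ho, h⟩ | ⟨ho, h⟩ | ⟨ho, h⟩ <;>
    simp only [hsq _ h, hone, ho] <;> norm_num

/-- The number of involutions in a finite subgroup of a Bianchi group. -/
lemma exists_card_add_three_eq (hdeg : Module.finrank ℚ K = 2) {m : ℕ} (hm : 0 < m) {α : K}
    (hα : α ^ 2 = -(m : K)) (H : Subgroup (Matrix.ProjectiveSpecialLinearGroup (Fin 2) (𝓞 K)))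
    [Finite H] :
    ∃ d : ℕ, 0 < d ∧ Nat.card H + 3 = Nat.card H * d + Nat.card {x : H // orderOf x = 2} := by
  classical
  have : Fintype H := Fintype.ofFinite H
  let ρ : Representation K H (Matrix (Fin 2) (Fin 2) K) :=
    (projectiveAdjointRep K).comp H.subtype
  refine ⟨Module.finrank K ρ.invariants, ?_, ?_⟩
  · have : Nontrivial ρ.invariants :=
      ⟨⟨1, one_mem_invariants_projectiveAdjointRep K H⟩, 0, by simp [Subtype.ext_iff]⟩
    exact Module.finrank_pos
  · have hsum := sum_trace_eq_card_mul_finrank_invariants ρ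
    have hval : ∀ h : H, LinearMap.trace K _ (ρ h) =
        1 + (if h = 1 then 3 else 0) - (if orderOf h = 2 then 1 else 0) := by
      intro h
      have := (orderOf_le_three_and_trace_projectiveAdjointRep hdeg hm hα
        (Submonoid.isOfFinOrder_coe.2 (isOfFinOrder_of_finite h))).2
      simpa [ρ] using this
    rw [Finset.sum_congr rfl fun h _ => hval h, Finset.sum_sub_distrib, Finset.sum_add_distrib,
      Finset.sum_ite_eq' Finset.univ (1 : H), Finset.sum_boole] at hsum
    simp only [Finset.mem_univ, if_true, Finset.sum_const, Finset.card_univ, nsmul_eq_mul,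
      mul_one] at hsum
    rw [Nat.card_eq_fintype_card (α := H), Nat.card_eq_fintype_card,
      Fintype.card_subtype (fun x : H => orderOf x = 2)]
    rw [sub_eq_iff_eq_add] at hsum
    exact_mod_cast hsum

end Bianchi

/-- Every finite subgroup of a Bianchi group `PSL₂(𝒪₋ₘ)` is isomorphic to the trivial group,
`ℤ/2`, `ℤ/3`, the Klein four-group, `S₃` or `A₄`. -/
theorem finite_subgroups_of_Bianchi
    (m : ℕ) (hm : 0 < m) (hsf : Squarefree m)
    (K : Type) [Field K] [NumberField K]
    (hdeg : Module.finrank ℚ K = 2) (hK : ∃ α : K, α ^ 2 = -(m : K))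
    (H : Subgroup (PSL2 (NumberField.RingOfIntegers K))) (hH : Finite H) :
    Nonempty (H ≃* PUnit) ∨
    Nonempty (H ≃* Multiplicative (ZMod 2)) ∨
    Nonempty (H ≃* Multiplicative (ZMod 3)) ∨
    Nonempty (H ≃* Multiplicative (ZMod 2 × ZMod 2)) ∨
    Nonempty (H ≃* Equiv.Perm (Fin 3)) ∨
    Nonempty (H ≃* alternatingGroup (Fin 4)) := by
  obtain ⟨α, hα⟩ := hK
  have hord : ∀ h : H, orderOf h ≤ 3 := fun h => by
    rw [← Subgroup.orderOf_coe]
    exact (orderOf_le_three_and_trace_projectiveAdjointRep hdeg hm hα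
      (Submonoid.isOfFinOrder_coe.2 (isOfFinOrder_of_finite h))).1
  obtain ⟨d, hd, hcount⟩ : ∃ d : ℕ, 0 < d ∧
      Nat.card H + 3 = Nat.card H * d + Nat.card {x : H // orderOf x = 2} :=
    exists_card_add_three_eq hdeg hm hα H
  have hpos : 0 < Nat.card H := Nat.card_pos
  rcases (show d = 1 ∨ 2 ≤ d by omega) with rfl | hd2
  · have := nonempty_mulEquiv_of_card_involutions_eq_three hord (by omega)
    tauto
  · have hle : Nat.card H ≤ 3 := by nlinarith
    interval_cases hn : Nat.card H
    · left
      have := (Nat.card_eq_one_iff_unique.1 hn).1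
      let : Unique H := ⟨⟨1⟩, fun _ => Subsingleton.elim _ _⟩
      exact ⟨MulEquiv.ofUnique⟩
    · have : Fact (Nat.Prime 2) := ⟨Nat.prime_two⟩
      exact Or.inr (Or.inl ⟨mulEquivOfPrimeCardEq (p := 2) hn (by simp)⟩)
    · have : Fact (Nat.Prime 3) := ⟨Nat.prime_three⟩
      exact Or.inr (Or.inr (Or.inl ⟨mulEquivOfPrimeCardEq (p := 3) hn (by simp)⟩))
end

section
/- For the Klein four-group D_2 = ℤ/2 × ℤ/2 and every positive integer q, the integral group homology with trivial ℤ-coefficients satisfies, as abelian groups: H_q(D_2; ℤ) ≅ (ℤ/2)^{(q+3)/2} when q is odd, and H_q(D_2; ℤ) ≅ (ℤ/2)^{q/2} when q is even and q > 0. -/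
section

open BarHomology CategoryTheory MonoidAlgebra

/-- The homology of a chain complex of modules in positive degree, computed from a levelwise
isomorphic sequence of modules and maps. -/
lemma nonempty_homology_succ_equiv {k : Type} [CommRing k] (K : ChainComplex (ModuleCat.{0} k) ℕ)
    {M : ℕ → Type} [∀ n, AddCommGroup (M n)] [∀ n, Module k (M n)]
    (δ : ∀ n, M (n + 1) →ₗ[k] M n) (e : ∀ n, K.X n ≃ₗ[k] M n)
    (comm : ∀ n x, e n (K.d (n + 1) n x) = δ n (e (n + 1) x)) (n : ℕ) :
    Nonempty (K.homology (n + 1) ≃ₗ[k]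
      (LinearMap.ker (δ n) ⧸
        (LinearMap.range (δ (n + 1))).comap (LinearMap.ker (δ n)).subtype)) := by
  let S := K.sc' (n + 2) (n + 1) n
  have hker : (LinearMap.ker S.g.hom).map (e (n + 1)).toLinearMap = LinearMap.ker (δ n) := by
    ext y
    constructor
    · rintro ⟨x, hx, rfl⟩
      exact (comm n x).symm.trans ((congrArg (e n) hx).trans (map_zero (e n)))
    · intro hy
      obtain ⟨x, rfl⟩ := (e (n + 1)).surjective y
      exact ⟨x, (e n).map_eq_zero_iff.1 ((comm n x).trans hy), rfl⟩
  refine ⟨(ShortComplex.homologyMapIso (K.isoSc' (n + 2) (n + 1) n (by simp) (by simp)) ≪≫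
    S.moduleCatHomologyIso).toLinearEquiv ≪≫ₗ
      Submodule.Quotient.equiv _ _ ((e (n + 1)).ofSubmodules _ _ hker) ?_⟩
  ext ⟨y, hy⟩
  constructor
  · rintro ⟨_, ⟨x, rfl⟩, h⟩
    exact ⟨e (n + 2) x, (comm (n + 1) x).symm.trans (congrArg Subtype.val h)⟩
  · rintro ⟨x, h⟩
    obtain ⟨x, rfl⟩ := (e (n + 2)).surjective x
    exact ⟨_, ⟨x, rfl⟩, Subtype.ext ((comm (n + 1) x).trans h)⟩

/-- Mathlib's group homology agrees with the homology of the bar complex in positive degrees. -/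
lemma nonempty_groupHomology_equiv (k G : Type) [CommRing k] [Group G] (n : ℕ) :
    Nonempty (groupHomology (Rep.trivial k G k) (n + 1) ≃ₗ[k] GroupHomology k G k (n + 1)) := by
  refine nonempty_homology_succ_equiv (groupHomology.inhomogeneousChains (Rep.trivial k G k))
    (M := chains G k) (BarHomology.d k G k) (fun n => LinearEquiv.refl k _) (fun n x => ?_) n
  have h : ((groupHomology.inhomogeneousChains (Rep.trivial k G k)).d (n + 1) n).hom
      = BarHomology.d k G k n := by
    rw [groupHomology.inhomogeneousChains.d_def]
    rfl
  exact LinearMap.congr_fun h x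

lemma Representation.free_apply_eq_smul {k G α : Type} [CommRing k] [CommGroup G] (g : G)
    (f : α →₀ k[G]) :
    Representation.free k G α g f = of k G g • f := by
  have h : Representation.free k G α g =
      (LinearMap.lsmul k[G] (α →₀ k[G]) (of k G g)).restrictScalars k := by
    ext; simp
  exact LinearMap.congr_fun h f

/-- The Klein four-group. -/
abbrev D₂ : Type := Multiplicative (ZMod 2 × ZMod 2)

namespace D₂

/-- The first generator of the Klein four-group. -/
def s : D₂ := .ofAdd (1, 0)

/-- The second generator of the Klein four-group. -/
def t : D₂ := .ofAdd (0, 1)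

@[simp] lemma s_mul_s : s * s = 1 := by decide

@[simp] lemma t_mul_t : t * t = 1 := by decide

@[simp] lemma t_mul_s : t * s = s * t := by decide

@[simp] lemma s_mul_s_mul_t : s * (s * t) = t := by decide

@[simp] lemma t_mul_s_mul_t : t * (s * t) = s := by decide

@[simp] lemma s_ne_one : s ≠ 1 := by decide

@[simp] lemma t_ne_one : t ≠ 1 := by decide

@[simp] lemma s_mul_t_ne_one : s * t ≠ 1 := by decide

@[simp] lemma s_ne_t : s ≠ t := by decide

@[simp] lemma s_mul_t_ne_t : s * t ≠ t := by decide

/-- The differential of the free resolution of the trivial module over `k[D₂]`, obtained as the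
total complex of the tensor product of the periodic resolutions of the two factors. The
basis element `i` in degree `n` has bidegree `(i, n - i)`. -/
noncomputable def diff (k : Type) [CommRing k] (n : ℕ) :
    (Fin (n + 2) →₀ k[D₂]) →ₗ[k[D₂]] (Fin (n + 1) →₀ k[D₂]) :=
  (Finsupp.linearEquivFunOnFinite k[D₂] k[D₂] (Fin (n + 1))).symm.toLinearMap ∘ₗ
  LinearMap.pi (fun i : Fin (n + 1) => (of k D₂ s + (-1) ^ (i + 1 : ℕ)) • Finsupp.lapply i.succ +
    ((-1) ^ (i : ℕ) * of k D₂ t + (-1) ^ (n + 1)) • Finsupp.lapply i.castSucc)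

lemma diff_apply (k : Type) [CommRing k] (n : ℕ) (f : Fin (n + 2) →₀ k[D₂]) (i : Fin (n + 1)) :
    diff k n f i = (of k D₂ s + (-1) ^ (i + 1 : ℕ)) * f i.succ +
    ((-1) ^ (i : ℕ) * of k D₂ t + (-1) ^ (n + 1)) * f i.castSucc := by
  simp [diff]

lemma diff_diff (k : Type) [CommRing k] (n : ℕ) (f : Fin (n + 3) →₀ k[D₂]) :
    diff k n (diff k (n + 1) f) = 0 := by
  have hs : of k D₂ s * of k D₂ s = 1 := by
    rw [← map_mul, ← map_one (of k D₂)]; congr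
  have ht : of k D₂ t * of k D₂ t = 1 := by
    rw [← map_mul, ← map_one (of k D₂)]; congr
  ext1 i
  simp only [diff_apply, Fin.val_succ, Fin.val_castSucc, pow_succ, Fin.succ_castSucc,
    Finsupp.zero_apply]
  have h1 : ((-1 : k[D₂]) ^ (i : ℕ)) * (-1) ^ (i : ℕ) = 1 := by rw [← mul_pow]; simp
  have h2 : ((-1 : k[D₂]) ^ n) * (-1) ^ n = 1 := by rw [← mul_pow]; simp
  generalize (-1 : k[D₂]) ^ (i : ℕ) = u at *
  generalize (-1 : k[D₂]) ^ n = v at *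
  generalize of k D₂ s = s at *
  generalize of k D₂ t = t at *
  grind

/-- `D₂.diff` as a morphism of representations. -/
noncomputable def repDiff (k : Type) [CommRing k] (n : ℕ) :
    Rep.free k D₂ (Fin (n + 2)) ⟶ Rep.free k D₂ (Fin (n + 1)) :=
  Rep.ofHom ⟨(diff k n).restrictScalars k, fun g => by
    refine LinearMap.ext fun f => ?_
    simp [Representation.free_apply_eq_smul, -of_apply]⟩

/-- The total complex of the tensor product of the two periodic resolutions. -/
noncomputable abbrev complex (k : Type) [CommRing k] : ChainComplex (Rep k D₂) ℕ :=
  ChainComplex.of (fun n => Rep.free k D₂ (Fin (n + 1))) (repDiff k) fun n => by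
    refine Rep.hom_ext (Representation.IntertwiningMap.ext (LinearMap.ext fun f => ?_))
    exact diff_diff k n f

lemma eq_one_or_s_or_t_or_s_mul_t (g : D₂) : g = 1 ∨ g = s ∨ g = t ∨ g = s * t := by
  revert g; decide

lemma coeff_diff (k : Type) [CommRing k] (n : ℕ) (f : Fin (n + 2) →₀ k[D₂]) (i : Fin (n + 1))
    (g : D₂) :
    (diff k n f i).coeff g = (f i.succ).coeff (s * g) + (-1) ^ (i + 1 : ℕ) * (f i.succ).coeff g +
    ((-1) ^ (i : ℕ) * (f i.castSucc).coeff (t * g) + (-1) ^ (n + 1) * (f i.castSucc).coeff g) := by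
  have hs : s⁻¹ = s := by decide
  have ht : t⁻¹ = t := by decide
  have key : ∀ (m : ℕ) (x : k[D₂]) (g : D₂),
      ((-1) ^ m * x).coeff g = (-1) ^ m * x.coeff g := by
    intro m x g
    rcases Nat.even_or_odd m with h | h <;> simp [h]
  rw [diff_apply]
  simp [add_mul, key, mul_assoc, hs, ht]

/-- A contracting homotopy for `D₂.diff`, restricted to cycles. -/
noncomputable def homotopy (k : Type) [CommRing k] (n : ℕ) (f : Fin (n + 1) →₀ k[D₂]) :
    Fin (n + 2) →₀ k[D₂] :=
  Finsupp.equivFunOnFinite.symm (Fin.cons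
    (.single 1 ((f 0).coeff t + (f 0).coeff (s * t)))
    fun i => .single 1 ((f i).coeff s) + .single t ((f i).coeff (s * t)))

lemma diff_homotopy (k : Type) [CommRing k] (n : ℕ) (f : Fin (n + 2) →₀ k[D₂])
    (hf : diff k n f = 0) : diff k (n + 1) (homotopy k (n + 1) f) = f := by
  have hf' (i : Fin (n + 1)) (g : D₂) := coeff_diff k n f i g
  simp only [hf, Finsupp.coe_zero, Pi.zero_apply, MonoidAlgebra.coeff_zero] at hf'
  have hn : (-1 : k) ^ n * (-1) ^ n = 1 := by rw [← mul_pow]; simp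
  ext i g
  rw [coeff_diff]
  refine Fin.cases ?_ (fun j => ?_) i
  · have h0 := hf' 0 1
    have h1 := hf' 0 s
    clear hf'
    rcases eq_one_or_s_or_t_or_s_mul_t g with rfl | rfl | rfl | rfl <;>
      simp [homotopy, t_ne_one.symm, pow_succ] at h0 h1 ⊢
    all_goals grind
  · have h0 := hf' j 1
    have h1 := hf' j s
    have h2 := hf' j t
    have h3 := hf' j (s * t)
    have hj : (-1 : k) ^ (j : ℕ) * (-1) ^ (j : ℕ) = 1 := by rw [← mul_pow]; simp
    have hc : (homotopy k (n + 1) f) j.succ.castSucc =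
      .single 1 ((f j.castSucc).coeff s) + .single t ((f j.castSucc).coeff (s * t)) := by
      rw [← Fin.succ_castSucc]; simp [homotopy]
    have hc' : (homotopy k (n + 1) f) j.succ.succ =
      .single 1 ((f j.succ).coeff s) + .single t ((f j.succ).coeff (s * t)) := by
      simp [homotopy]
    rw [hc, hc']
    clear hf' hc hc'
    rcases eq_one_or_s_or_t_or_s_mul_t g with rfl | rfl | rfl | rfl <;>
      simp [t_ne_one.symm, pow_succ] at h0 h1 h2 h3 ⊢
    · linear_combination h1
    · linear_combination h3

/-- The augmentation of the group algebra. -/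
noncomputable def augmentation (k : Type) [CommRing k] : k[D₂] →ₐ[k] k :=
  MonoidAlgebra.lift k k D₂ 1

lemma augmentation_single (k : Type) [CommRing k] (g : D₂) (r : k) :
    augmentation k (.single g r) = r := by
  simp [augmentation]

lemma augmentation_eq (k : Type) [CommRing k] (x : k[D₂]) :
    augmentation k x = x.coeff 1 + x.coeff s + x.coeff t + x.coeff (s * t) := by
  have : (Finset.univ : Finset D₂) = {1, s, t, s * t} := by decide
  have hs1 : (1 : D₂) ∉ ({s, t, s * t} : Finset D₂) := by decide
  have hs2 : s ∉ ({t, s * t} : Finset D₂) := by decide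
  have hs3 : t ∉ ({s * t} : Finset D₂) := by decide
  rw [augmentation, MonoidAlgebra.lift_apply, Finsupp.sum_fintype _ _ (by simp), this,
    Finset.sum_insert hs1, Finset.sum_insert hs2, Finset.sum_insert hs3, Finset.sum_singleton]
  simp [add_assoc]

lemma augmentation_diff (k : Type) [CommRing k] (n : ℕ) (f : Fin (n + 2) →₀ k[D₂])
    (i : Fin (n + 1)) :
    augmentation k (diff k n f i) = (1 + (-1) ^ (i + 1 : ℕ)) * augmentation k (f i.succ) +
      ((-1) ^ (i : ℕ) + (-1) ^ (n + 1)) * augmentation k (f i.castSucc) := by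
  simp [diff_apply, augmentation_single]

lemma diff_homotopy_zero (k : Type) [CommRing k] (f : Fin 1 →₀ k[D₂])
    (hf : augmentation k (f 0) = 0) : diff k 0 (homotopy k 0 f) = f := by
  rw [augmentation_eq] at hf
  ext i g
  obtain rfl : i = 0 := Fin.fin_one_eq_zero i
  rw [coeff_diff]
  rcases eq_one_or_s_or_t_or_s_mul_t g with rfl | rfl | rfl | rfl <;>
    simp [homotopy, t_ne_one.symm]
  all_goals linear_combination -hf

/-- The augmentation of `D₂.complex` in degree zero. -/
noncomputable def repAugmentation (k : Type) [CommRing k] :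
    Rep.free k D₂ (Fin 1) ⟶ Rep.trivial k D₂ k :=
  Rep.ofHom ⟨(augmentation k).toLinearMap ∘ₗ Finsupp.lapply 0, fun g => by
    refine LinearMap.ext fun f => ?_
    simp [Representation.free_apply_eq_smul, augmentation_single]⟩

lemma complex_d (k : Type) [CommRing k] (n : ℕ) :
    (complex k).d (n + 1) n = repDiff k n :=
  ChainComplex.of_d (fun n => Rep.free k D₂ (Fin (n + 1))) (repDiff k) n

/-- The augmentation of `D₂.complex` as a morphism of complexes. -/
noncomputable def complexToSingle (k : Type) [CommRing k] :
    complex k ⟶ (ChainComplex.single₀ (Rep k D₂)).obj (Rep.trivial k D₂ k) :=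
  ((complex k).toSingle₀Equiv _).symm ⟨repAugmentation k, by
    refine (congrArg (· ≫ repAugmentation k) (complex_d k 0)).trans ?_
    refine Rep.hom_ext (Representation.IntertwiningMap.ext (LinearMap.ext fun f => ?_))
    exact (augmentation_diff k 0 f 0).trans (by simp)⟩

instance (k : Type) [CommRing k] : QuasiIso (complexToSingle k) where
  quasiIsoAt m := by
    cases m with
    | zero =>
      rw [ChainComplex.quasiIsoAt₀_iff, ShortComplex.quasiIso_iff_of_zeros' _ rfl rfl rfl]
      have h0 : (complexToSingle k).f 0 = repAugmentation k :=
        ChainComplex.toSingle₀Equiv_symm_apply_f_zero _ _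
      constructor
      · apply (forget₂ _ (ModuleCat k)).reflects_exact_of_faithful
        rw [ShortComplex.moduleCat_exact_iff]
        intro x hx
        have hx' : (repAugmentation k) x = 0 := by
          rw [← h0]; exact hx
        refine ⟨homotopy k 0 x, ?_⟩
        refine Eq.trans ?_ (diff_homotopy_zero k x hx')
        exact congrArg (fun q : Rep.free k D₂ (Fin 2) ⟶ Rep.free k D₂ (Fin 1) => q (homotopy k 0 x))
          (complex_d k 0)
      · have : Epi (repAugmentation k) := by
          rw [Rep.epi_iff_surjective]
          exact fun x => ⟨Finsupp.single 0 (.single 1 x),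
            (congrArg (augmentation k) (by simp)).trans (augmentation_single k 1 x)⟩
        rw [← h0] at this
        exact this
    | succ m =>
      rw [quasiIsoAt_iff_exactAt' (hL := ChainComplex.exactAt_succ_single_obj ..),
          HomologicalComplex.exactAt_iff' _ (m + 2) (m + 1) m (by simp) (by simp)]
      apply (forget₂ _ (ModuleCat k)).reflects_exact_of_faithful
      rw [ShortComplex.moduleCat_exact_iff]
      intro x hx
      refine ⟨homotopy k (m + 1) x, ?_⟩
      have hx' : diff k m x = 0 := by
        refine Eq.trans ?_ hx
        exact congrArg (fun q : Rep.free k D₂ (Fin (m + 2)) ⟶ Rep.free k D₂ (Fin (m + 1)) => q x)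
          (complex_d k m).symm
      refine Eq.trans ?_ (diff_homotopy k m x hx')
      exact congrArg (fun q : Rep.free k D₂ (Fin (m + 3)) ⟶ Rep.free k D₂ (Fin (m + 2)) =>
        q (homotopy k (m + 1) x)) (complex_d k (m + 1))

/-- The free resolution of the trivial representation of the Klein four-group. -/
noncomputable def resolution (k : Type) [CommRing k] :
    ProjectiveResolution (Rep.trivial k D₂ k) where
  complex := complex k
  projective n := inferInstanceAs (Projective (Rep.free k D₂ (Fin (n + 1))))
  π := complexToSingle k

lemma coinvariantsTensorFreeToFinsupp_trivial (k : Type) [CommRing k] {α : Type} [DecidableEq α]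
    (x : k) (f : α →₀ k[D₂]) (i : α) :
    Rep.coinvariantsTensorFreeToFinsupp (Rep.trivial k D₂ k) α
      (Rep.coinvariantsTensorMk (Rep.trivial k D₂ k) (Rep.free k D₂ α) x f) i =
      augmentation k (f i) * x := by
  let φ : (α →₀ k[D₂]) →ₗ[k] k :=
    Finsupp.lapply i ∘ₗ Rep.coinvariantsTensorFreeToFinsupp (Rep.trivial k D₂ k) α ∘ₗ
      Rep.coinvariantsTensorMk (Rep.trivial k D₂ k) (Rep.free k D₂ α) x
  let ψ : (α →₀ k[D₂]) →ₗ[k] k :=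
    LinearMap.mulRight k x ∘ₗ (augmentation k).toLinearMap ∘ₗ Finsupp.lapply i
  suffices h : φ = ψ from LinearMap.congr_fun h f
  refine Finsupp.lhom_ext' fun j => MonoidAlgebra.lhom_ext' fun g => LinearMap.ext fun r => ?_
  refine (congrArg (fun y : α →₀ k => y i)
    (Rep.coinvariantsTensorFreeToFinsupp_mk_tmul_single (A := Rep.trivial k D₂ k) x j g r)).trans ?_
  by_cases h : j = i
  · subst h
    simp [ψ, augmentation_single]
  · simp [ψ, h]

/-- The differential induced by `D₂.diff` on coinvariants. -/
def coinvariantsDiff (k : Type) [CommRing k] (n : ℕ) : (Fin (n + 2) → k) →ₗ[k] (Fin (n + 1) → k) :=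
  LinearMap.pi fun i => (1 + (-1 : k) ^ (i + 1 : ℕ)) • LinearMap.proj i.succ +
    ((-1 : k) ^ (i : ℕ) + (-1) ^ (n + 1)) • LinearMap.proj i.castSucc

lemma coinvariantsDiff_apply (k : Type) [CommRing k] (n : ℕ) (f : Fin (n + 2) → k)
    (i : Fin (n + 1)) :
    coinvariantsDiff k n f i = (1 + (-1) ^ (i + 1 : ℕ)) * f i.succ +
      ((-1) ^ (i : ℕ) + (-1) ^ (n + 1)) * f i.castSucc := by
  simp [coinvariantsDiff]

/-- The homology in degree `n + 1` of the complex with differential `D₂.coinvariantsDiff`. -/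
abbrev coinvariantsHomology (k : Type) [CommRing k] (n : ℕ) : Type :=
  LinearMap.ker (coinvariantsDiff k n) ⧸
    (LinearMap.range (coinvariantsDiff k (n + 1))).comap
      (LinearMap.ker (coinvariantsDiff k n)).subtype

lemma nonempty_groupHomology_equiv (k : Type) [CommRing k] (n : ℕ) :
    Nonempty (groupHomology (Rep.trivial k D₂ k) (n + 1) ≃ₗ[k]
      coinvariantsHomology k n) := by
  have e := (groupHomologyIso (Rep.trivial k D₂ k) (n + 1) (resolution k)).toLinearEquiv
  refine (nonempty_homology_succ_equiv
    ((resolution k).complex.coinvariantsTensorObj (Rep.trivial k D₂ k))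
    (M := fun n => Fin (n + 1) → k) (coinvariantsDiff k)
    (fun n => Rep.coinvariantsTensorFreeLEquiv (Rep.trivial k D₂ k) (Fin (n + 1)) ≪≫ₗ
      Finsupp.linearEquivFunOnFinite k k (Fin (n + 1)))
    (fun n x => ?_) n).map e.trans
  have hd : ((resolution k).complex.coinvariantsTensorObj (Rep.trivial k D₂ k)).d (n + 1) n =
      ((Rep.coinvariantsTensor k D₂).obj (Rep.trivial k D₂ k)).map (repDiff k n) :=
    congrArg ((Rep.coinvariantsTensor k D₂).obj (Rep.trivial k D₂ k)).map (complex_d k n)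
  rw [hd]
  let φ (m : ℕ) : _ →ₗ[k] (Fin (m + 1) → k) :=
    (Finsupp.linearEquivFunOnFinite k k (Fin (m + 1))).toLinearMap ∘ₗ
      Rep.coinvariantsTensorFreeToFinsupp (Rep.trivial k D₂ k) (Fin (m + 1))
  refine LinearMap.congr_fun (f := φ n ∘ₗ (((Rep.coinvariantsTensor k D₂).obj
    (Rep.trivial k D₂ k)).map (repDiff k n)).hom) (g := coinvariantsDiff k n ∘ₗ φ (n + 1)) ?_ x
  refine Representation.Coinvariants.hom_ext (TensorProduct.ext' fun y f => ?_)
  refine funext fun i => ?_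
  refine (coinvariantsTensorFreeToFinsupp_trivial k y (diff k n f) i).trans ?_
  refine Eq.trans ?_ (coinvariantsDiff_apply k n _ i).symm
  refine Eq.trans ?_ (congrArg₂ (fun a b => (1 + (-1) ^ (i + 1 : ℕ)) * a +
      ((-1) ^ (i : ℕ) + (-1) ^ (n + 1)) * b)
      (coinvariantsTensorFreeToFinsupp_trivial k y f i.succ)
      (coinvariantsTensorFreeToFinsupp_trivial k y f i.castSucc)).symm
  rw [augmentation_diff]
  ring

/-- If every cycle is half a boundary, and the coordinates `c` detect divisibility of cycles by `2`
and can be prescribed freely on cycles, then the homology is `(ℤ/2)^r`. -/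
lemma nonempty_coinvariantsHomology_equiv {n r : ℕ} (c : Fin r → Fin (n + 2))
    (hc : ∀ x, coinvariantsDiff ℤ n x = 0 → (∀ m, Even (x (c m))) → ∀ i, Even (x i))
    (hb : ∀ x, coinvariantsDiff ℤ n x = 0 → ∃ y, coinvariantsDiff ℤ (n + 1) y = 2 • x)
    (hs : ∀ w : Fin r → ℤ, ∃ x, coinvariantsDiff ℤ n x = 0 ∧ ∀ m, x (c m) = w m) :
    Nonempty (coinvariantsHomology ℤ n ≃ₗ[ℤ] (Fin r → ZMod 2)) := by
  let φ : LinearMap.ker (coinvariantsDiff ℤ n) →ₗ[ℤ] (Fin r → ZMod 2) :=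
    LinearMap.pi fun m => (Int.castAddHom (ZMod 2)).toIntLinearMap ∘ₗ
      LinearMap.proj (c m) ∘ₗ (LinearMap.ker (coinvariantsDiff ℤ n)).subtype
  have hφ (x : LinearMap.ker (coinvariantsDiff ℤ n)) (m : Fin r) :
      φ x m = ((x.1 (c m) : ℤ) : ZMod 2) := rfl
  have hsurj : Function.Surjective φ := fun v => by
    obtain ⟨x, hx, hxv⟩ := hs fun m => ((v m).val : ℤ)
    exact ⟨⟨x, hx⟩, funext fun m => by simp [hφ, hxv]⟩
  have hker : (LinearMap.range (coinvariantsDiff ℤ (n + 1))).comap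
      (LinearMap.ker (coinvariantsDiff ℤ n)).subtype = LinearMap.ker φ := by
    ext ⟨x, hx⟩
    have hmem : ⟨x, hx⟩ ∈ LinearMap.ker φ ↔ ∀ m, Even (x (c m)) := by
      simp [funext_iff, hφ, ZMod.intCast_eq_zero_iff_even]
    rw [hmem]
    constructor
    · rintro ⟨y, rfl⟩ m
      simp only [coinvariantsDiff_apply]
      refine .add (.mul_right ?_ _) (.mul_right ?_ _)
      · simp [Int.even_add, Int.even_pow']
      · exact odd_neg_one.pow.add_odd odd_neg_one.pow
    · intro h
      choose z hz using hc x hx h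
      obtain rfl : x = 2 • z := funext fun i => by simp [hz, two_mul]
      exact hb z (by simpa [map_nsmul, -nsmul_eq_mul] using hx)
  exact ⟨Submodule.quotEquivOfEq _ _ hker ≪≫ₗ φ.quotKerEquivOfSurjective hsurj⟩

lemma nonempty_coinvariantsHomology_equiv_odd {n : ℕ} (hn : Even n) :
    Nonempty (coinvariantsHomology ℤ n ≃ₗ[ℤ] (Fin ((n + 4) / 2) → ZMod 2)) := by
  have hker (x : Fin (n + 2) → ℤ) :
      coinvariantsDiff ℤ n x = 0 ↔ ∀ i : Fin (n + 1), Odd (i : ℕ) → x i.succ = x i.castSucc := by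
    rw [funext_iff]
    refine forall_congr' fun i => ?_
    rw [coinvariantsDiff_apply]
    rcases Nat.even_or_odd i with h | h
    · simp [h, hn, pow_succ]
    · simp [h, hn, pow_succ]
      lia
  refine nonempty_coinvariantsHomology_equiv (fun m => ⟨min (2 * m) (n + 1), by lia⟩)
    (fun x hx h i => ?_) (fun x hx => ?_) fun w => ?_
  · rw [hker] at hx
    have hi := h ⟨(i + 1) / 2, by lia⟩
    rcases Nat.even_or_odd i with h' | h'
    · convert hi
      grind
    · refine Fin.lastCases (fun h' hi => ?_) (fun j h' hi => ?_) i h' hi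
      · convert hi
        grind
      · rw [← hx j h']
        convert hi
        grind [Fin.val_castSucc]
  · rw [hker] at hx
    refine ⟨Fin.snoc x (x (Fin.last _)), funext fun i => ?_⟩
    rw [coinvariantsDiff_apply]
    rcases Nat.even_or_odd i with h | h
    · simp [h, hn, pow_succ]
    · refine Fin.lastCases (fun h => ?_) (fun j h => ?_) i h
      · simp [hn, pow_succ]
      · rw [← Fin.castSucc_succ, Fin.snoc_castSucc, Fin.snoc_castSucc, hx j h]
        have h' : Odd (j : ℕ) := h
        simp [h', hn, pow_succ]
  · refine ⟨fun i => w ⟨(i + 1) / 2, by lia⟩, (hker _).2 fun i hi => ?_, fun m => ?_⟩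
    · congr 2
      grind [Fin.val_castSucc]
    · exact congrArg w (Fin.ext (by grind))

lemma nonempty_coinvariantsHomology_equiv_even {n : ℕ} (hn : Odd n) :
    Nonempty (coinvariantsHomology ℤ n ≃ₗ[ℤ] (Fin ((n + 1) / 2) → ZMod 2)) := by
  have hker (x : Fin (n + 2) → ℤ) :
      coinvariantsDiff ℤ n x = 0 ↔ ∀ i : Fin (n + 2), Even (i : ℕ) → x i = 0 := by
    rw [funext_iff]
    simp only [coinvariantsDiff_apply]
    constructor
    · intro h i hi
      refine Fin.lastCases (fun hi => ?_) (fun j hi => ?_) i hi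
      · simpa [hn, pow_succ] using h (Fin.last n)
      · have hi' : Even (j : ℕ) := hi
        simpa [hn, hi', pow_succ] using h j
    · intro h i
      rcases Nat.even_or_odd i with hi | hi
      · simp [hi, hn, pow_succ, h i.castSucc hi]
      · simp [hi, hn, pow_succ, h i.succ hi.add_one]
  refine nonempty_coinvariantsHomology_equiv (fun m => ⟨2 * m + 1, by lia⟩)
    (fun x hx h i => ?_) (fun x hx => ?_) fun w => ?_
  · rw [hker] at hx
    rcases Nat.even_or_odd i with h' | h'
    · simp [hx i h']
    · convert h ⟨i / 2, by grind⟩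
      grind
  · rw [hker] at hx
    refine ⟨Fin.snoc (-x) 0, funext fun i => ?_⟩
    rw [coinvariantsDiff_apply]
    rcases Nat.even_or_odd i with h | h
    · simp [h, hn, pow_succ, hx i h]
    · refine Fin.lastCases (fun h => ?_) (fun j h => ?_) i h
      · grind
      · rw [← Fin.castSucc_succ, Fin.snoc_castSucc, Fin.snoc_castSucc]
        have h' : Odd (j : ℕ) := h
        simp [h', hn, pow_succ, hx j.succ h'.add_one, two_mul]
  · refine ⟨fun i => if h : Odd (i : ℕ) then w ⟨i / 2, by grind⟩ else 0,
      (hker _).2 fun i hi => ?_, fun m => ?_⟩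
    · simp [hi]
    · simp; grind

end D₂

end

open BarHomology

/-- The integral homology of the Klein four-group `D₂ = ℤ/2 × ℤ/2` in positive degrees. -/
theorem homology_klein_four_group (q : ℕ) (hq : 1 ≤ q) :
    (Odd q → Nonempty (GroupHomology ℤ (Multiplicative (ZMod 2 × ZMod 2)) ℤ q ≃+
      (Fin ((q + 3) / 2) → ZMod 2))) ∧
    (Even q → Nonempty (GroupHomology ℤ (Multiplicative (ZMod 2 × ZMod 2)) ℤ q ≃+
      (Fin (q / 2) → ZMod 2))) := by
  obtain ⟨n, rfl⟩ := Nat.exists_eq_add_of_le' hq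
  obtain ⟨e₁⟩ := nonempty_groupHomology_equiv ℤ D₂ n
  obtain ⟨e₂⟩ := D₂.nonempty_groupHomology_equiv ℤ n
  constructor
  · intro h
    obtain ⟨e₃⟩ := D₂.nonempty_coinvariantsHomology_equiv_odd (n := n) (by grind)
    exact ⟨((e₁.symm.trans e₂).trans e₃).toAddEquiv⟩
  · intro h
    obtain ⟨e₃⟩ := D₂.nonempty_coinvariantsHomology_equiv_even (n := n) (by grind)
    exact ⟨((e₁.symm.trans e₂).trans e₃).toAddEquiv⟩
end

section
/- For the symmetric group S_3 on three letters and every positive integer q, the integral group homology with trivial ℤ-coefficients satisfies, as abelian groups: H_q(S_3; ℤ) ≅ ℤ/2 if q ≡ 1 (mod 4); H_q(S_3; ℤ) = 0 if q ≡ 2 (mod 4); H_q(S_3; ℤ) ≅ ℤ/6 if q ≡ 3 (mod 4); and H_q(S_3; ℤ) = 0 if q ≡ 0 (mod 4) with q > 0. -/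
open BarHomology

section Resolutions

open CategoryTheory

/-- The homology `ker g / im f` of a composable pair of linear maps `A → B → C`. -/
abbrev homologyAt {k A B C : Type*} [CommRing k] [AddCommGroup A] [Module k A]
    [AddCommGroup B] [Module k B] [AddCommGroup C] [Module k C]
    (f : A →ₗ[k] B) (g : B →ₗ[k] C) : Type _ :=
  LinearMap.ker g ⧸ (LinearMap.range f).comap (LinearMap.ker g).subtype

section homologyAt

variable {k A B C A₂ B₂ C₂ : Type*} [CommRing k] [AddCommGroup A] [Module k A]
  [AddCommGroup B] [Module k B] [AddCommGroup C] [Module k C]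
  [AddCommGroup A₂] [Module k A₂] [AddCommGroup B₂] [Module k B₂] [AddCommGroup C₂] [Module k C₂]

/-- Isomorphic composable pairs of linear maps have isomorphic homology. -/
noncomputable def homologyAtCongr {f : A →ₗ[k] B} {g : B →ₗ[k] C} {f₂ : A₂ →ₗ[k] B₂}
    {g₂ : B₂ →ₗ[k] C₂} (eA : A ≃ₗ[k] A₂) (eB : B ≃ₗ[k] B₂) (eC : C ≃ₗ[k] C₂)
    (hf : ∀ a, f₂ (eA a) = eB (f a)) (hg : ∀ b, g₂ (eB b) = eC (g b)) :
    homologyAt f g ≃ₗ[k] homologyAt f₂ g₂ := by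
  refine Submodule.Quotient.equiv _ _ (eB.ofSubmodules _ (LinearMap.ker g₂) ?_) ?_
  · ext b
    simp only [Submodule.mem_map, LinearMap.mem_ker]
    constructor
    · rintro ⟨b, hb, rfl⟩
      simp [hg, hb]
    · intro hb
      refine ⟨eB.symm b, eC.injective ?_, by simp⟩
      simp [← hg, hb]
  · ext ⟨b, hb⟩
    simp only [Submodule.mem_map, Submodule.mem_comap, Submodule.subtype_apply,
      LinearMap.mem_range, Subtype.exists]
    constructor
    · rintro ⟨c, hc, ⟨a, rfl⟩, h⟩
      exact ⟨eA a, by rw [hf]; exact congrArg Subtype.val h⟩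
    · rintro ⟨a, rfl⟩
      refine ⟨f (eA.symm a), eC.injective ?_, ⟨_, rfl⟩, Subtype.ext ?_⟩
      · rw [← hg, ← hf]
        simpa using hb
      · simp [← hf]

lemma subsingleton_homologyAt (f : A →ₗ[k] B) {g : B →ₗ[k] C} (hg : ∀ b, g b = 0 → b = 0) :
    Subsingleton (homologyAt f g) := by
  rw [Submodule.Quotient.subsingleton_iff, eq_top_iff]
  rintro ⟨b, hb⟩ -
  exact ⟨0, by simp [hg b hb]⟩

lemma nonempty_homologyAt_addEquiv {f : A →ₗ[k] B} {g : B →ₗ[k] C} (hg : g = 0) {M : Type*}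
    [AddCommGroup M] (φ : B →+ M) (hφ : Function.Surjective φ)
    (hf : ∀ b, φ b = 0 ↔ b ∈ LinearMap.range f) : Nonempty (homologyAt f g ≃+ M) := by
  subst hg
  let ψ : LinearMap.ker (0 : B →ₗ[k] C) →+ M :=
    φ.comp (LinearMap.ker (0 : B →ₗ[k] C)).subtype.toAddMonoidHom
  have hψ : Function.Surjective ψ := fun m =>
    let ⟨b, hb⟩ := hφ m
    ⟨⟨b, rfl⟩, hb⟩
  refine ⟨(QuotientAddGroup.quotientAddEquivOfEq ?_).trans
    (QuotientAddGroup.quotientKerEquivOfSurjective ψ hψ)⟩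
  ext b
  exact (hf b).symm

/-- Homology of a complex of modules in a positive degree, as cycles modulo boundaries. -/
noncomputable def homologySuccEquiv {k : Type} [CommRing k]
    (K : ChainComplex (ModuleCat.{0} k) ℕ) (n : ℕ) :
    K.homology (n + 1) ≃ₗ[k] homologyAt (K.d (n + 2) (n + 1)).hom (K.d (n + 1) n).hom :=
  (K.homologyIsoSc' (n + 2) (n + 1) n (by simp) (by simp) ≪≫
    (K.sc' (n + 2) (n + 1) n).moduleCatHomologyIso).toLinearEquiv ≪≫ₗ
    Submodule.quotEquivOfEq _ _ (by
      ext x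
      simp only [LinearMap.mem_range, ShortComplex.moduleCatToCycles, Subtype.ext_iff]
      rfl)

end homologyAt

lemma inhomogeneousChains_d_trivial (k G : Type) [CommRing k] [Group G] (n : ℕ) :
    ((groupHomology.inhomogeneousChains (Rep.trivial k G k)).d (n + 1) n).hom = d k G k n := by
  rw [groupHomology.inhomogeneousChains.d_def]
  refine Finsupp.lhom_ext fun g a => ?_
  rw [groupHomology.inhomogeneousChains.d_single]
  simp [d]

/-- The bar homology agrees with Mathlib's group homology in positive degrees. -/
noncomputable def groupHomologySuccEquiv (k G : Type) [CommRing k] [Group G] (n : ℕ) :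
    GroupHomology k G k (n + 1) ≃ₗ[k] groupHomology (Rep.trivial k G k) (n + 1) :=
  homologyAtCongr (.refl _ _) (.refl _ _) (.refl _ _)
    (fun a => by rw [inhomogeneousChains_d_trivial]; rfl)
    (fun a => by rw [inhomogeneousChains_d_trivial]; rfl) ≪≫ₗ
    (homologySuccEquiv (groupHomology.inhomogeneousChains (Rep.trivial k G k)) n).symm

section FreeResolution

variable {k G : Type} [CommRing k] [Group G]

lemma free_apply_apply {β : Type} (g : G) (y : β →₀ MonoidAlgebra k G) (j : β) :
    Representation.free k G β g y j = MonoidAlgebra.single g 1 * y j := by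
  have h : (Finsupp.lapply j : (β →₀ MonoidAlgebra k G) →ₗ[k] _) ∘ₗ
      Representation.free k G β g =
      LinearMap.mulLeft k (MonoidAlgebra.single g 1) ∘ₗ Finsupp.lapply j := by
    classical
    refine Finsupp.lhom_ext' fun i => MonoidAlgebra.lhom_ext' fun h => LinearMap.ext_ring ?_
    change Representation.free k G β g (Finsupp.single i (MonoidAlgebra.single h 1)) j =
      MonoidAlgebra.single g 1 * (Finsupp.single i (MonoidAlgebra.single h 1)) j
    erw [Representation.free_single_single]
    by_cases hij : i = j
    · subst hij; simp
    · simp [hij]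
  exact LinearMap.congr_fun h y

lemma freeLift_apply_apply {α β : Type} [Fintype α] (f : α → (β →₀ MonoidAlgebra k G))
    (x : α →₀ MonoidAlgebra k G) (j : β) :
    Representation.freeLift (Representation.free k G β) f x j = ∑ i, x i * f i j := by
  have h : (Finsupp.lapply j : (β →₀ MonoidAlgebra k G) →ₗ[k] _) ∘ₗ
      (Representation.freeLift (Representation.free k G β) f).toLinearMap =
      ∑ i, (LinearMap.mulRight k (f i j)) ∘ₗ Finsupp.lapply i := by
    refine Finsupp.lhom_ext' fun i => MonoidAlgebra.lhom_ext' fun g => LinearMap.ext_ring ?_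
    classical
    simp only [LinearMap.comp_apply, LinearMap.sum_apply, Finsupp.lsingle_apply,
      MonoidAlgebra.lsingle_apply, LinearMap.mulRight_apply, Finsupp.lapply_apply]
    rw [Finset.sum_eq_single i (by simp +contextual [eq_comm]) (by simp)]
    erw [Representation.freeLift_single_single]
    simp [free_apply_apply]
  have := LinearMap.congr_fun h x
  simp only [LinearMap.sum_apply, LinearMap.comp_apply, LinearMap.mulRight_apply,
    Finsupp.lapply_apply] at this
  exact this

lemma freeLift_trivial_apply {α : Type} [Fintype α] (ε : α → k) (x : α →₀ MonoidAlgebra k G) :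
    Representation.freeLift (Representation.trivial k G k) ε x =
      ∑ i, MonoidAlgebra.lift k k G 1 (x i) * ε i := by
  have h : (Representation.freeLift (Representation.trivial k G k) ε).toLinearMap =
      ∑ i, LinearMap.mulRight k (ε i) ∘ₗ
        (MonoidAlgebra.lift k k G 1).toLinearMap ∘ₗ Finsupp.lapply i := by
    refine Finsupp.lhom_ext' fun i => MonoidAlgebra.lhom_ext' fun g => LinearMap.ext_ring ?_
    classical
    simp only [LinearMap.comp_apply, LinearMap.sum_apply, Finsupp.lsingle_apply,
      MonoidAlgebra.lsingle_apply, LinearMap.mulRight_apply, Finsupp.lapply_apply]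
    rw [Finset.sum_eq_single i (by simp +contextual [eq_comm]) (by simp)]
    erw [Representation.freeLift_single_single]
    simp
  have := LinearMap.congr_fun h x
  simp only [LinearMap.sum_apply, LinearMap.comp_apply, LinearMap.mulRight_apply,
    Finsupp.lapply_apply] at this
  exact this

variable (ι : ℕ → Type) (m : ∀ n, ι (n + 1) → (ι n →₀ MonoidAlgebra k G))

/-- The complex of free representations with bases `ι n` whose differentials have matrices `m`. -/
noncomputable abbrev freeComplex
    (hm : ∀ n, Function.Exact (Representation.freeLift (Representation.free k G _) (m (n + 1)))
      (Representation.freeLift (Representation.free k G _) (m n))) :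
    ChainComplex (Rep.{0} k G) ℕ :=
  ChainComplex.of (fun n => Rep.free k G (ι n)) (fun n => Rep.freeLift k G _ (m n)) fun n => by
    refine Rep.hom_ext (DFunLike.ext _ _ fun x => ?_)
    exact (hm n _).2 ⟨_, rfl⟩

lemma freeComplex_d (hm : ∀ n,
      Function.Exact (Representation.freeLift (Representation.free k G _) (m (n + 1)))
        (Representation.freeLift (Representation.free k G _) (m n))) (n : ℕ) :
    (freeComplex ι m hm).d (n + 1) n = Rep.freeLift k G (Rep.free k G (ι n)) (m n) :=
  ChainComplex.of_d (fun n => Rep.free k G (ι n)) (fun n => Rep.freeLift k G _ (m n)) n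

variable (hm : ∀ n, Function.Exact (Representation.freeLift (Representation.free k G _) (m (n + 1)))
      (Representation.freeLift (Representation.free k G _) (m n)))
  (ε : ι 0 → k)
  (h₀ : Function.Exact (Representation.freeLift (Representation.free k G _) (m 0))
    (Representation.freeLift (Representation.trivial k G k) ε))

/-- The augmentation of `freeComplex` given by `ε`, as a map to a complex concentrated in
degree `0`. -/
noncomputable def freeComplexAugmentation :
    freeComplex ι m hm ⟶ (ChainComplex.single₀ (Rep k G)).obj (Rep.trivial k G k) :=
  ((freeComplex ι m hm).toSingle₀Equiv _).symm
    ⟨Rep.freeLift k G _ ε, by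
      rw [freeComplex_d]
      refine Rep.hom_ext (DFunLike.ext _ _ fun x => ?_)
      exact (h₀ _).2 ⟨_, rfl⟩⟩

lemma quasiIso_freeComplexAugmentation
    (h₁ : Function.Surjective (Representation.freeLift (Representation.trivial k G k) ε)) :
    QuasiIso (freeComplexAugmentation ι m hm ε h₀) where
  quasiIsoAt n := by
    cases n with
    | zero =>
      simp only [freeComplexAugmentation]
      rw [ChainComplex.quasiIsoAt₀_iff, ShortComplex.quasiIso_iff_of_zeros' _ rfl rfl rfl]
      constructor
      · apply (forget₂ _ (ModuleCat k)).reflects_exact_of_faithful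
        rw [ShortComplex.ShortExact.moduleCat_exact_iff_function_exact]
        have h : Function.Exact ((freeComplex ι m hm).d 1 0).hom
            (Representation.freeLift (Representation.trivial k G k) ε) := by
          rw [freeComplex_d]
          exact h₀
        exact h
      · rw [Rep.epi_iff_surjective]
        exact h₁
    | succ n =>
      rw [quasiIsoAt_iff_exactAt' (hL := ChainComplex.exactAt_succ_single_obj ..),
          HomologicalComplex.exactAt_iff' _ (n + 2) (n + 1) n (by simp) (by simp)]
      apply (forget₂ _ (ModuleCat k)).reflects_exact_of_faithful
      rw [ShortComplex.ShortExact.moduleCat_exact_iff_function_exact]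
      have h : Function.Exact ((freeComplex ι m hm).d (n + 2) (n + 1)).hom
          ((freeComplex ι m hm).d (n + 1) n).hom := by
        rw [freeComplex_d, freeComplex_d]
        exact hm n
      exact h

/-- An exact augmented complex of free representations, as a projective resolution of the trivial
representation. -/
noncomputable def freeResolution
    (h₁ : Function.Surjective (Representation.freeLift (Representation.trivial k G k) ε)) :
    ProjectiveResolution (Rep.trivial k G k) where
  complex := freeComplex ι m hm
  projective n := (inferInstance : Projective (Rep.free k G (ι n)))
  π := freeComplexAugmentation ι m hm ε h₀
  quasiIso := quasiIso_freeComplexAugmentation ι m hm ε h₀ h₁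

/-- The map induced on coinvariants by the map of free representations with rows `f`. -/
noncomputable def augmentedMap {α β : Type} (f : α → (β →₀ MonoidAlgebra k G)) :
    (α →₀ k) →ₗ[k] (β →₀ k) :=
  Finsupp.linearCombination k fun i =>
    (f i).mapRange (MonoidAlgebra.lift k k G 1) (map_zero _)

lemma coinvariantsTensorFreeLEquiv_mk {β : Type} [DecidableEq β] (c : k)
    (y : β →₀ MonoidAlgebra k G) :
    Rep.coinvariantsTensorFreeLEquiv (Rep.trivial k G k) β
      (Rep.coinvariantsTensorMk (Rep.trivial k G k) (Rep.free k G β) c y) =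
      c • y.mapRange (MonoidAlgebra.lift k k G 1) (map_zero _) := by
  have h : (Rep.coinvariantsTensorFreeLEquiv (Rep.trivial k G k) β).toLinearMap ∘ₗ
      Rep.coinvariantsTensorMk (Rep.trivial k G k) (Rep.free k G β) c =
      c • Finsupp.mapRange.linearMap (MonoidAlgebra.lift k k G 1).toLinearMap := by
    refine Finsupp.lhom_ext' fun i => MonoidAlgebra.lhom_ext' fun g => LinearMap.ext_ring ?_
    refine (Rep.coinvariantsTensorFreeToFinsupp_mk_tmul_single _ _ _ _ _).trans ?_
    simp
  exact LinearMap.congr_fun h y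

lemma augmentedMap_mapRange {α β : Type} [Fintype α] (f : α → (β →₀ MonoidAlgebra k G))
    (y : α →₀ MonoidAlgebra k G) :
    augmentedMap f (y.mapRange (MonoidAlgebra.lift k k G 1) (map_zero _)) =
      (Representation.freeLift (Representation.free k G β) f y).mapRange
        (MonoidAlgebra.lift k k G 1) (map_zero _) := by
  ext j
  simp only [Finsupp.mapRange_apply, freeLift_apply_apply, map_sum, map_mul]
  simp [augmentedMap, Finsupp.linearCombination_apply, Finsupp.sum_fintype]

lemma augmentedMap_coinvariantsTensorFreeLEquiv {α β : Type} [Fintype α] [DecidableEq α]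
    [DecidableEq β] (f : α → (β →₀ MonoidAlgebra k G))
    (x : ((Rep.coinvariantsTensor k G).obj (Rep.trivial k G k)).obj (Rep.free k G α)) :
    augmentedMap f (Rep.coinvariantsTensorFreeLEquiv (Rep.trivial k G k) α x) =
      Rep.coinvariantsTensorFreeLEquiv (Rep.trivial k G k) β
        (((Rep.coinvariantsTensor k G).obj (Rep.trivial k G k)).map (Rep.freeLift k G _ f) x) := by
  have h : augmentedMap f ∘ₗ
      (Rep.coinvariantsTensorFreeLEquiv (Rep.trivial k G k) α).toLinearMap =
      (Rep.coinvariantsTensorFreeLEquiv (Rep.trivial k G k) β).toLinearMap ∘ₗ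
        (((Rep.coinvariantsTensor k G).obj (Rep.trivial k G k)).map
          (Rep.freeLift k G _ f)).hom := by
    refine Representation.Coinvariants.hom_ext <| TensorProduct.ext' fun (c : k) y => ?_
    change augmentedMap f (Rep.coinvariantsTensorFreeLEquiv (Rep.trivial k G k) α
        (Rep.coinvariantsTensorMk (Rep.trivial k G k) (Rep.free k G α) c y)) =
      Rep.coinvariantsTensorFreeLEquiv (Rep.trivial k G k) β
        (Rep.coinvariantsTensorMk (Rep.trivial k G k) (Rep.free k G β) c
          (Representation.freeLift (Representation.free k G β) f y))
    rw [coinvariantsTensorFreeLEquiv_mk, coinvariantsTensorFreeLEquiv_mk, map_smul,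
      augmentedMap_mapRange]
  exact LinearMap.congr_fun h x

/-- Group homology with trivial coefficients in positive degrees is computed by the coinvariants of
a free resolution. -/
noncomputable def groupHomologySuccEquivHomologyAt [DecidableEq G] [∀ n, Fintype (ι n)]
    [∀ n, DecidableEq (ι n)]
    (h₁ : Function.Surjective (Representation.freeLift (Representation.trivial k G k) ε)) (n : ℕ) :
    GroupHomology k G k (n + 1) ≃ₗ[k] homologyAt (augmentedMap (m (n + 1))) (augmentedMap (m n)) :=
  groupHomologySuccEquiv k G n ≪≫ₗ
    (groupHomologyIso _ _ (freeResolution ι m hm ε h₀ h₁)).toLinearEquiv ≪≫ₗ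
    homologySuccEquiv _ n ≪≫ₗ
    homologyAtCongr (Rep.coinvariantsTensorFreeLEquiv (Rep.trivial k G k) _)
      (Rep.coinvariantsTensorFreeLEquiv (Rep.trivial k G k) _)
      (Rep.coinvariantsTensorFreeLEquiv (Rep.trivial k G k) _)
      (fun a => (augmentedMap_coinvariantsTensorFreeLEquiv (m (n + 1)) a).trans (by
        rw [← freeComplex_d ι m hm]
        rfl))
      (fun a => (augmentedMap_coinvariantsTensorFreeLEquiv (m n) a).trans (by
        rw [← freeComplex_d ι m hm]
        rfl))

end FreeResolution

end Resolutions

namespace SymmetricGroupThree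

/-- The integral group ring of the symmetric group on three letters. -/
abbrev GroupRing : Type := MonoidAlgebra ℤ (Equiv.Perm (Fin 3))

/-- The first simple transposition. -/
abbrev s : Equiv.Perm (Fin 3) := Equiv.swap 0 1

/-- The second simple transposition. -/
abbrev t : Equiv.Perm (Fin 3) := Equiv.swap 1 2

/-- The first simple transposition as an element of the group ring. -/
noncomputable def S : GroupRing := .single s 1

/-- The second simple transposition as an element of the group ring. -/
noncomputable def T : GroupRing := .single t 1

/-- The element of the group ring with given coefficients at `1, s, t, st, ts, sts`. -/
noncomputable def mk (a b c d e f : ℤ) : GroupRing :=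
  .single 1 a + .single s b + .single t c + .single (s * t) d + .single (t * s) e +
    .single (s * t * s) f

lemma coeff_mk (a b c d e f : ℤ) :
    (mk a b c d e f).coeff 1 = a ∧ (mk a b c d e f).coeff s = b ∧ (mk a b c d e f).coeff t = c ∧
    (mk a b c d e f).coeff (s * t) = d ∧ (mk a b c d e f).coeff (t * s) = e ∧
    (mk a b c d e f).coeff (s * t * s) = f := by
  simp only [mk, MonoidAlgebra.coeff_add, MonoidAlgebra.coeff_single, Finsupp.add_apply,
    Finsupp.single_apply]
  simp +decide

lemma exists_eq_mk (x : GroupRing) : ∃ a b c d e f, x = mk a b c d e f := by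
  refine ⟨x.coeff 1, x.coeff s, x.coeff t, x.coeff (s * t), x.coeff (t * s),
    x.coeff (s * t * s), MonoidAlgebra.ext (Finsupp.ext fun g => ?_)⟩
  have hg : ∀ g : Equiv.Perm (Fin 3), g = 1 ∨ g = s ∨ g = t ∨ g = s * t ∨ g = t * s ∨
    g = s * t * s := by decide
  obtain ⟨h₁, h₂, h₃, h₄, h₅, h₆⟩ := coeff_mk (x.coeff 1) (x.coeff s) (x.coeff t)
    (x.coeff (s * t)) (x.coeff (t * s)) (x.coeff (s * t * s))
  obtain rfl | rfl | rfl | rfl | rfl | rfl := hg g <;> simp only [*]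

lemma mk_inj {a b c d e f a' b' c' d' e' f' : ℤ} :
    mk a b c d e f = mk a' b' c' d' e' f' ↔
      a = a' ∧ b = b' ∧ c = c' ∧ d = d' ∧ e = e' ∧ f = f' := by
  refine ⟨fun h => ?_, by rintro ⟨rfl, rfl, rfl, rfl, rfl, rfl⟩; rfl⟩
  obtain ⟨h₁, h₂, h₃, h₄, h₅, h₆⟩ := coeff_mk a b c d e f
  obtain ⟨h₁', h₂', h₃', h₄', h₅', h₆'⟩ := coeff_mk a' b' c' d' e' f'
  rw [h] at h₁ h₂ h₃ h₄ h₅ h₆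
  exact ⟨h₁.symm.trans h₁', h₂.symm.trans h₂', h₃.symm.trans h₃', h₄.symm.trans h₄',
    h₅.symm.trans h₅', h₆.symm.trans h₆'⟩

lemma mk_add (a b c d e f a' b' c' d' e' f' : ℤ) :
    mk a b c d e f + mk a' b' c' d' e' f' =
      mk (a + a') (b + b') (c + c') (d + d') (e + e') (f + f') := by
  simp only [mk, MonoidAlgebra.single_add]
  abel

lemma zero_eq_mk : (0 : GroupRing) = mk 0 0 0 0 0 0 := by simp [mk]

lemma mk_eq_zero {a b c d e f : ℤ} :
    mk a b c d e f = 0 ↔ a = 0 ∧ b = 0 ∧ c = 0 ∧ d = 0 ∧ e = 0 ∧ f = 0 := by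
  rw [zero_eq_mk, mk_inj]

lemma mk_sub (a b c d e f a' b' c' d' e' f' : ℤ) :
    mk a b c d e f - mk a' b' c' d' e' f' =
      mk (a - a') (b - b') (c - c') (d - d') (e - e') (f - f') := by
  rw [sub_eq_iff_eq_add, mk_add, mk_inj]
  simp

lemma mk_mul_S (a b c d e f : ℤ) : mk a b c d e f * S = mk b a e f c d := by
  simp only [mk, S, add_mul, MonoidAlgebra.single_mul_single, mul_one, one_mul]
  rw [show s * s = 1 by decide, show t * s * s = t by decide, show s * t * s * s = s * t by decide]
  abel

lemma mk_mul_T (a b c d e f : ℤ) : mk a b c d e f * T = mk c d a b f e := by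
  simp only [mk, T, add_mul, MonoidAlgebra.single_mul_single, mul_one, one_mul]
  rw [show t * t = 1 by decide, show s * t * t = s by decide, show t * s * t = s * t * s by decide,
    show s * t * s * t = t * s by decide]
  abel

lemma lift_mk (a b c d e f : ℤ) :
    MonoidAlgebra.lift ℤ ℤ (Equiv.Perm (Fin 3)) 1 (mk a b c d e f) = a + b + c + d + e + f := by
  simp [mk]

lemma lift_S : MonoidAlgebra.lift ℤ ℤ (Equiv.Perm (Fin 3)) 1 S = 1 := by simp [S]

lemma lift_T : MonoidAlgebra.lift ℤ ℤ (Equiv.Perm (Fin 3)) 1 T = 1 := by simp [T]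

/-- The ranks `1, 2, 2, 1` of the modules in the periodic free resolution. -/
def rank : ℕ → ℕ
  | 0 => 1
  | 1 => 2
  | 2 => 2
  | 3 => 1
  | n + 4 => rank n

/-- The differential from degree `1` to degree `0`. -/
noncomputable def matrixZero : Matrix (Fin 2) (Fin 1) GroupRing := ![![S - 1], ![T - 1]]

/-- The differential from degree `2` to degree `1`. -/
noncomputable def matrixOne : Matrix (Fin 2) (Fin 2) GroupRing :=
  ![![1 + S, 0], ![1 + S * T - T, S - 1 - T * S]]

/-- The differential from degree `3` to degree `2`. -/
noncomputable def matrixTwo : Matrix (Fin 1) (Fin 2) GroupRing :=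
  ![![S - 1, 1 + T - S * T - S * T * S]]

/-- The differential from degree `4` to degree `3`, multiplication by the norm element. -/
noncomputable def matrixThree : Matrix (Fin 1) (Fin 1) GroupRing :=
  ![![1 + S + T + S * T + T * S + S * T * S]]

/-- The matrices of the differentials in the periodic free resolution. -/
noncomputable def matrix : ∀ n, Matrix (Fin (rank (n + 1))) (Fin (rank n)) GroupRing
  | 0 => matrixZero
  | 1 => matrixOne
  | 2 => matrixTwo
  | 3 => matrixThree
  | n + 4 => matrix n

/-- The rows of a matrix over the group ring, as elements of a free module. -/
noncomputable def toRows {a b : ℕ} (M : Matrix (Fin a) (Fin b) GroupRing) (i : Fin a) :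
    Fin b →₀ GroupRing :=
  Finsupp.equivFunOnFinite.symm (M i)

lemma exact_toRows {a b c : ℕ} {M : Matrix (Fin a) (Fin b) GroupRing}
    {N : Matrix (Fin b) (Fin c) GroupRing}
    (h : ∀ x : Fin b → GroupRing,
      (∀ j, ∑ i, x i * N i j = 0) ↔ ∃ y : Fin a → GroupRing, ∀ j, ∑ i, y i * M i j = x j) :
    Function.Exact
      (Representation.freeLift (Representation.free ℤ (Equiv.Perm (Fin 3)) _) (toRows M))
      (Representation.freeLift (Representation.free ℤ (Equiv.Perm (Fin 3)) _) (toRows N)) := by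
  intro x
  have hx := h x
  simp only [Finsupp.ext_iff, Set.mem_range, freeLift_apply_apply]
  refine hx.trans (Finsupp.equivFunOnFinite.symm.exists_congr fun y => ?_)
  rfl

lemma matrixOne_exact_matrixZero (x : Fin 2 → GroupRing) :
    (∀ j, ∑ i, x i * matrixZero i j = 0) ↔
      ∃ y : Fin 2 → GroupRing, ∀ j, ∑ i, y i * matrixOne i j = x j := by
  obtain ⟨a₀, b₀, c₀, d₀, e₀, f₀, h₀⟩ := exists_eq_mk (x 0)
  obtain ⟨a₁, b₁, c₁, d₁, e₁, f₁, h₁⟩ := exists_eq_mk (x 1)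
  simp only [matrixZero, matrixOne, Fin.forall_fin_one, Fin.forall_fin_two, Fin.sum_univ_two,
    Matrix.cons_val, h₀, h₁, mul_add, mul_sub, mul_one, mul_zero, ← mul_assoc, mk_mul_S, mk_mul_T,
    mk_add, mk_sub, zero_add, mk_eq_zero]
  constructor
  · intro h
    refine ⟨![mk (a₀ + e₁) 0 (c₀ + b₁) (d₀ + a₁) 0 0,
      mk (-e₁) (-b₁ - e₁) 0 (-a₁ - b₁) 0 (-a₀ + b₀ - a₁)], ?_⟩
    simp only [Matrix.cons_val, mk_mul_S, mk_mul_T, mk_add, mk_sub, zero_add, mk_inj]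
    omega
  · rintro ⟨y, hy⟩
    obtain ⟨p₀, q₀, r₀, u₀, v₀, w₀, k₀⟩ := exists_eq_mk (y 0)
    obtain ⟨p₁, q₁, r₁, u₁, v₁, w₁, k₁⟩ := exists_eq_mk (y 1)
    simp only [k₀, k₁, mk_mul_S, mk_mul_T, mk_add, mk_sub, mk_inj] at hy
    omega

lemma matrixTwo_exact_matrixOne (x : Fin 2 → GroupRing) :
    (∀ j, ∑ i, x i * matrixOne i j = 0) ↔
      ∃ y : Fin 1 → GroupRing, ∀ j, ∑ i, y i * matrixTwo i j = x j := by
  obtain ⟨a₀, b₀, c₀, d₀, e₀, f₀, h₀⟩ := exists_eq_mk (x 0)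
  obtain ⟨a₁, b₁, c₁, d₁, e₁, f₁, h₁⟩ := exists_eq_mk (x 1)
  simp only [matrixTwo, matrixOne, Fin.forall_fin_two, Fin.sum_univ_two, Fin.sum_univ_one,
    Matrix.cons_val, h₀, h₁, mul_add, mul_sub, mul_one, mul_zero, ← mul_assoc, mk_mul_S, mk_mul_T,
    mk_add, mk_sub, zero_add, mk_eq_zero]
  constructor
  · intro h
    refine ⟨![mk (c₀ + d₀ + a₁) (a₀ + c₀ + d₀ + a₁) (a₀ + a₁ - b₁) 0 (a₀ + c₀ + a₁ - b₁) d₀], ?_⟩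
    simp only [Matrix.cons_val, mk_mul_S, mk_mul_T, mk_add, mk_sub, mk_inj]
    omega
  · rintro ⟨y, hy⟩
    obtain ⟨p₀, q₀, r₀, u₀, v₀, w₀, k₀⟩ := exists_eq_mk (y 0)
    simp only [k₀, mk_mul_S, mk_mul_T, mk_add, mk_sub, mk_inj] at hy
    omega

lemma matrixThree_exact_matrixTwo (x : Fin 1 → GroupRing) :
    (∀ j, ∑ i, x i * matrixTwo i j = 0) ↔
      ∃ y : Fin 1 → GroupRing, ∀ j, ∑ i, y i * matrixThree i j = x j := by
  obtain ⟨a, b, c, d, e, f, h₀⟩ := exists_eq_mk (x 0)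
  simp only [matrixTwo, matrixThree, Fin.forall_fin_one, Fin.forall_fin_two, Fin.sum_univ_one,
    Matrix.cons_val, h₀, mul_add, mul_sub, mul_one, ← mul_assoc, mk_mul_S, mk_mul_T,
    mk_add, mk_sub, mk_eq_zero]
  constructor
  · intro h
    refine ⟨![mk a 0 0 0 0 0], ?_⟩
    simp only [Matrix.cons_val, mk_mul_S, mk_mul_T, mk_add, mk_inj]
    omega
  · rintro ⟨y, hy⟩
    obtain ⟨p₀, q₀, r₀, u₀, v₀, w₀, k₀⟩ := exists_eq_mk (y 0)
    simp only [k₀, mk_mul_S, mk_mul_T, mk_add, mk_inj] at hy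
    omega

lemma lift_eq_zero_iff (x : GroupRing) :
    MonoidAlgebra.lift ℤ ℤ (Equiv.Perm (Fin 3)) 1 x = 0 ↔
      ∃ y : Fin 2 → GroupRing, ∀ j, ∑ i, y i * matrixZero i j = x := by
  obtain ⟨a, b, c, d, e, f, rfl⟩ := exists_eq_mk x
  simp only [matrixZero, Fin.forall_fin_one, Fin.sum_univ_two, Matrix.cons_val, mul_sub, mul_one,
    lift_mk]
  constructor
  · intro h
    refine ⟨![mk (-a) 0 (-c) (-a - b - d) 0 0, mk 0 (-a - b) 0 0 (-c - e) 0], ?_⟩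
    simp only [Matrix.cons_val, mk_mul_S, mk_mul_T, mk_add, mk_sub, mk_inj]
    omega
  · rintro ⟨y, hy⟩
    obtain ⟨p₀, q₀, r₀, u₀, v₀, w₀, k₀⟩ := exists_eq_mk (y 0)
    obtain ⟨p₁, q₁, r₁, u₁, v₁, w₁, k₁⟩ := exists_eq_mk (y 1)
    simp only [k₀, k₁, mk_mul_S, mk_mul_T, mk_add, mk_sub, mk_inj] at hy
    omega

lemma mul_matrixThree_eq_zero_iff (x : Fin 1 → GroupRing) :
    (∀ j, ∑ i, x i * matrixThree i j = 0) ↔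
      MonoidAlgebra.lift ℤ ℤ (Equiv.Perm (Fin 3)) 1 (x 0) = 0 := by
  obtain ⟨a, b, c, d, e, f, h₀⟩ := exists_eq_mk (x 0)
  simp only [matrixThree, Fin.forall_fin_one, Fin.sum_univ_one, Matrix.cons_val, h₀, mul_add,
    mul_one, ← mul_assoc, mk_mul_S, mk_mul_T, mk_add, mk_eq_zero, lift_mk]
  omega

lemma matrixZero_exact_matrixThree (x : Fin 1 → GroupRing) :
    (∀ j, ∑ i, x i * matrixThree i j = 0) ↔
      ∃ y : Fin 2 → GroupRing, ∀ j, ∑ i, y i * matrixZero i j = x j := by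
  rw [mul_matrixThree_eq_zero_iff, lift_eq_zero_iff]
  simp only [Fin.forall_fin_one]

lemma exact_matrix : ∀ n, Function.Exact
    (Representation.freeLift (Representation.free ℤ (Equiv.Perm (Fin 3)) _)
      (toRows (matrix (n + 1))))
    (Representation.freeLift (Representation.free ℤ (Equiv.Perm (Fin 3)) _) (toRows (matrix n)))
  | 0 => exact_toRows matrixOne_exact_matrixZero
  | 1 => exact_toRows matrixTwo_exact_matrixOne
  | 2 => exact_toRows matrixThree_exact_matrixTwo
  | 3 => exact_toRows matrixZero_exact_matrixThree
  | n + 4 => exact_matrix n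

lemma exact_augmentation : Function.Exact
    (Representation.freeLift (Representation.free ℤ (Equiv.Perm (Fin 3)) _) (toRows matrixZero))
    (Representation.freeLift (Representation.trivial ℤ (Equiv.Perm (Fin 3)) ℤ)
      fun _ : Fin 1 => 1) := by
  intro x
  rw [freeLift_trivial_apply, Fin.sum_univ_one, mul_one, lift_eq_zero_iff, Set.mem_range]
  refine Finsupp.equivFunOnFinite.symm.exists_congr fun y => ?_
  rw [Finsupp.ext_iff]
  refine forall_congr' fun j => ?_
  rw [freeLift_apply_apply, Subsingleton.elim j 0]
  rfl

lemma surjective_augmentation : Function.Surjective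
    (Representation.freeLift (Representation.trivial ℤ (Equiv.Perm (Fin 3)) ℤ)
      fun _ : Fin 1 => 1) := by
  intro a
  refine ⟨Finsupp.single 0 (.single 1 a), ?_⟩
  rw [freeLift_trivial_apply]
  simp

lemma augmentedMap_toRows {a b : ℕ} (M : Matrix (Fin a) (Fin b) GroupRing) (x : Fin a →₀ ℤ)
    (j : Fin b) :
    augmentedMap (toRows M) x j =
      ∑ i, x i * MonoidAlgebra.lift ℤ ℤ (Equiv.Perm (Fin 3)) 1 (M i j) := by
  simp [augmentedMap, toRows, Finsupp.linearCombination_apply, Finsupp.sum_fintype]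

lemma augmentedMap_matrixZero : augmentedMap (toRows matrixZero) = 0 := by
  refine LinearMap.ext fun x => Finsupp.ext fun j => ?_
  rw [augmentedMap_toRows]
  fin_cases j
  simp [matrixZero, lift_S, lift_T]

lemma augmentedMap_matrixOne (x : Fin 2 →₀ ℤ) :
    augmentedMap (toRows matrixOne) x 0 = x 0 * 2 + x 1 ∧
      augmentedMap (toRows matrixOne) x 1 = -x 1 := by
  rw [augmentedMap_toRows, augmentedMap_toRows]
  simp [matrixOne, lift_S, lift_T, Fin.sum_univ_two, one_add_one_eq_two]

lemma augmentedMap_matrixTwo : augmentedMap (toRows matrixTwo) = 0 := by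
  refine LinearMap.ext fun x => Finsupp.ext fun j => ?_
  rw [augmentedMap_toRows]
  fin_cases j <;> simp [matrixTwo, lift_S, lift_T]

lemma augmentedMap_matrixThree (x : Fin 1 →₀ ℤ) :
    augmentedMap (toRows matrixThree) x 0 = x 0 * 6 := by
  rw [augmentedMap_toRows]
  simp [matrixThree, lift_S, lift_T]

/-- The group homology of the symmetric group on three letters, computed by the periodic
resolution. -/
noncomputable def groupHomologyEquiv (n : ℕ) :
    GroupHomology ℤ (Equiv.Perm (Fin 3)) ℤ (n + 1) ≃ₗ[ℤ]
      homologyAt (augmentedMap (toRows (matrix (n + 1)))) (augmentedMap (toRows (matrix n))) :=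
  groupHomologySuccEquivHomologyAt (fun n => Fin (rank n)) (fun n => toRows (matrix n))
    exact_matrix (fun _ => 1) exact_augmentation surjective_augmentation n

lemma homologyAt_matrix_zero :
    Nonempty (homologyAt (augmentedMap (toRows matrixOne)) (augmentedMap (toRows matrixZero)) ≃+
      ZMod 2) := by
  refine nonempty_homologyAt_addEquiv augmentedMap_matrixZero
    ((Int.castAddHom (ZMod 2)).comp (Finsupp.applyAddHom 0 + Finsupp.applyAddHom 1))
    (fun z => ?_) fun x => ?_
  · obtain ⟨a, rfl⟩ := ZMod.intCast_surjective z
    exact ⟨Finsupp.single 0 a, by simp⟩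
  · change ((x 0 + x 1 : ℤ) : ZMod 2) = 0 ↔ _
    rw [ZMod.intCast_zmod_eq_zero_iff_dvd]
    constructor
    · rintro ⟨a, ha⟩
      refine ⟨Finsupp.equivFunOnFinite.symm ![a, -x 1], Finsupp.ext ?_⟩
      simp only [Fin.forall_fin_two, augmentedMap_matrixOne,
        Finsupp.equivFunOnFinite_symm_apply_apply, Matrix.cons_val]
      omega
    · rintro ⟨y, rfl⟩
      simp only [augmentedMap_matrixOne]
      omega

lemma homologyAt_matrix_one :
    Subsingleton
      (homologyAt (augmentedMap (toRows matrixTwo)) (augmentedMap (toRows matrixOne))) := by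
  refine subsingleton_homologyAt _ fun x hx => Finsupp.ext ?_
  have h := augmentedMap_matrixOne x
  rw [hx] at h
  simp only [Finsupp.zero_apply] at h
  simp only [Fin.forall_fin_two, Finsupp.zero_apply]
  omega

lemma homologyAt_matrix_two :
    Nonempty (homologyAt (augmentedMap (toRows matrixThree)) (augmentedMap (toRows matrixTwo)) ≃+
      ZMod 6) := by
  refine nonempty_homologyAt_addEquiv augmentedMap_matrixTwo
    ((Int.castAddHom (ZMod 6)).comp (Finsupp.applyAddHom 0))
    (fun z => ?_) fun x => ?_
  · obtain ⟨a, rfl⟩ := ZMod.intCast_surjective z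
    exact ⟨Finsupp.single 0 a, by simp⟩
  · change ((x 0 : ℤ) : ZMod 6) = 0 ↔ _
    rw [ZMod.intCast_zmod_eq_zero_iff_dvd]
    constructor
    · rintro ⟨a, ha⟩
      refine ⟨Finsupp.single 0 a, Finsupp.ext ?_⟩
      simp only [Fin.forall_fin_one, augmentedMap_matrixThree, Finsupp.single_eq_same]
      omega
    · rintro ⟨y, rfl⟩
      simp only [augmentedMap_matrixThree]
      omega

lemma homologyAt_matrix_three :
    Subsingleton
      (homologyAt (augmentedMap (toRows matrixZero)) (augmentedMap (toRows matrixThree))) := by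
  refine subsingleton_homologyAt _ fun x hx => Finsupp.ext ?_
  have h := augmentedMap_matrixThree x
  rw [hx] at h
  simp only [Finsupp.zero_apply] at h
  simp only [Fin.forall_fin_one, Finsupp.zero_apply]
  omega

/-- The homology of the coinvariants of the periodic resolution. -/
lemma homologyAt_matrix : ∀ n,
    (n % 4 = 0 → Nonempty (homologyAt (augmentedMap (toRows (matrix (n + 1))))
      (augmentedMap (toRows (matrix n))) ≃+ ZMod 2)) ∧
    (n % 4 = 1 → Subsingleton (homologyAt (augmentedMap (toRows (matrix (n + 1))))
      (augmentedMap (toRows (matrix n))))) ∧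
    (n % 4 = 2 → Nonempty (homologyAt (augmentedMap (toRows (matrix (n + 1))))
      (augmentedMap (toRows (matrix n))) ≃+ ZMod 6)) ∧
    (n % 4 = 3 → Subsingleton (homologyAt (augmentedMap (toRows (matrix (n + 1))))
      (augmentedMap (toRows (matrix n)))))
  | 0 => ⟨fun _ => homologyAt_matrix_zero, by simp, by simp, by simp⟩
  | 1 => ⟨by simp, fun _ => homologyAt_matrix_one, by simp, by simp⟩
  | 2 => ⟨by simp, by simp, fun _ => homologyAt_matrix_two, by simp⟩
  | 3 => ⟨by simp, by simp, by simp, fun _ => homologyAt_matrix_three⟩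
  | n + 4 => by
    rw [Nat.add_mod_right]
    exact homologyAt_matrix n

end SymmetricGroupThree

/-- The integral homology of the symmetric group `S₃` in positive degrees. -/
theorem homology_S3 (q : ℕ) (hq : 1 ≤ q) :
    (q % 4 = 1 → Nonempty (GroupHomology ℤ (Equiv.Perm (Fin 3)) ℤ q ≃+ ZMod 2)) ∧
    (q % 4 = 2 → Subsingleton (GroupHomology ℤ (Equiv.Perm (Fin 3)) ℤ q)) ∧
    (q % 4 = 3 → Nonempty (GroupHomology ℤ (Equiv.Perm (Fin 3)) ℤ q ≃+ ZMod 6)) ∧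
    (q % 4 = 0 → Subsingleton (GroupHomology ℤ (Equiv.Perm (Fin 3)) ℤ q)) := by
  obtain ⟨n, rfl⟩ := Nat.exists_eq_add_of_le' hq
  obtain ⟨h₀, h₁, h₂, h₃⟩ := SymmetricGroupThree.homologyAt_matrix n
  have e := SymmetricGroupThree.groupHomologyEquiv n
  refine ⟨fun h => ?_, fun h => ?_, fun h => ?_, fun h => ?_⟩
  · exact (h₀ (by omega)).map e.toAddEquiv.trans
  · have := h₁ (by omega)
    exact e.injective.subsingleton
  · exact (h₂ (by omega)).map e.toAddEquiv.trans
  · have := h₃ (by omega)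
    exact e.injective.subsingleton
end

section
/- For the alternating group A_4 on four letters and every integer k ≥ 0, the integral group homology with trivial ℤ-coefficients satisfies, as abelian groups: H_{6k+1}(A_4; ℤ) ≅ (ℤ/2)^k ⊕ ℤ/3; H_{6k+2}(A_4; ℤ) ≅ (ℤ/2)^k ⊕ ℤ/2; H_{6k+3}(A_4; ℤ) ≅ (ℤ/2)^k ⊕ ℤ/6; H_{6k+4}(A_4; ℤ) ≅ (ℤ/2)^k; H_{6k+5}(A_4; ℤ) ≅ (ℤ/2)^k ⊕ ℤ/2 ⊕ ℤ/6; and H_{6k+6}(A_4; ℤ) ≅ (ℤ/2)^{k+1}. -/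
open BarHomology

namespace HomologyA4

open CategoryTheory groupHomology

section
variable {k G K : Type} [CommRing k] [Group G] [Group K]

lemma chainsMap_add' {A : Rep k G} {B : Rep k K} (f : G →* K) (φ ψ : A ⟶ Rep.res f B) :
    groupHomology.chainsMap f (φ + ψ) = groupHomology.chainsMap f φ + groupHomology.chainsMap f ψ := by
  refine HomologicalComplex.hom_ext _ _ fun n => ModuleCat.hom_ext (Finsupp.lhom_ext fun x a => ?_)
  erw [groupHomology.chainsMap_f_single]
  rw [HomologicalComplex.add_f_apply, ModuleCat.hom_add, LinearMap.add_apply]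
  erw [groupHomology.chainsMap_f_single, groupHomology.chainsMap_f_single]
  rw [← Finsupp.single_add]
  rfl

lemma map_add' {A : Rep k G} {B : Rep k K} (f : G →* K) (φ ψ : A ⟶ Rep.res f B) (n : ℕ) :
    map f (φ + ψ) n = map f φ n + map f ψ n := by
  rw [groupHomology.map, chainsMap_add', HomologicalComplex.homologyMap_add]
  rfl

lemma map_nsmul' {A : Rep k G} {B : Rep k K} (f : G →* K) (m : ℕ) (φ : A ⟶ Rep.res f B) (n : ℕ) :
    map f (m • φ) n = m • map f φ n := by
  induction m with
  | zero => rw [zero_smul, zero_smul, groupHomology.map, groupHomology.chainsMap_zero, HomologicalComplex.homologyMap_zero]; rfl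
  | succ m ih => rw [succ_nsmul, map_add', ih, succ_nsmul]

/-- The map on homology induced by a map of representations. -/
noncomputable abbrev hmap {A B : Rep k G} (f : A ⟶ B) (n : ℕ) :
    groupHomology A n →ₗ[k] groupHomology B n := (map (B := B) (MonoidHom.id G) f n).hom

lemma hmap_comp {A B C : Rep k G} (f : A ⟶ B) (g : B ⟶ C) (n : ℕ) :
    hmap (f ≫ g) n = hmap g n ∘ₗ hmap f n := by
  have := map_id_comp f g n
  exact congrArg ModuleCat.Hom.hom this

lemma hmap_nsmul {A B : Rep k G} (f : A ⟶ B) (m n : ℕ) :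
    hmap (m • f) n = m • hmap f n := congrArg ModuleCat.Hom.hom (map_nsmul' (B := B) (MonoidHom.id G) m f n)

lemma hmap_id (A : Rep k G) (n : ℕ) : hmap (𝟙 A) n = LinearMap.id := congrArg ModuleCat.Hom.hom (map_id (A := A) (n := n))

end

section LES
variable {k G : Type} [CommRing k] [Group G] {A B C : Rep k G} (f : A ⟶ B) (g : B ⟶ C)

/-- A short exact sequence of representations, stated on underlying functions. -/
structure SES : Prop where
  inj : Function.Injective f.hom
  exact : Function.Exact f.hom g.hom
  surj : Function.Surjective g.hom

variable {f g}

lemma SES.w (h : SES f g) : f ≫ g = 0 := by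
  ext x
  exact h.exact.apply_apply_eq_zero x

lemma SES.shortExact (h : SES f g) : (ShortComplex.mk f g h.w).ShortExact where
  exact := by
    refine (forget₂ (Rep k G) (ModuleCat k)).reflects_exact_of_faithful _ ?_
    rw [ShortComplex.moduleCat_exact_iff_range_eq_ker]
    exact (LinearMap.exact_iff.1 h.exact).symm
  mono_f := (Rep.mono_iff_injective _).2 h.inj
  epi_g := (Rep.epi_iff_surjective _).2 h.surj

lemma SES.exact₂ (h : SES f g) (n : ℕ) : Function.Exact (hmap f n) (hmap g n) := by
  have := mapShortComplex₂_exact h.shortExact n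
  rw [ShortComplex.moduleCat_exact_iff_range_eq_ker] at this
  exact LinearMap.exact_iff.2 this.symm

/-- The connecting homomorphism of a short exact sequence. -/
noncomputable def SES.δ (h : SES f g) (n : ℕ) : groupHomology C (n + 1) →ₗ[k] groupHomology A n :=
  (groupHomology.δ h.shortExact (n + 1) n rfl).hom

lemma SES.exact₁ (h : SES f g) (n : ℕ) : Function.Exact (h.δ n) (hmap f n) := by
  have := mapShortComplex₁_exact h.shortExact (i := n + 1) rfl
  rw [ShortComplex.moduleCat_exact_iff_range_eq_ker] at this
  exact LinearMap.exact_iff.2 this.symm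

lemma SES.exact₃ (h : SES f g) (n : ℕ) : Function.Exact (hmap g (n + 1)) (h.δ n) := by
  have := mapShortComplex₃_exact h.shortExact (i := n + 1) rfl
  rw [ShortComplex.moduleCat_exact_iff_range_eq_ker] at this
  exact LinearMap.exact_iff.2 this.symm

lemma SES.surj₀ (h : SES f g) : Function.Surjective (hmap g 0) := by
  have : Epi g := (Rep.epi_iff_surjective _).2 h.surj
  exact (ModuleCat.epi_iff_surjective _).1 (epi_map_0_of_epi g)
end LES

section Perm
variable (G : Type) [Group G] (X : Type) [MulAction G X] (A : Type) [AddCommGroup A]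

/-- The action of `G` on the `A`-valued functions on a `G`-set `X`. -/
def funRepr : Representation ℤ G (X → A) where
  toFun g := LinearMap.funLeft ℤ A (g⁻¹ • ·)
  map_one' := by ext; simp [LinearMap.funLeft]
  map_mul' g h := by ext; simp [LinearMap.funLeft, mul_smul]

/-- The representation of `G` on the `A`-valued functions on a `G`-set `X`. -/
noncomputable abbrev funRep : Rep ℤ G := Rep.of (funRepr G X A)

variable {G X A}
@[simp] lemma funRepr_apply (g : G) (f : X → A) (x : X) : funRepr G X A g f x = f (g⁻¹ • x) := rfl

end Perm

section Shapiro
variable {G : Type} [Group G] {X : Type} [MulAction G X] {A : Type} [AddCommGroup A]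

open MulAction

/-- Functions on the orbit of `x₀`, as elements of the module coinduced from the stabilizer. -/
noncomputable def funToCoind (x₀ : X) :
    (X → A) →ₗ[ℤ] Representation.coindV (stabilizer G x₀).subtype (Representation.trivial ℤ (stabilizer G x₀) A) where
  toFun φ := ⟨fun g => φ (g⁻¹ • x₀), fun s g => by
    have : (s : G)⁻¹ • x₀ = x₀ := by
      rw [inv_smul_eq_iff]; exact s.2.symm
    simp [mul_smul, this]⟩
  map_add' _ _ := rfl
  map_smul' _ _ := rfl

lemma funToCoind_bijective [IsPretransitive G X] (x₀ : X) : Function.Bijective (funToCoind (A := A) (G := G) x₀) := by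
  constructor
  · intro φ ψ h
    ext x
    obtain ⟨g, rfl⟩ := exists_smul_eq G x₀ x
    have := congrFun (congrArg Subtype.val h) g⁻¹
    simpa [funToCoind] using this
  · intro f
    choose t ht using exists_smul_eq G x₀
    refine ⟨fun x => f.1 (t x)⁻¹, Subtype.ext (funext fun g => ?_)⟩
    change f.1 (t (g⁻¹ • x₀))⁻¹ = f.1 g
    have hs : (t (g⁻¹ • x₀))⁻¹ * g⁻¹ ∈ stabilizer G x₀ := by
      rw [mem_stabilizer_iff, mul_smul, inv_smul_eq_iff, ht]
    have := f.2 ⟨_, hs⟩ g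
    simpa using this

/-- The Shapiro lemma for functions on a transitive `G`-set with point stabilizer the image of `Q`. -/
theorem shapiro [IsPretransitive G X] [Finite G] {Q : Type} [Group Q] (i : Q →* G) (hi : Function.Injective i)
    (x₀ : X) (hx : i.range = stabilizer G x₀) (n : ℕ) :
    Nonempty (groupHomology (funRep G X A) n ≃+ groupHomology (Rep.trivial ℤ Q A) n) := by
  classical
  let S := stabilizer G x₀
  let T := Rep.trivial ℤ S A
  let e₁ : groupHomology (funRep G X A) n ≅ groupHomology (Rep.coind S.subtype T) n :=
    mapIso (MulEquiv.refl G) (A := funRep G X A) (B := Rep.coind S.subtype T)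
      (LinearEquiv.ofBijective (funToCoind x₀) (funToCoind_bijective x₀)) (fun g => by
        ext φ h
        change φ (g⁻¹ • h⁻¹ • x₀) = φ ((h * g)⁻¹ • x₀)
        rw [mul_inv_rev, mul_smul]) n
  let e₂ : groupHomology (Rep.ind S.subtype T) n ≅ groupHomology (Rep.coind S.subtype T) n :=
    (groupHomology.functor ℤ G n).mapIso (Rep.indCoindIso.{0} T)
  let e₃ := groupHomology.indIso S T n
  let e : Q ≃* S := (MonoidHom.ofInjective hi).trans (MulEquiv.subgroupCongr hx)
  let e₄ : groupHomology (Rep.trivial ℤ Q A) n ≅ groupHomology T n :=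
    mapIso e (A := Rep.trivial ℤ Q A) (B := T) (LinearEquiv.refl ℤ A) (fun g => rfl) n
  exact ⟨(e₁ ≪≫ e₂.symm ≪≫ e₃ ≪≫ e₄.symm).toLinearEquiv.toAddEquiv⟩

end Shapiro

section Finiteness
variable {k G : Type} [CommRing k] [Group G]

lemma iCycles_injective (A : Rep k G) (n : ℕ) : Function.Injective (iCycles A n).hom :=
  (ModuleCat.mono_iff_injective (iCycles A n)).1
    (inferInstanceAs (Mono ((inhomogeneousChains A).iCycles n)))

lemma π_surjective (A : Rep k G) (n : ℕ) : Function.Surjective (π A n).hom := fun x =>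
  groupHomology_induction_on (C := fun x => ∃ y, (π A n).hom y = x) x fun y => ⟨y, rfl⟩

instance finite_groupHomology [Finite G] (A : Rep k G) [Finite A] (n : ℕ) :
    Finite (groupHomology A n) := by
  have : Finite ((inhomogeneousChains A).X n) :=
    Finite.of_injective (β := (Fin n → G) → A) (fun f : (Fin n → G) →₀ A => f) DFunLike.coe_injective
  have := Finite.of_injective _ (iCycles_injective A n)
  exact Finite.of_surjective _ (π_surjective A n)

instance module_finite_groupHomology [IsNoetherianRing k] [Finite G] (A : Rep k G)
    [Module.Finite k A] (n : ℕ) : Module.Finite k (groupHomology A n) := by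
  have : Module.Finite k ((inhomogeneousChains A).X n) :=
    inferInstanceAs (Module.Finite k ((Fin n → G) →₀ A))
  have := Module.Finite.of_injective _ (iCycles_injective A n)
  exact Module.Finite.of_surjective _ (π_surjective A n)

lemma finite_of_nsmul_eq_zero {M : Type} [AddCommGroup M] [inst : Module ℤ M] [Module.Finite ℤ M] {m : ℕ}
    (hm : m ≠ 0) (h : ∀ x : M, m • x = 0) : Finite M := by
  obtain rfl : inst = AddCommGroup.toIntModule M := Subsingleton.elim _ _
  refine Module.finite_of_fg_torsion M fun {x} => ⟨⟨(m : ℤ), ?_⟩, ?_⟩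
  · exact mem_nonZeroDivisors_of_ne_zero (by exact_mod_cast hm)
  · rw [Submonoid.mk_smul, natCast_zsmul, h]

end Finiteness

section Retract
variable (G : Type) [Group G] (X : Type) [MulAction G X] [Fintype X] (A : Type) [AddCommGroup A]

/-- Summing the values of a function on `X`. -/
def sumLin : (X → A) →ₗ[ℤ] A := ∑ x, LinearMap.proj x

@[simp] lemma sumLin_apply (f : X → A) : sumLin X A f = ∑ x, f x := by simp [sumLin]

variable {X} {A} in
lemma sumLin_funRepr (g : G) (f : X → A) : sumLin X A (funRepr G X A g f) = sumLin X A f := by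
  simpa using Equiv.sum_comp (MulAction.toPerm g⁻¹) f

/-- Summing the values of a function, as a map of representations. -/
noncomputable def sumHom : funRep G X A ⟶ Rep.trivial ℤ G A :=
  Rep.ofHom ⟨sumLin X A, fun g => LinearMap.ext fun f => sumLin_funRepr G g f⟩

/-- The inclusion of the constant functions. -/
noncomputable def constHom : Rep.trivial ℤ G A ⟶ funRep G X A :=
  Rep.ofHom ⟨LinearMap.pi fun _ => LinearMap.id, fun _ => rfl⟩

lemma constHom_sumHom : constHom G X A ≫ sumHom G X A = Fintype.card X • 𝟙 _ := by
  ext a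
  change sumLin X A (fun _ => a) = Fintype.card X • a
  simp

lemma hmap_sum_const (n : ℕ) (x : groupHomology (Rep.trivial ℤ G A) n) :
    hmap (sumHom G X A) n (hmap (constHom G X A) n x) = Fintype.card X • x := by
  have := LinearMap.congr_fun (congrArg (fun f => hmap f n) (constHom_sumHom G X A)) x
  rw [hmap_comp, hmap_nsmul, hmap_id] at this
  exact this

variable {G X A}

/-- The transfer argument: if `m` kills the homology of the stabilizer, then `m` times the index
kills that of `G`. -/
lemma nsmul_eq_zero_of_stabilizer [MulAction.IsPretransitive G X] [Finite G] {Q : Type} [Group Q] (i : Q →* G)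
    (hi : Function.Injective i) (x₀ : X) (hx : i.range = MulAction.stabilizer G x₀) (n m : ℕ)
    (h : ∀ x : groupHomology (Rep.trivial ℤ Q A) n, m • x = 0) (x : groupHomology (Rep.trivial ℤ G A) n) :
    (Fintype.card X * m) • x = 0 := by
  obtain ⟨e⟩ := shapiro (A := A) i hi x₀ hx n
  have h' : ∀ y : groupHomology (funRep G X A) n, m • y = 0 := fun y => e.injective (by simp [h])
  rw [mul_comm, mul_smul, ← hmap_sum_const, ← map_nsmul, h', map_zero]

variable {Q : Type} [Group Q]

/-- Summation, as a map covering a group homomorphism `r`. -/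
noncomputable def sumRes (r : G →* Q) : funRep G X A ⟶ Rep.res r (Rep.trivial ℤ Q A) := sumHom G X A

/-- The identity of `A`, as a map of trivial representations covering `r`. -/
noncomputable def trivRes (r : G →* Q) (A : Type) [AddCommGroup A] :
    Rep.trivial ℤ G A ⟶ Rep.res r (Rep.trivial ℤ Q A) := 𝟙 _

/-- Functions supported at the point `x₀`, as a map covering `s`. -/
noncomputable def singleRes [DecidableEq X] (s : Q →* G) (A : Type) [AddCommGroup A] (x₀ : X)
    (h : ∀ q, s q • x₀ = x₀) :
    Rep.trivial ℤ Q A ⟶ Rep.res s (funRep G X A) :=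
  Rep.ofHom ⟨LinearMap.single ℤ (fun _ => A) x₀, fun q => LinearMap.ext fun a => by
    ext x
    change (Pi.single x₀ a : X → A) x = (Pi.single x₀ a : X → A) ((s q)⁻¹ • x)
    have : (s q)⁻¹ • x = x₀ ↔ x = x₀ := by rw [inv_smul_eq_iff, h]
    by_cases hx : x = x₀
    · rw [this.2 hx, hx]
    · rw [Pi.single_eq_of_ne hx, Pi.single_eq_of_ne (mt this.1 hx)]⟩

/-- The stabilizer of `x₀` is a retract `Q` of `G`. -/
structure RetractData (s : Q →* G) (r : G →* Q) (x₀ : X) : Prop where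
  rs : r.comp s = MonoidHom.id Q
  range : s.range = MulAction.stabilizer G x₀

variable {s : Q →* G} {r : G →* Q} {x₀ : X}

lemma RetractData.injective (h : RetractData s r x₀) : Function.Injective s := by
  intro a b hab
  have := congrArg r hab
  rwa [← MonoidHom.comp_apply, ← MonoidHom.comp_apply, h.rs] at this

lemma RetractData.map_map_surj (h : RetractData s r x₀) (n : ℕ) (x : groupHomology (Rep.trivial ℤ Q A) n) :
    (groupHomology.map r (trivRes r A) n).hom ((groupHomology.map (B := Rep.trivial ℤ G A) s (trivRes s A) n).hom x) = x := by
  have := groupHomology.map_comp s r (A := Rep.trivial ℤ Q A) (B := Rep.trivial ℤ G A) (C := Rep.trivial ℤ Q A) (trivRes s A) (trivRes r A) n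
  have h2 : groupHomology.map (r.comp s) ((trivRes s A : Rep.trivial ℤ Q A ⟶ _) ≫ (Rep.resFunctor s).map (trivRes r A)) n = 𝟙 (groupHomology (Rep.trivial ℤ Q A) n) := by
    rw [← groupHomology.map_id]
    exact groupHomology.map_congr h.rs rfl n
  rw [h2] at this
  exact (congrArg (fun f => f.hom x) this).symm

lemma RetractData.sum_surjective (h : RetractData s r x₀) (n : ℕ) :
    Function.Surjective (groupHomology.map r (sumRes (X := X) (A := A) r) n).hom := by
  classical
  intro x
  have hs : ∀ q, s q • x₀ = x₀ := fun q => by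
    have : s q ∈ s.range := ⟨q, rfl⟩
    rwa [h.range] at this
  refine ⟨(groupHomology.map s (singleRes s A x₀ hs) n).hom x, ?_⟩
  have := groupHomology.map_comp s r (A := Rep.trivial ℤ Q A) (B := funRep G X A) (C := Rep.trivial ℤ Q A) (singleRes s A x₀ hs) (sumRes r) n
  have h2 : groupHomology.map (r.comp s) ((singleRes s A x₀ hs : Rep.trivial ℤ Q A ⟶ _) ≫ (Rep.resFunctor s).map (sumRes r)) n = 𝟙 (groupHomology (Rep.trivial ℤ Q A) n) := by
    rw [← groupHomology.map_id]
    refine groupHomology.map_congr h.rs ?_ n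
    refine LinearMap.ext fun a => ?_
    change sumLin X A (Pi.single x₀ a) = a
    simp
  rw [h2] at this
  exact (congrArg (fun f => f.hom x) this).symm

lemma map_sumRes (n : ℕ) (x : groupHomology (funRep G X A) n) :
    (groupHomology.map r (sumRes (X := X) (A := A) r) n).hom x =
    (groupHomology.map r (trivRes r A) n).hom (hmap (sumHom G X A) n x) := by
  have := groupHomology.map_comp (MonoidHom.id G) r (A := funRep G X A)
    (B := Rep.trivial ℤ G A) (C := Rep.trivial ℤ Q A) (sumHom G X A) (trivRes r A) n
  exact congrArg (fun f => f.hom x) this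

variable [MulAction.IsPretransitive G X] [Finite G]

lemma RetractData.sum_bijective (h : RetractData s r x₀) (n : ℕ)
    [Finite (groupHomology (Rep.trivial ℤ Q A) n)] :
    Function.Bijective (groupHomology.map r (sumRes (X := X) (A := A) r) n).hom := by
  obtain ⟨e⟩ := shapiro (A := A) s h.injective x₀ h.range n
  have : Finite (groupHomology (funRep G X A) n) := Finite.of_equiv _ e.symm.toEquiv
  exact (Nat.bijective_iff_surjective_and_card _).2 ⟨h.sum_surjective n, Nat.card_congr e.toEquiv⟩

lemma RetractData.hmap_sum_injective (h : RetractData s r x₀) (n : ℕ)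
    [Finite (groupHomology (Rep.trivial ℤ Q A) n)] :
    Function.Injective (hmap (sumHom G X A) n) := by
  intro x y hxy
  refine (h.sum_bijective n).1 ?_
  rw [map_sumRes, map_sumRes, hxy]

lemma RetractData.card_nsmul (h : RetractData s r x₀) (n : ℕ)
    [Finite (groupHomology (Rep.trivial ℤ Q A) n)]
    (x : groupHomology (Rep.trivial ℤ G A) n) (hx : (groupHomology.map r (trivRes r A) n).hom x = 0) :
    Fintype.card X • x = 0 := by
  rw [← hmap_sum_const]
  have : hmap (constHom G X A) n x = 0 := by
    refine (h.sum_bijective n).1 ?_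
    rw [map_sumRes, hmap_sum_const, map_nsmul, hx, smul_zero, map_zero]
  rw [this, map_zero]

end Retract

/-- The cyclic group of order `m`, written multiplicatively. -/
abbrev Cyc (m : ℕ) : Type := Multiplicative (ZMod m)

section
variable {G : Type} [Group G]

/-- Degree zero homology with trivial coefficients. -/
noncomputable def H0Equiv (A : Type) [AddCommGroup A] : groupHomology (Rep.trivial ℤ G A) 0 ≃ₗ[ℤ] A :=
  (H0IsoOfIsTrivial (Rep.trivial ℤ G A)).toLinearEquiv

lemma subsingleton_of_subsingleton [Subsingleton G] (A : Rep ℤ G) (n : ℕ) :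
    Subsingleton (groupHomology A (n + 1)) :=
  ModuleCat.subsingleton_of_isZero (isZero_groupHomology_succ_of_subsingleton A n)
end

section Cyclic
open Rep.FiniteCyclicGroup

instance finite_cyc (m : ℕ) [NeZero m] : Finite (Cyc m) := inferInstanceAs (Finite (ZMod m))

lemma comp_homologyπ_surjective (S : ShortComplex (ModuleCat ℤ)) {M N : ModuleCat ℤ}
    (e : M ≅ S.cycles) (e' : N ≅ S.homology) :
    Function.Surjective (e.hom ≫ S.homologyπ ≫ e'.inv).hom :=
  (ModuleCat.epi_iff_surjective _).1 inferInstance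

lemma cyc_gen (m : ℕ) [NeZero m] (x : Cyc m) : x ∈ Subgroup.zpowers (Multiplicative.ofAdd (1 : ZMod m)) := by
  refine ⟨(x.toAdd.val : ℤ), ?_⟩
  change Multiplicative.ofAdd (1 : ZMod m) ^ (x.toAdd.val : ℤ) = x
  rw [← ofAdd_zsmul]
  simp

lemma norm_trivial (m : ℕ) [NeZero m] (x : ℤ) :
    (Rep.trivial ℤ (Cyc m) ℤ).ρ.norm x = (m : ℤ) * x := by
  simp [Representation.norm]

lemma card_cyc_even (m : ℕ) [NeZero m] (i : ℕ) [NeZero i] (hi : Even i) :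
    Nat.card (groupHomology (Rep.trivial ℤ (Cyc m) ℤ) i) = 1 := by
  have hs : Function.Surjective (groupHomologyπEven (Rep.trivial ℤ (Cyc m) ℤ) _ (cyc_gen m) i hi).hom :=
    comp_homologyπ_surjective _ (ShortComplex.moduleCatCyclesIso _).symm _
  have : Subsingleton (LinearMap.ker (Rep.trivial ℤ (Cyc m) ℤ).ρ.norm) := by
    refine ⟨fun x y => Subtype.ext ?_⟩
    have key : ∀ z : LinearMap.ker (Rep.trivial ℤ (Cyc m) ℤ).ρ.norm, z.1 = (0 : ℤ) := fun z => by
      have := z.2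
      rw [LinearMap.mem_ker, norm_trivial] at this
      exact (mul_eq_zero.1 this).resolve_left (Nat.cast_ne_zero.2 (NeZero.ne m))
    rw [key, key]
  have : Subsingleton (groupHomology (Rep.trivial ℤ (Cyc m) ℤ) i) := hs.subsingleton
  exact Nat.card_of_subsingleton 0

lemma card_cyc_odd (m : ℕ) [NeZero m] (i : ℕ) (hi : Odd i) :
    Nat.card (groupHomology (Rep.trivial ℤ (Cyc m) ℤ) i) = m := by
  let A := Rep.trivial ℤ (Cyc m) ℤ
  let p := (groupHomologyπOdd A _ (cyc_gen m) i hi).hom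
  have hs : Function.Surjective p := comp_homologyπ_surjective _ (ShortComplex.moduleCatCyclesIso _).symm _
  have hz : ∀ x : ℤ, (Rep.applyAsHom A (Multiplicative.ofAdd (1 : ZMod m)) - 𝟙 A).hom.toLinearMap x = 0 := by
    intro x
    exact sub_self x
  let j : ℤ →+ groupHomology A i :=
    p.toAddMonoidHom.comp { toFun := fun x => ⟨x, hz x⟩, map_zero' := rfl, map_add' := fun _ _ => rfl }
  have hj : Function.Surjective j := fun y => by
    obtain ⟨x, rfl⟩ := hs y
    exact ⟨x.1, rfl⟩
  have hk : j.ker = AddSubgroup.zmultiples (m : ℤ) := by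
    ext x
    have := groupHomologyπOdd_eq_zero_iff A _ (cyc_gen m) i hi ⟨x, hz x⟩
    refine Iff.trans this ?_
    rw [Int.mem_zmultiples_iff]
    constructor
    · rintro ⟨y, hy⟩
      exact ⟨y, hy.symm.trans (norm_trivial m y)⟩
    · rintro ⟨y, rfl⟩
      exact ⟨y, norm_trivial m y⟩
  have e := QuotientAddGroup.quotientKerEquivOfSurjective j hj
  rw [← Nat.card_congr e.toEquiv, hk, Nat.card_congr (Int.quotientZMultiplesNatEquivZMod m).toEquiv, Nat.card_zmod]
end Cyclic

section Via
variable {G K : Type} [Group G] [Group K]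

/-- The set `K`, on which `G` acts by left multiplication through `t`. -/
@[ext]
structure Via (t : G →* K) : Type where
  val : K

/-- The underlying set of `Via t` is `K`. -/
def Via.equiv (t : G →* K) : K ≃ Via t := ⟨fun x => ⟨x⟩, fun x => x.val, fun _ => rfl, fun _ => rfl⟩

instance (t : G →* K) [Fintype K] : Fintype (Via t) := Fintype.ofEquiv K (Via.equiv t)

instance (t : G →* K) : MulAction G (Via t) where
  smul g x := ⟨t g * x.val⟩
  one_smul x := Via.ext <| show t 1 * x.val = x.val by rw [map_one, one_mul]
  mul_smul g h x := Via.ext <| show t (g * h) * x.val = t g * (t h * x.val) by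
    rw [map_mul, mul_assoc]

/-- The identity element of `K`, as a point of `Via t`. -/
def Via.base (t : G →* K) : Via t := ⟨1⟩

lemma Via.smul_val (t : G →* K) (g : G) (x : Via t) : (g • x).val = t g * x.val := rfl

lemma Via.card (t : G →* K) [Fintype K] : Fintype.card (Via t) = Fintype.card K :=
  Fintype.card_congr (Via.equiv t).symm

lemma Via.stabilizer_base (t : G →* K) : MulAction.stabilizer G (Via.base t) = t.ker := by
  ext g
  rw [MulAction.mem_stabilizer_iff, Via.ext_iff, Via.smul_val, MonoidHom.mem_ker]
  simp [Via.base]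

lemma Via.pretransitive (t : G →* K) (ht : Function.Surjective t) : MulAction.IsPretransitive G (Via t) where
  exists_smul_eq x y := by
    obtain ⟨g, hg⟩ := ht (y.val * x.val⁻¹)
    exact ⟨g, Via.ext (by rw [Via.smul_val, hg, inv_mul_cancel_right])⟩

end Via

section Kill

lemma cyc_nsmul (m : ℕ) [NeZero m] (A : Type) [AddCommGroup A] (n : ℕ)
    (x : groupHomology (Rep.trivial ℤ (Cyc m) A) (n + 1)) : m • x = 0 := by
  have := Via.pretransitive (MonoidHom.id (Cyc m)) Function.surjective_id
  have := nsmul_eq_zero_of_stabilizer (X := Via (MonoidHom.id (Cyc m))) (A := A) (1 : PUnit.{1} →* Cyc m)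
    (Function.injective_of_subsingleton _) (Via.base _) (by
      rw [Via.stabilizer_base]; ext x; simp) (n + 1) 1 (fun x => by
        have := subsingleton_of_subsingleton (Rep.trivial ℤ PUnit.{1} A) n
        exact Subsingleton.elim _ _) x
  rw [mul_one] at this
  rwa [Via.card, Fintype.card_multiplicative, ZMod.card] at this

end Kill

section Counting
variable {R M N P : Type} [Ring R] [AddCommGroup M] [AddCommGroup N] [AddCommGroup P] [Module R M]
  [Module R N] [Module R P]

lemma card_eq_ker_mul_range (f : M →ₗ[R] N) : Nat.card M = Nat.card f.ker * Nat.card f.range := by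
  rw [Submodule.card_eq_card_quotient_mul_card f.ker, Nat.card_congr f.quotKerEquivRange.toEquiv,
    mul_comm]

lemma card_range_of_injective (f : M →ₗ[R] N) (hf : Function.Injective f) :
    Nat.card f.range = Nat.card M :=
  (Nat.card_congr (LinearEquiv.ofInjective f hf).toEquiv).symm

lemma card_range_of_surjective (f : M →ₗ[R] N) (hf : Function.Surjective f) :
    Nat.card f.range = Nat.card N := by
  rw [LinearMap.range_eq_top.2 hf, Nat.card_congr Submodule.topEquiv.toEquiv]

lemma card_ker_of_eq_zero (f : M →ₗ[R] N) (hf : f = 0) : Nat.card f.ker = Nat.card M := by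
  rw [hf, LinearMap.ker_zero, Nat.card_congr Submodule.topEquiv.toEquiv]

lemma card_range_of_eq_zero (f : M →ₗ[R] N) (hf : f = 0) : Nat.card f.range = 1 := by
  rw [hf, LinearMap.range_zero, Nat.card_of_subsingleton 0]

lemma card_ker_of_injective (f : M →ₗ[R] N) (hf : Function.Injective f) : Nat.card f.ker = 1 := by
  rw [LinearMap.ker_eq_bot.2 hf, Nat.card_of_subsingleton 0]

lemma eq_zero_of_exact_of_injective {f : M →ₗ[R] N} {g : N →ₗ[R] P} (h : Function.Exact f g)
    (hg : Function.Injective g) : f = 0 :=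
  LinearMap.ext fun x => hg (by rw [h.apply_apply_eq_zero, LinearMap.zero_apply, map_zero])

lemma card_mul_of_exact {f : M →ₗ[R] N} {g : N →ₗ[R] P} (h : Function.Exact f g) :
    Nat.card N = Nat.card f.range * Nat.card g.range := by
  rw [card_eq_ker_mul_range g, LinearMap.exact_iff.1 h]
end Counting

section
variable {k G : Type} [CommRing k] [Group G] {A B C : Rep k G} {f : A ⟶ B} {g : B ⟶ C}

lemma SES.card_mid (h : SES f g) (n : ℕ) :
    Nat.card (groupHomology B n) = Nat.card (hmap f n).range * Nat.card (hmap g n).range :=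
  card_mul_of_exact (h.exact₂ n)

lemma SES.card_right (h : SES f g) (n : ℕ) :
    Nat.card (groupHomology C (n + 1)) = Nat.card (hmap g (n + 1)).range * Nat.card (hmap f n).ker := by
  rw [card_mul_of_exact (h.exact₃ n), LinearMap.exact_iff.1 (h.exact₁ n)]
end

section Double
variable {G X : Type} [Group G] [MulAction G X] [Fintype X]

lemma ses_const_sum (hX : Fintype.card X = 2) :
    SES (constHom G X (ZMod 2)) (sumHom G X (ZMod 2)) where
  inj := by
    have : Nonempty X := Fintype.card_pos_iff.1 (by omega)
    intro a b hab
    exact congrFun hab (Classical.arbitrary X)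
  exact := by
    obtain ⟨e⟩ : Nonempty (Fin 2 ≃ X) := ⟨(Fintype.equivFinOfCardEq hX).symm⟩
    intro (f : X → ZMod 2)
    change sumLin X (ZMod 2) f = 0 ↔ ∃ a : ZMod 2, (fun _ => a) = f
    rw [sumLin_apply, ← e.sum_comp, Fin.sum_univ_two]
    constructor
    · intro h
      refine ⟨f (e 0), funext fun x => ?_⟩
      have h' : f (e 0) = f (e 1) := by
        generalize f (e 0) = a at *
        generalize f (e 1) = b at *
        revert a b
        decide
      obtain ⟨i, rfl⟩ := e.surjective x
      fin_cases i
      · rfl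
      · exact h'
    · rintro ⟨a, rfl⟩
      exact CharTwo.add_self_eq_zero a
  surj := by
    classical
    have : Nonempty X := Fintype.card_pos_iff.1 (by omega)
    intro a
    refine ⟨(Pi.single (Classical.arbitrary X) a : X → ZMod 2), ?_⟩
    change sumLin X (ZMod 2) _ = a
    simp

theorem RetractData.card_succ [MulAction.IsPretransitive G X] [Finite G] {Q : Type} [Group Q] [Finite Q]
    {s : Q →* G} {r : G →* Q} {x₀ : X} (h : RetractData s r x₀) (hX : Fintype.card X = 2) (n : ℕ) :
    Nat.card (groupHomology (Rep.trivial ℤ G (ZMod 2)) (n + 1)) =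
      Nat.card (groupHomology (Rep.trivial ℤ Q (ZMod 2)) (n + 1)) *
      Nat.card (groupHomology (Rep.trivial ℤ G (ZMod 2)) n) := by
  have hs := ses_const_sum (G := G) hX
  obtain ⟨e⟩ := shapiro (A := ZMod 2) s h.injective x₀ h.range (n + 1)
  rw [hs.card_right, card_range_of_injective _ (h.hmap_sum_injective _), Nat.card_congr e.toEquiv,
    card_ker_of_eq_zero _ (eq_zero_of_exact_of_injective (hs.exact₂ n) (h.hmap_sum_injective n))]
end Double

section KleinFour

lemma card_H0 (G : Type) [Group G] : Nat.card (groupHomology (Rep.trivial ℤ G (ZMod 2)) 0) = 2 := by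
  rw [Nat.card_congr (H0Equiv (ZMod 2)).toEquiv, Nat.card_zmod]

lemma retract_C2 : RetractData (1 : PUnit.{1} →* Cyc 2) 1 (Via.base (MonoidHom.id (Cyc 2))) where
  rs := by ext
  range := by rw [Via.stabilizer_base]; ext x; simp

lemma retract_V : RetractData (MonoidHom.inl (Cyc 2) (Cyc 2)) (MonoidHom.fst (Cyc 2) (Cyc 2))
    (Via.base (MonoidHom.snd (Cyc 2) (Cyc 2))) where
  rs := by ext; rfl
  range := by
    rw [Via.stabilizer_base]
    ext ⟨a, b⟩
    simp [Subgroup.mem_prod, eq_comm]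

instance : MulAction.IsPretransitive (Cyc 2) (Via (MonoidHom.id (Cyc 2))) :=
  Via.pretransitive _ Function.surjective_id

instance : MulAction.IsPretransitive (Cyc 2 × Cyc 2) (Via (MonoidHom.snd (Cyc 2) (Cyc 2))) :=
  Via.pretransitive _ Prod.snd_surjective

theorem card_C2 (n : ℕ) : Nat.card (groupHomology (Rep.trivial ℤ (Cyc 2) (ZMod 2)) n) = 2 := by
  induction n with
  | zero => exact card_H0 _
  | succ n ih =>
    have := subsingleton_of_subsingleton (Rep.trivial ℤ PUnit.{1} (ZMod 2)) n
    rw [retract_C2.card_succ rfl, ih, Nat.card_of_subsingleton 0]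

theorem card_V (n : ℕ) :
    Nat.card (groupHomology (Rep.trivial ℤ (Cyc 2 × Cyc 2) (ZMod 2)) n) = 2 ^ (n + 1) := by
  induction n with
  | zero => exact card_H0 _
  | succ n ih => rw [retract_V.card_succ rfl, ih, card_C2, pow_succ' 2 (n + 1)]

theorem two_nsmul_V (n : ℕ) (x : groupHomology (Rep.trivial ℤ (Cyc 2 × Cyc 2) ℤ) (n + 1)) :
    2 • x = 0 := by
  have : Finite (groupHomology (Rep.trivial ℤ (Cyc 2) ℤ) (n + 1)) :=
    finite_of_nsmul_eq_zero two_ne_zero (cyc_nsmul 2 ℤ n)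
  let s := (groupHomology.map (B := Rep.trivial ℤ (Cyc 2 × Cyc 2) ℤ) (MonoidHom.inl (Cyc 2) (Cyc 2)) (trivRes _ ℤ) (n + 1)).hom
  let r := (groupHomology.map (MonoidHom.fst (Cyc 2) (Cyc 2)) (trivRes _ ℤ) (n + 1)).hom
  have h := retract_V.card_nsmul (A := ℤ) (n + 1) (x - s (r x)) (by
    rw [map_sub]
    exact sub_eq_zero.2 (retract_V.map_map_surj (n + 1) (r x)).symm)
  change 2 • (x - s (r x)) = 0 at h
  rw [smul_sub, ← map_nsmul, cyc_nsmul, map_zero, sub_zero] at h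
  exact h

end KleinFour

/-- The alternating group on four letters. -/
abbrev A4 : Type := alternatingGroup (Fin 4)

open Equiv in
/-- The product of the transpositions `(a b)` and `(c d)`. -/
def swaps (a b c d : Fin 4) (h : Perm.sign (swap a b * swap c d) = 1 := by decide) : A4 :=
  ⟨swap a b * swap c d, Perm.mem_alternatingGroup.2 h⟩

/-- The projection onto the cyclic group of order three, through the action on the three
pairings of `Fin 4`. -/
def toC3 : A4 →* Cyc 3 :=
  MonoidHom.mk' (fun g => Multiplicative.ofAdd (-(((g.1 3).val ^^^ (g.1 0).val : ℕ) : ZMod 3)))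
    (by decide +kernel)

/-- The cyclic subgroup of order three fixing the letter `3`. -/
def ofC3 : Cyc 3 →* A4 :=
  MonoidHom.mk' (fun a => swaps 0 1 1 2 ^ a.toAdd.val) (by decide +kernel)

/-- The inclusion of the Klein four-group. -/
def ofV : Cyc 2 × Cyc 2 →* A4 :=
  MonoidHom.mk' (fun a => swaps 0 1 2 3 ^ a.1.toAdd.val *
    swaps 0 2 1 3 ^ a.2.toAdd.val) (by decide +kernel)

/-- The two-element subsets of `Fin 4`. -/
structure Pair where
  set : Finset (Fin 4)
  card : set.card = 2

@[ext] lemma Pair.ext {p q : Pair} (h : p.set = q.set) : p = q := by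
  cases p; cases q; cases h; rfl

/-- A pair is a finset of cardinality two. -/
def Pair.equiv : {s : Finset (Fin 4) // s.card = 2} ≃ Pair :=
  ⟨fun s => ⟨s.1, s.2⟩, fun p => ⟨p.1, p.2⟩, fun _ => rfl, fun _ => rfl⟩

instance : Fintype Pair := Fintype.ofEquiv _ Pair.equiv
instance : DecidableEq Pair := fun p q => decidable_of_iff (p.set = q.set) ⟨Pair.ext, fun h => h ▸ rfl⟩

open Pointwise in
instance : MulAction A4 Pair where
  smul g p := ⟨g • p.set, by rw [Finset.card_smul_finset, p.card]⟩
  one_smul p := Pair.ext (one_smul _ _)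
  mul_smul g h p := Pair.ext (mul_smul _ _ _)

/-- The cyclic subgroup generated by `(0 1)(2 3)`. -/
def ofC2 : Cyc 2 →* A4 :=
  MonoidHom.mk' (fun a => swaps 0 1 2 3 ^ a.toAdd.val) (by decide +kernel)

lemma ofC2_range : ofC2.range = MulAction.stabilizer A4 (⟨{0, 1}, rfl⟩ : Pair) := by
  have : ∀ g : A4, (∃ a, ofC2 a = g) ↔ g • (⟨{0, 1}, rfl⟩ : Pair) = ⟨{0, 1}, rfl⟩ := by
    decide +kernel
  exact Subgroup.ext this

lemma ofC2_injective : Function.Injective ofC2 := by decide +kernel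
lemma ofC3_injective : Function.Injective ofC3 := by decide +kernel
lemma ofV_injective : Function.Injective ofV := by decide +kernel
lemma toC3_surjective : Function.Surjective toC3 := by decide +kernel

lemma ofV_range : ofV.range = MulAction.stabilizer A4 (Via.base toC3) := by
  have : ∀ g : A4, (∃ a, ofV a = g) ↔ toC3 g = 1 := by decide +kernel
  rw [Via.stabilizer_base]
  exact Subgroup.ext this

lemma retract_A4 : RetractData ofC3 toC3 (3 : Fin 4) where
  rs := by
    have : ∀ a, toC3 (ofC3 a) = a := by decide +kernel
    exact MonoidHom.ext this
  range := by
    have : ∀ g : A4, (∃ a, ofC3 a = g) ↔ g • (3 : Fin 4) = 3 := by decide +kernel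
    exact Subgroup.ext this

instance : MulAction.IsPretransitive A4 (Fin 4) := ⟨by decide +kernel⟩
instance : MulAction.IsPretransitive A4 Pair := ⟨by decide +kernel⟩
instance : MulAction.IsPretransitive A4 (Via toC3) := Via.pretransitive _ toC3_surjective

section Augmentation
variable (G : Type) [Group G] (X : Type) [MulAction G X] [Fintype X] (A : Type) [AddCommGroup A]

/-- The functions on `X` with sum zero. -/
noncomputable def augRepr : Representation ℤ G (sumLin X A).ker where
  toFun g := (funRepr G X A g).restrict fun f hf => by
    rw [LinearMap.mem_ker] at hf ⊢
    rw [sumLin_funRepr, hf]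
  map_one' := by ext; simp
  map_mul' g h := by ext; simp

/-- The functions on `X` with sum zero, as an object of `Rep ℤ G`. -/
noncomputable abbrev augRep : Rep ℤ G := Rep.of (augRepr G X A)

/-- The inclusion of the functions with sum zero. -/
noncomputable def augHom : augRep G X A ⟶ funRep G X A :=
  Rep.ofHom ⟨(sumLin X A).ker.subtype, fun _ => rfl⟩

lemma ses_aug [Nonempty X] : SES (augHom G X A) (sumHom G X A) where
  inj := Subtype.val_injective
  exact f := ⟨fun h => ⟨⟨f, h⟩, rfl⟩, fun ⟨f', h⟩ => h ▸ f'.2⟩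
  surj a := by
    classical
    refine ⟨(Pi.single (Classical.arbitrary X) a : X → A), ?_⟩
    change sumLin X A _ = a
    simp

instance [Finite A] : Finite (augRep G X A) := inferInstanceAs (Finite (sumLin X A).ker)

end Augmentation

/-- The trivial representation on `ZMod 2`. -/
noncomputable abbrev F2 : Rep ℤ A4 := Rep.trivial ℤ A4 (ZMod 2)
/-- Mod 2 functions on the three pairings of `Fin 4`. -/
noncomputable abbrev R3 : Rep ℤ A4 := funRep A4 (Via toC3) (ZMod 2)
/-- Mod 2 functions on `Fin 4`. -/
noncomputable abbrev R4 : Rep ℤ A4 := funRep A4 (Fin 4) (ZMod 2)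
/-- Mod 2 functions on the six pairs in `Fin 4`. -/
noncomputable abbrev R6 : Rep ℤ A4 := funRep A4 Pair (ZMod 2)
/-- Mod 2 functions on `Fin 4` with sum zero. -/
noncomputable abbrev E4 : Rep ℤ A4 := augRep A4 (Fin 4) (ZMod 2)
/-- Mod 2 functions on the three pairings with sum zero. -/
noncomputable abbrev W3 : Rep ℤ A4 := augRep A4 (Via toC3) (ZMod 2)

instance : DecidableEq (Via toC3) := fun x y => decidable_of_iff (x.val = y.val) Via.ext_iff.symm

lemma card_R3 (n : ℕ) : Nat.card (groupHomology R3 n) = 2 ^ (n + 1) := by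
  obtain ⟨e⟩ := shapiro (A := ZMod 2) ofV ofV_injective _ ofV_range n
  rw [Nat.card_congr e.toEquiv, card_V]

lemma card_R6 (n : ℕ) : Nat.card (groupHomology R6 n) = 2 := by
  obtain ⟨e⟩ := shapiro (A := ZMod 2) ofC2 ofC2_injective _ ofC2_range n
  rw [Nat.card_congr e.toEquiv, card_C2]

lemma two_nsmul_trivial {G : Type} [Group G] (n : ℕ)
    (x : groupHomology (Rep.trivial ℤ G (ZMod 2)) n) : 2 • x = 0 := by
  have : 2 • 𝟙 (Rep.trivial ℤ G (ZMod 2)) = 0 := by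
    ext a
    exact (by decide : ∀ a : ZMod 2, 2 • a = 0) a
  have := LinearMap.congr_fun (congrArg (fun f => hmap f n) this) x
  rw [hmap_nsmul, hmap_id] at this
  refine Eq.trans this ?_
  have h0 : hmap (0 : Rep.trivial ℤ G (ZMod 2) ⟶ Rep.trivial ℤ G (ZMod 2)) n = 0 := by
    have := hmap_nsmul (0 : Rep.trivial ℤ G (ZMod 2) ⟶ Rep.trivial ℤ G (ZMod 2)) 0 n
    rwa [smul_zero, zero_smul] at this
  rw [h0]
  rfl

lemma subsingleton_R4 (n : ℕ) : Subsingleton (groupHomology R4 (n + 1)) := by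
  obtain ⟨e⟩ := shapiro (A := ZMod 2) ofC3 ofC3_injective _ retract_A4.range (n + 1)
  have : Subsingleton (groupHomology (Rep.trivial ℤ (Cyc 3) (ZMod 2)) (n + 1)) := by
    refine subsingleton_of_forall_eq 0 fun x => ?_
    have h2 := two_nsmul_trivial _ x
    have h3 := cyc_nsmul 3 _ _ x
    rwa [succ_nsmul, h2, zero_add] at h3
  exact e.toEquiv.subsingleton

/-- The pairing consisting of a pair and its complement. -/
def Pair.pairing (p : Pair) : Via toC3 := ⟨Multiplicative.ofAdd (-((p.set.fold (· ^^^ ·) 0 Fin.val : ℕ) : ZMod 3))⟩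

lemma Pair.pairing_smul : ∀ (g : A4) (p : Pair), (g • p).pairing = g • p.pairing := by
  decide +kernel

/-- The letter matched with `3` in a pairing. -/
def partner (y : Via toC3) : Fin 4 := ⟨y.val.toAdd.val, (ZMod.val_lt _).trans (by decide)⟩

/-- The pair containing `3` in a pairing. -/
def Pair.withThree (y : Via toC3) : Pair := ⟨{3, partner y}, by revert y; decide +kernel⟩
/-- The pair not containing `3` in a pairing. -/
def Pair.withoutThree (y : Via toC3) : Pair := ⟨{3, partner y}ᶜ, by revert y; decide +kernel⟩

lemma pairing_with : ∀ y : Via toC3, (Pair.withThree y).pairing = y := by decide +kernel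
lemma pairing_without : ∀ y : Via toC3, (Pair.withoutThree y).pairing = y := by decide +kernel

lemma pairing_cases : ∀ p : Pair, p = Pair.withThree p.pairing ∨ p = Pair.withoutThree p.pairing := by
  decide +kernel

lemma with_smul : ∀ (g : A4) (y : Via toC3),
    (g • Pair.withThree y = Pair.withThree (g • y) ∧ g • Pair.withoutThree y = Pair.withoutThree (g • y)) ∨
    (g • Pair.withThree y = Pair.withoutThree (g • y) ∧ g • Pair.withoutThree y = Pair.withThree (g • y)) := by
  decide +kernel

/-- Pulling back a function along the map from pairs to pairings. -/
noncomputable def pullPairing : R3 ⟶ R6 :=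
  Rep.ofHom ⟨LinearMap.funLeft ℤ (ZMod 2) Pair.pairing, fun g => LinearMap.ext fun (f : Via toC3 → ZMod 2) => funext fun p => by
    change f (g⁻¹ • p.pairing) = f (g⁻¹ • p).pairing
    rw [Pair.pairing_smul]⟩

/-- Summing a function over the two pairs of a pairing. -/
noncomputable def pushPairing : R6 ⟶ R3 :=
  Rep.ofHom ⟨
    { toFun f y := f (Pair.withThree y) + f (Pair.withoutThree y)
      map_add' f g := funext fun y => add_add_add_comm _ _ _ _
      map_smul' c f := funext fun y => (smul_add c _ _).symm },
    fun g => LinearMap.ext fun (f : Pair → ZMod 2) => funext fun y => by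
    change f (g⁻¹ • Pair.withThree y) + f (g⁻¹ • Pair.withoutThree y) =
      f (Pair.withThree (g⁻¹ • y)) + f (Pair.withoutThree (g⁻¹ • y))
    obtain ⟨h₁, h₂⟩ | ⟨h₁, h₂⟩ := with_smul g⁻¹ y
    · rw [h₁, h₂]
    · rw [h₁, h₂, add_comm]⟩

lemma eq_of_add_eq_zero : ∀ a b : ZMod 2, a + b = 0 → a = b := by decide

lemma ses_pairing : SES pullPairing pushPairing where
  inj f g h := funext fun y => by
    have := congrFun h (Pair.withThree y)
    change f (Pair.withThree y).pairing = g (Pair.withThree y).pairing at this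
    rwa [pairing_with] at this
  exact (f : Pair → ZMod 2) := by
    constructor
    · intro h
      refine ⟨fun y => f (Pair.withThree y), funext fun p => ?_⟩
      change f (Pair.withThree p.pairing) = f p
      have := eq_of_add_eq_zero _ _ (congrFun h p.pairing)
      obtain hp | hp := pairing_cases p
      · rw [← hp]
      · rw [hp, pairing_without]
        exact this
    · rintro ⟨f, rfl⟩
      funext y
      change f (Pair.withThree y).pairing + f (Pair.withoutThree y).pairing = 0
      rw [pairing_with, pairing_without]
      exact CharTwo.add_self_eq_zero (f y)
  surj (f : Via toC3 → ZMod 2) := by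
    refine ⟨fun p => if 3 ∈ p.set then f p.pairing else 0, funext fun y => ?_⟩
    have h₁ : 3 ∈ (Pair.withThree y).set := by simp [Pair.withThree]
    have h₂ : 3 ∉ (Pair.withoutThree y).set := by simp [Pair.withoutThree]
    change (if 3 ∈ (Pair.withThree y).set then f (Pair.withThree y).pairing else 0) + (if 3 ∈ (Pair.withoutThree y).set then f (Pair.withoutThree y).pairing else 0) = f y
    rw [if_pos h₁, if_neg h₂, pairing_with, add_zero]

lemma card_range_pull (n : ℕ) : Nat.card (hmap pullPairing n).range = 1 := by
  have hm := ses_pairing.card_mid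
  simp only [card_R6] at hm
  have hr := ses_pairing.card_right
  simp only [card_R3] at hr
  have hl : ∀ n, 2 ^ (n + 1) = _ := fun n => (card_R3 n).symm.trans (card_eq_ker_mul_range (hmap pullPairing n))
  induction n with
  | zero =>
    have h0 := hm 0
    rw [card_range_of_surjective _ ses_pairing.surj₀, card_R3] at h0
    omega
  | succ n ih =>
    have h1 := hl n
    rw [ih, mul_one] at h1
    have h2 := hr n
    rw [← h1, pow_succ' 2 (n + 1)] at h2
    have h3 := Nat.eq_of_mul_eq_mul_right (by positivity) h2
    have h4 := hm (n + 1)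
    rw [← h3] at h4
    omega

lemma hmap_pull (n : ℕ) : hmap pullPairing n = 0 := by
  have := (Nat.card_eq_one_iff_unique.1 (card_range_pull n)).1
  exact LinearMap.range_eq_bot.1 (Submodule.eq_bot_of_subsingleton)

/-- Summing a function over the pairs that contain a given letter. -/
noncomputable def pushPoint : R6 ⟶ E4 :=
  Rep.ofHom ⟨LinearMap.codRestrict (sumLin (Fin 4) (ZMod 2)).ker
    { toFun f a := ∑ p : Pair, if a ∈ p.set then f p else 0
      map_add' f g := funext fun a => by
        simp only [Pi.add_apply, ← Finset.sum_add_distrib]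
        exact Finset.sum_congr rfl fun p _ => by split_ifs <;> simp
      map_smul' c f := funext fun a => by
        simp only [Pi.smul_apply, Finset.smul_sum, RingHom.id_apply]
        exact Finset.sum_congr rfl fun p _ => by split_ifs <;> simp }
    (fun f => by
      rw [LinearMap.mem_ker, sumLin_apply]
      change ∑ a, ∑ p : Pair, (if a ∈ p.set then f p else 0) = 0
      rw [Finset.sum_comm]
      refine Finset.sum_eq_zero fun p _ => ?_
      rw [← Finset.sum_filter, Finset.filter_mem_eq_inter, Finset.univ_inter, Finset.sum_const,
        p.card]
      exact (by decide : ∀ a : ZMod 2, 2 • a = 0) _),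
    fun g => LinearMap.ext fun (f : Pair → ZMod 2) => Subtype.ext <| funext fun a => by
      change (∑ p : Pair, if a ∈ p.set then f (g⁻¹ • p) else 0) =
        ∑ p : Pair, if g⁻¹ • a ∈ p.set then f p else 0
      refine Eq.trans ?_ (Equiv.sum_comp (MulAction.toPerm g⁻¹ : Equiv.Perm Pair)
        fun p : Pair => if g⁻¹ • a ∈ p.set then f p else 0)
      refine Finset.sum_congr rfl fun p _ => if_congr ?_ rfl rfl
      exact (Finset.smul_mem_smul_finset_iff (s := p.set) g⁻¹).symm⟩

/-- The constant functions on `Fin 4` have sum zero modulo 2; this inclusion factors through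
`R6`. -/
noncomputable def constAug : F2 ⟶ E4 :=
  constHom A4 (Via toC3) (ZMod 2) ≫ pullPairing ≫ pushPoint

lemma constAug_apply (x : ZMod 2) (a : Fin 4) : (constAug.hom x).1 a = x := by
  change (∑ p : Pair, if a ∈ p.set then x else 0) = x
  revert x a
  decide +kernel

lemma hmap_constAug (n : ℕ) : hmap constAug n = 0 := by
  rw [constAug, hmap_comp, hmap_comp, hmap_pull, LinearMap.comp_zero, LinearMap.zero_comp]

lemma partner_equivariant : ∀ (g : A4) (y : Via toC3) (f : Fin 4 → ZMod 2), ∑ a, f a = 0 →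
    f (g • 3) + f (g • partner y) = f 3 + f (partner (g • y)) := by
  decide +kernel

lemma sum_partner : ∀ f : Fin 4 → ZMod 2, ∑ y, (f 3 + f (partner y)) = ∑ a, f a := by
  decide +kernel

/-- The pairing that matches `a` with `3`. -/
def unpartner (a : Fin 4) : Via toC3 := ⟨Multiplicative.ofAdd (a.val : ZMod 3)⟩

lemma partner_unpartner : ∀ a : Fin 4, a = 3 ∨ partner (unpartner a) = a := by decide +kernel

lemma partner_ne : ∀ y : Via toC3, partner y ≠ 3 := by decide +kernel
lemma unpartner_partner : ∀ y : Via toC3, unpartner (partner y) = y := by decide +kernel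

/-- The map `E4 ⟶ W3` summing a function over either pair of a pairing. -/
noncomputable def augToAug : E4 ⟶ W3 :=
  Rep.ofHom ⟨LinearMap.restrict
    { toFun (f : Fin 4 → ZMod 2) (y : Via toC3) := f 3 + f (partner y)
      map_add' f g := funext fun y => add_add_add_comm _ _ _ _
      map_smul' c f := funext fun y => (smul_add c _ _).symm }
    (fun (f : Fin 4 → ZMod 2) hf => by
      rw [LinearMap.mem_ker, sumLin_apply] at hf ⊢
      exact (sum_partner f).trans hf),
    fun g => LinearMap.ext fun f => Subtype.ext <| funext fun y =>
      partner_equivariant g⁻¹ y f.1 ((sumLin_apply _ _ f.1).symm.trans f.2)⟩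

lemma ses_augToAug : SES constAug augToAug where
  inj x y h := by
    rw [← constAug_apply x 0, h, constAug_apply]
  exact (f : (sumLin (Fin 4) (ZMod 2)).ker) := by
    constructor
    · intro h
      refine ⟨f.1 3, Subtype.ext <| funext fun a => (constAug_apply _ a).trans ?_⟩
      obtain rfl | ha := partner_unpartner a
      · rfl
      · have := eq_of_add_eq_zero _ _ (congrFun (congrArg Subtype.val h) (unpartner a))
        rwa [ha] at this
    · rintro ⟨x, rfl⟩
      refine Subtype.ext <| funext fun y => ?_
      change (constAug.hom x).1 3 + (constAug.hom x).1 (partner y) = 0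
      rw [constAug_apply, constAug_apply]
      exact CharTwo.add_self_eq_zero x
  surj (w : (sumLin (Via toC3) (ZMod 2)).ker) := by
    let f : Fin 4 → ZMod 2 := fun a => if a = 3 then 0 else w.1 (unpartner a)
    have hf (y : Via toC3) : f 3 + f (partner y) = w.1 y := by
      simp [f, partner_ne, unpartner_partner]
    refine ⟨⟨f, ?_⟩, Subtype.ext <| funext hf⟩
    rw [LinearMap.mem_ker, sumLin_apply, ← sum_partner, Finset.sum_congr rfl fun y _ => hf y]
    exact (sumLin_apply _ _ w.1).symm.trans w.2

lemma card_W3_succ (n : ℕ) : Nat.card (groupHomology W3 (n + 1)) =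
    Nat.card (groupHomology E4 (n + 1)) * Nat.card (groupHomology F2 n) := by
  have hm := ses_augToAug.card_mid (n + 1)
  rw [card_range_of_eq_zero _ (hmap_constAug _), one_mul] at hm
  rw [ses_augToAug.card_right, ← hm, card_ker_of_eq_zero _ (hmap_constAug n)]

lemma card_W3_zero : Nat.card (groupHomology W3 0) = Nat.card (groupHomology E4 0) := by
  have hm := ses_augToAug.card_mid 0
  rw [card_range_of_eq_zero _ (hmap_constAug _), one_mul,
    card_range_of_surjective _ ses_augToAug.surj₀] at hm
  exact hm.symm

lemma hmap_sum_R3_surjective (n : ℕ) :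
    Function.Surjective (hmap (sumHom A4 (Via toC3) (ZMod 2)) n) := fun x => by
  refine ⟨hmap (constHom A4 (Via toC3) (ZMod 2)) n x, ?_⟩
  rw [hmap_sum_const]
  change 3 • x = x
  rw [succ_nsmul, two_nsmul_trivial, zero_add]

instance : Nonempty (Via toC3) := ⟨Via.base toC3⟩

lemma card_mul_W3 (n : ℕ) :
    Nat.card (groupHomology W3 n) * Nat.card (groupHomology F2 n) = 2 ^ (n + 1) := by
  have hs := ses_aug A4 (Via toC3) (ZMod 2)
  have hm := hs.card_mid n
  have hr := hs.card_right n
  rw [card_range_of_surjective _ (hmap_sum_R3_surjective _)] at hm hr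
  have hk : Nat.card (hmap (augHom A4 (Via toC3) (ZMod 2)) n).ker = 1 := by
    refine Nat.eq_of_mul_eq_mul_left (Nat.card_pos (α := groupHomology F2 (n + 1))) ?_
    rw [← hr, mul_one]
  have := card_eq_ker_mul_range (hmap (augHom A4 (Via toC3) (ZMod 2)) n)
  rw [hk, one_mul] at this
  rw [this, ← hm, card_R3]

lemma card_F2_add_two (n : ℕ) :
    Nat.card (groupHomology F2 (n + 2)) = Nat.card (groupHomology E4 (n + 1)) := by
  have hs := ses_aug A4 (Fin 4) (ZMod 2)
  have h₁ := subsingleton_R4 n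
  have h₂ := subsingleton_R4 (n + 1)
  have e₁ : hmap (augHom A4 (Fin 4) (ZMod 2)) (n + 1) = 0 :=
    LinearMap.ext fun x => Subsingleton.elim _ _
  have e₂ : hmap (sumHom A4 (Fin 4) (ZMod 2)) (n + 1 + 1) = 0 :=
    LinearMap.ext fun x => by rw [Subsingleton.elim x 0, map_zero, map_zero]
  rw [hs.card_right, card_ker_of_eq_zero _ e₁, card_range_of_eq_zero _ e₂, one_mul]

lemma card_F2_zero : Nat.card (groupHomology F2 0) = 2 := card_H0 A4

lemma card_F2_one : Nat.card (groupHomology F2 1) = 1 := by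
  have h := card_mul_W3 0
  rw [card_F2_zero, card_W3_zero] at h
  have h1 : Nat.card (groupHomology E4 0) = 1 := by omega
  have := (Nat.card_eq_one_iff_unique.1 h1).1
  have := subsingleton_R4 0
  have e : hmap (sumHom A4 (Fin 4) (ZMod 2)) (0 + 1) = 0 :=
    LinearMap.ext fun x => by rw [Subsingleton.elim x 0, map_zero, map_zero]
  rw [(ses_aug A4 (Fin 4) (ZMod 2)).card_right 0, card_range_of_eq_zero _ e, one_mul,
    Nat.card_of_subsingleton 0]

lemma card_F2_mul (n : ℕ) : Nat.card (groupHomology F2 n) * Nat.card (groupHomology F2 (n + 1)) *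
    Nat.card (groupHomology F2 (n + 2)) = 2 ^ (n + 2) := by
  rw [← card_mul_W3 (n + 1), card_W3_succ, card_F2_add_two]
  ring

theorem card_F2 (m : ℕ) : Nat.card (groupHomology F2 (3 * m)) = 2 ^ (m + 1) ∧
    Nat.card (groupHomology F2 (3 * m + 1)) = 2 ^ m ∧
    Nat.card (groupHomology F2 (3 * m + 2)) = 2 ^ (m + 1) := by
  have third (n a b : ℕ) (h₀ : Nat.card (groupHomology F2 n) = 2 ^ a)
      (h₁ : Nat.card (groupHomology F2 (n + 1)) = 2 ^ b) (c : ℕ) (hc : a + b + c = n + 2) :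
      Nat.card (groupHomology F2 (n + 2)) = 2 ^ c := by
    have := card_F2_mul n
    rw [h₀, h₁, show 2 ^ (n + 2) = 2 ^ a * 2 ^ b * 2 ^ c by rw [← hc, pow_add, pow_add]] at this
    exact Nat.eq_of_mul_eq_mul_left (by positivity : 0 < 2 ^ a * 2 ^ b) this
  induction m with
  | zero =>
    exact ⟨card_F2_zero, card_F2_one, third 0 1 0 card_F2_zero card_F2_one 1 rfl⟩
  | succ m ih =>
    have h₀ := third _ _ _ ih.2.1 ih.2.2 (m + 2) (by omega)
    have h₁ := third _ _ _ ih.2.2 h₀ (m + 1) (by omega)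
    exact ⟨h₀, h₁, third _ _ _ h₀ h₁ (m + 2) (by omega)⟩

lemma nonempty_addEquiv_of_module (p a : ℕ) [Fact p.Prime] (M : Type) [AddCommGroup M]
    [Module (ZMod p) M] (hc : Nat.card M = p ^ a) : Nonempty (M ≃+ (Fin a → ZMod p)) := by
  have hp := (Fact.out : p.Prime)
  have : Finite M := Nat.finite_of_card_ne_zero (by rw [hc]; exact (pow_pos hp.pos a).ne')
  have hr := FiniteField.pow_finrank_eq_natCard p M
  rw [hc] at hr
  exact ⟨(Module.finBasisOfFinrankEq (ZMod p) M
    (Nat.pow_right_injective hp.two_le hr)).equivFun.toAddEquiv⟩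

lemma nonempty_addEquiv_of_nsmul_eq_zero (p a : ℕ) [Fact p.Prime] (M : Type) [AddCommGroup M]
    (h : ∀ x : M, p • x = 0) (hc : Nat.card M = p ^ a) : Nonempty (M ≃+ (Fin a → ZMod p)) :=
  let _ := AddCommGroup.zmodModule h
  nonempty_addEquiv_of_module p a M hc

/-- The trivial representation of `A4` on the integers. -/
noncomputable abbrev Z : Rep ℤ A4 := Rep.trivial ℤ A4 ℤ

lemma six_nsmul (n : ℕ) (x : groupHomology Z (n + 1)) : 6 • x = 0 :=
  nsmul_eq_zero_of_stabilizer (A := ℤ) ofV ofV_injective _ ofV_range (n + 1) 2 (two_nsmul_V n) x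

instance finite_Z (n : ℕ) : Finite (groupHomology Z (n + 1)) :=
  finite_of_nsmul_eq_zero (by decide : 6 ≠ 0) (six_nsmul n)

/-- Multiplication by two on integral homology. -/
noncomputable def doubling (n : ℕ) : groupHomology Z n →ₗ[ℤ] groupHomology Z n := hmap (2 • 𝟙 Z) n

lemma doubling_apply (n : ℕ) (x : groupHomology Z n) : doubling n x = 2 • x := by
  rw [doubling, hmap_nsmul, hmap_id]
  rfl

/-- Reduction modulo 2. -/
noncomputable def reduction : Z ⟶ F2 :=
  Rep.ofHom ⟨(Int.castAddHom (ZMod 2)).toIntLinearMap, fun _ => rfl⟩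

lemma ses_doubling : SES (2 • 𝟙 Z) reduction where
  inj (x : ℤ) (y : ℤ) h := by
    change 2 • x = 2 • y at h
    simpa using h
  exact (x : ℤ) := by
    change ((x : ℤ) : ZMod 2) = 0 ↔ ∃ y : ℤ, 2 • y = x
    rw [ZMod.intCast_zmod_eq_zero_iff_dvd, dvd_def]
    simp [eq_comm]
  surj (x : ZMod 2) := ZMod.intCast_surjective x

lemma card_F2_succ (n : ℕ) : Nat.card (groupHomology F2 (n + 1)) =
    Nat.card (doubling (n + 1)).ker * Nat.card (doubling n).ker := by
  have hm := ses_doubling.card_mid (n + 1)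
  have hk := card_eq_ker_mul_range (doubling (n + 1))
  rw [mul_comm] at hk
  have := Nat.eq_of_mul_eq_mul_left Nat.card_pos (hm.symm.trans hk)
  rw [ses_doubling.card_right, this]
  rfl

lemma card_ker_doubling_zero : Nat.card (doubling 0).ker = 1 := by
  refine card_ker_of_injective _ fun x y h => (H0Equiv (G := A4) ℤ).injective ?_
  rw [doubling_apply, doubling_apply] at h
  have := congrArg (H0Equiv (G := A4) ℤ) h
  rw [map_nsmul, map_nsmul] at this
  exact nsmul_right_injective two_ne_zero this

lemma card_ker_doubling_succ {n m a b c : ℕ} (h : Nat.card (doubling n).ker = 2 ^ a)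
    (hf : Nat.card (groupHomology F2 m) = 2 ^ c) (hm : m = n + 1) (hc : b + a = c) :
    Nat.card (doubling (n + 1)).ker = 2 ^ b := by
  subst hm
  rw [card_F2_succ, h, ← hc, pow_add] at hf
  exact Nat.eq_of_mul_eq_mul_right (by positivity) hf

theorem card_ker_doubling_of_six_mul {k : ℕ} (h₀ : Nat.card (doubling (6 * k)).ker = 2 ^ k) :
    Nat.card (doubling (6 * k + 1)).ker = 2 ^ k ∧
    Nat.card (doubling (6 * k + 2)).ker = 2 ^ (k + 1) ∧
    Nat.card (doubling (6 * k + 3)).ker = 2 ^ (k + 1) ∧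
    Nat.card (doubling (6 * k + 4)).ker = 2 ^ k ∧
    Nat.card (doubling (6 * k + 5)).ker = 2 ^ (k + 2) ∧
    Nat.card (doubling (6 * k + 6)).ker = 2 ^ (k + 1) := by
  have h₁ := card_ker_doubling_succ (b := k) h₀ (card_F2 (2 * k)).2.1 (by ring) (by ring)
  have h₂ := card_ker_doubling_succ (b := k + 1) h₁ (card_F2 (2 * k)).2.2 (by ring) (by ring)
  have h₃ := card_ker_doubling_succ (b := k + 1) h₂ (card_F2 (2 * k + 1)).1 (by ring) (by ring)
  have h₄ := card_ker_doubling_succ (b := k) h₃ (card_F2 (2 * k + 1)).2.1 (by ring) (by ring)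
  have h₅ := card_ker_doubling_succ (b := k + 2) h₄ (card_F2 (2 * k + 1)).2.2 (by ring) (by ring)
  have h₆ := card_ker_doubling_succ (b := k + 1) h₅ (card_F2 (2 * k + 2)).1 (by ring) (by ring)
  exact ⟨h₁, h₂, h₃, h₄, h₅, h₆⟩

lemma card_ker_doubling_six_mul (k : ℕ) : Nat.card (doubling (6 * k)).ker = 2 ^ k := by
  induction k with
  | zero => exact card_ker_doubling_zero
  | succ k ih => exact (card_ker_doubling_of_six_mul ih).2.2.2.2.2

/-- The map induced on integral homology by the projection onto the cyclic group of order 3. -/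
noncomputable def toCyc (n : ℕ) :
    groupHomology Z n →ₗ[ℤ] groupHomology (Rep.trivial ℤ (Cyc 3) ℤ) n :=
  (groupHomology.map toC3 (trivRes toC3 ℤ) n).hom

instance finite_homology_cyc (n : ℕ) : Finite (groupHomology (Rep.trivial ℤ (Cyc 3) ℤ) (n + 1)) :=
  finite_of_nsmul_eq_zero three_ne_zero (cyc_nsmul 3 ℤ n)

lemma ker_toCyc (n : ℕ) : (toCyc (n + 1)).ker = (doubling (n + 1)).ker := by
  ext x
  rw [LinearMap.mem_ker, LinearMap.mem_ker, doubling_apply]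
  constructor
  · intro h
    have h4 : 4 • x = 0 := retract_A4.card_nsmul (A := ℤ) (n + 1) x h
    have h6 := six_nsmul n x
    rwa [show 6 = 2 + 4 from rfl, add_nsmul, h4, add_zero] at h6
  · intro h
    have h3 := cyc_nsmul 3 ℤ n (toCyc (n + 1) x)
    rwa [succ_nsmul, ← map_nsmul, h, map_zero, zero_add] at h3

lemma toCyc_surjective (n : ℕ) : Function.Surjective (toCyc n) := fun x =>
  ⟨_, retract_A4.map_map_surj n x⟩

/-- The splitting of integral homology into its 2-torsion and its 3-torsion. -/
noncomputable def splitting (n : ℕ) : groupHomology Z (n + 1) ≃+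
    (doubling (n + 1)).ker × groupHomology (Rep.trivial ℤ (Cyc 3) ℤ) (n + 1) :=
  AddEquiv.ofBijective
    ((AddMonoidHom.codRestrict (3 • AddMonoidHom.id _) (doubling (n + 1)).ker fun x => by
      rw [LinearMap.mem_ker, doubling_apply]
      change 2 • 3 • x = 0
      rw [← mul_nsmul, six_nsmul]).prod (toCyc (n + 1)).toAddMonoidHom) <| by
    refine (Nat.bijective_iff_injective_and_card _).2 ⟨?_, ?_⟩
    · refine (injective_iff_map_eq_zero _).2 fun x hx => ?_
      have h3 : 3 • x = 0 := congrArg Subtype.val (congrArg Prod.fst hx)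
      have h2 : x ∈ (toCyc (n + 1)).ker := congrArg Prod.snd hx
      rw [ker_toCyc, LinearMap.mem_ker, doubling_apply] at h2
      rwa [succ_nsmul, h2, zero_add] at h3
    · rw [Nat.card_prod, ← ker_toCyc, card_eq_ker_mul_range (toCyc (n + 1)),
        card_range_of_surjective _ (toCyc_surjective _)]

lemma nonempty_ker_doubling (n a : ℕ) (h : Nat.card (doubling n).ker = 2 ^ a) :
    Nonempty ((doubling n).ker ≃+ (Fin a → ZMod 2)) :=
  nonempty_addEquiv_of_nsmul_eq_zero 2 a _ (fun x => Subtype.ext <| by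
    have := x.2
    rwa [LinearMap.mem_ker, doubling_apply] at this) h

theorem nonempty_even (n a : ℕ) (hn : Even (n + 1)) (h : Nat.card (doubling (n + 1)).ker = 2 ^ a) :
    Nonempty (groupHomology Z (n + 1) ≃+ (Fin a → ZMod 2)) := by
  obtain ⟨e⟩ := nonempty_ker_doubling _ a h
  have := (Nat.card_eq_one_iff_unique.1 (card_cyc_even 3 (n + 1) hn)).1
  let _ : Unique (groupHomology (Rep.trivial ℤ (Cyc 3) ℤ) (n + 1)) := ⟨⟨0⟩, fun _ => Subsingleton.elim _ _⟩
  exact ⟨(splitting n).trans (AddEquiv.prodUnique.trans e)⟩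

theorem nonempty_odd (n a : ℕ) (hn : Odd (n + 1)) (h : Nat.card (doubling (n + 1)).ker = 2 ^ a) :
    Nonempty (groupHomology Z (n + 1) ≃+ (Fin a → ZMod 2) × ZMod 3) := by
  obtain ⟨e⟩ := nonempty_ker_doubling _ a h
  have hc := card_cyc_odd 3 (n + 1) hn
  have := isAddCyclic_of_prime_card hc
  exact ⟨(splitting n).trans (e.prodCongr (zmodAddCyclicAddEquiv this |>.symm.trans (by rw [hc]; exact .refl _)))⟩

lemma nonempty_snoc (k : ℕ) :
    Nonempty ((Fin (k + 1) → ZMod 2) ≃+ (Fin k → ZMod 2) × ZMod 2) := by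
  obtain ⟨e⟩ := nonempty_addEquiv_of_nsmul_eq_zero 2 (k + 1) ((Fin k → ZMod 2) × ZMod 2)
    (fun x => Prod.ext (funext fun _ => (by decide : ∀ a : ZMod 2, 2 • a = 0) _)
      ((by decide : ∀ a : ZMod 2, 2 • a = 0) _)) (by simp [pow_succ])
  exact ⟨e.symm⟩

/-- The Chinese remainder isomorphism. -/
noncomputable def zmodSix : ZMod 2 × ZMod 3 ≃+ ZMod 6 :=
  (ZMod.chineseRemainder (by decide : Nat.Coprime 2 3)).symm.toAddEquiv

section Bridge
variable {k G : Type} [CommRing k] [Group G]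

lemma exact_d_π (M : Rep k G) (n : ℕ) (x : groupHomology.cycles M n) :
    (groupHomology.π M n).hom x = 0 ↔
      ∃ y : (Fin (n + 1) → G) →₀ M, (groupHomology.inhomogeneousChains.d M n).hom y =
        (groupHomology.iCycles M n).hom x := by
  have he := ShortComplex.exact_of_g_is_cokernel 
    (ShortComplex.mk _ _ ((groupHomology.inhomogeneousChains M).toCycles_comp_homologyπ (n + 1) n))
    ((groupHomology.inhomogeneousChains M).homologyIsCokernel (n + 1) n (by simp))
  rw [ShortComplex.ShortExact.moduleCat_exact_iff_function_exact] at he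
  refine (he x).trans (exists_congr fun y => ?_)
  rw [← (iCycles_injective M n).eq_iff]
  have := congrArg (fun f => f.hom y) ((groupHomology.inhomogeneousChains M).toCycles_i (n + 1) n)
  rw [groupHomology.inhomogeneousChains.d_def] at this
  exact Eq.congr_left this

variable {A : Type} [AddCommGroup A] [Module k A]

lemma exists_iCycles (n : ℕ) (x : (Fin (n + 1) → G) →₀ A) (hx : d k G A n x = 0) :
    ∃ y : groupHomology.cycles (Rep.trivial k G A) (n + 1),
      (groupHomology.iCycles (Rep.trivial k G A) (n + 1)).hom y = x :=
  ⟨groupHomology.cyclesMk (A := Rep.trivial k G A) (n + 1) n (by simp) x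
    (by rw [groupHomology.inhomogeneousChains.d_def]; exact hx), groupHomology.iCycles_mk _ _ _⟩

lemma d_iCycles (n : ℕ) (y : groupHomology.cycles (Rep.trivial k G A) (n + 1)) :
    d k G A n ((groupHomology.iCycles (Rep.trivial k G A) (n + 1)).hom y) = 0 := by
  have := congrArg (fun f => f.hom y)
    ((groupHomology.inhomogeneousChains (Rep.trivial k G A)).iCycles_d (n + 1) n)
  rw [groupHomology.inhomogeneousChains.d_def] at this
  exact this

/-- The cycles of the explicit bar complex agree with those of `groupHomology`. -/
noncomputable def cyclesEquiv (n : ℕ) :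
    groupHomology.cycles (Rep.trivial k G A) (n + 1) ≃ₗ[k] BarHomology.cycles k G A (n + 1) :=
  LinearEquiv.ofBijective
    (LinearMap.codRestrict _ (groupHomology.iCycles (Rep.trivial k G A) (n + 1)).hom (d_iCycles n))
    ⟨fun x y h => iCycles_injective _ _ (congrArg Subtype.val h), fun x => by
      obtain ⟨y, hy⟩ := exists_iCycles n x.1 x.2
      exact ⟨y, Subtype.ext hy⟩⟩

/-- The homology of the explicit bar complex agrees with `groupHomology`. -/
noncomputable def homologyEquiv (n : ℕ) :
    GroupHomology k G A (n + 1) ≃ₗ[k] groupHomology (Rep.trivial k G A) (n + 1) :=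
  (Submodule.quotEquivOfEq _ _ <| by
    ext x
    obtain ⟨y, rfl⟩ := (cyclesEquiv n).surjective x
    rw [LinearMap.mem_ker, LinearMap.comp_apply]
    erw [LinearEquiv.symm_apply_apply, exact_d_π]
    rfl).trans
  (((groupHomology.π (Rep.trivial k G A) (n + 1)).hom ∘ₗ
    (cyclesEquiv n).symm.toLinearMap).quotKerEquivOfSurjective
    ((π_surjective _ _).comp (cyclesEquiv n).symm.surjective))

end Bridge

end HomologyA4

open HomologyA4

/-- The integral homology of the alternating group `A₄` in positive degrees. -/
theorem homology_A4 (k : ℕ) :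
    Nonempty (GroupHomology ℤ (↥(alternatingGroup (Fin 4))) ℤ (6 * k + 1) ≃+ ((Fin k → ZMod 2) × ZMod 3)) ∧
    Nonempty (GroupHomology ℤ (↥(alternatingGroup (Fin 4))) ℤ (6 * k + 2) ≃+ ((Fin k → ZMod 2) × ZMod 2)) ∧
    Nonempty (GroupHomology ℤ (↥(alternatingGroup (Fin 4))) ℤ (6 * k + 3) ≃+ ((Fin k → ZMod 2) × ZMod 6)) ∧
    Nonempty (GroupHomology ℤ (↥(alternatingGroup (Fin 4))) ℤ (6 * k + 4) ≃+ (Fin k → ZMod 2)) ∧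
    Nonempty (GroupHomology ℤ (↥(alternatingGroup (Fin 4))) ℤ (6 * k + 5) ≃+ ((Fin k → ZMod 2) × ZMod 2 × ZMod 6)) ∧
    Nonempty (GroupHomology ℤ (↥(alternatingGroup (Fin 4))) ℤ (6 * k + 6) ≃+ (Fin (k + 1) → ZMod 2)) := by
  obtain ⟨h₁, h₂, h₃, h₄, h₅, h₆⟩ :=
    card_ker_doubling_of_six_mul (card_ker_doubling_six_mul k)
  obtain ⟨s⟩ := nonempty_snoc k
  obtain ⟨s'⟩ := nonempty_snoc (k + 1)
  obtain ⟨e₁⟩ := nonempty_odd (6 * k) k ⟨3 * k, by ring⟩ h₁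
  obtain ⟨e₂⟩ := nonempty_even (6 * k + 1) (k + 1) ⟨3 * k + 1, by ring⟩ h₂
  obtain ⟨e₃⟩ := nonempty_odd (6 * k + 2) (k + 1) ⟨3 * k + 1, by ring⟩ h₃
  obtain ⟨e₄⟩ := nonempty_even (6 * k + 3) k ⟨3 * k + 2, by ring⟩ h₄
  obtain ⟨e₅⟩ := nonempty_odd (6 * k + 4) (k + 2) ⟨3 * k + 2, by ring⟩ h₅
  obtain ⟨e₆⟩ := nonempty_even (6 * k + 5) (k + 1) ⟨3 * k + 3, by ring⟩ h₆
  have t : (Fin (k + 1) → ZMod 2) × ZMod 3 ≃+ (Fin k → ZMod 2) × ZMod 6 :=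
    (s.prodCongr (.refl _)).trans (AddEquiv.prodAssoc.trans ((AddEquiv.refl _).prodCongr zmodSix))
  have t' : (Fin (k + 2) → ZMod 2) × ZMod 3 ≃+ (Fin k → ZMod 2) × ZMod 2 × ZMod 6 :=
    (s'.prodCongr (.refl _)).trans <| AddEquiv.prodAssoc.trans <|
      (s.prodCongr zmodSix).trans AddEquiv.prodAssoc
  have b (n : ℕ) := (homologyEquiv (k := ℤ) (G := A4) (A := ℤ) n).toAddEquiv
  exact ⟨⟨(b _).trans e₁⟩, ⟨(b _).trans (e₂.trans s)⟩, ⟨(b _).trans (e₃.trans t)⟩, ⟨(b _).trans e₄⟩,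
    ⟨(b _).trans (e₅.trans t')⟩, ⟨(b _).trans e₆⟩⟩
end
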